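/- Let X be a nonempty compact simply connected topological 3-dimensional manifold with boundary. Then every connected component of the boundary ∂X is homeomorphic to the 2-sphere S². -/

import Mathlib

noncomputable section

set_option linter.unusedSectionVars false
set_option linter.unusedVariables false

namespace CubicalChain

open Set Topology unitInterval

/-- Singular `k`-cubes of `X`. -/
abbrev Cube (k : ℕ) (X : Type) [TopologicalSpace X] := C(Fin k → I, X)

/-- Cubical singular chains with coefficients in `ℤ/2`. -/
abbrev Chain (k : ℕ) (X : Type) [TopologicalSpace X] := Cube k X →₀ ZMod 2

variable {X Y Z : Type} [TopologicalSpace X] [TopologicalSpace Y] [TopologicalSpace Z] {k : ℕ}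

lemma add_self {k : ℕ} {X : Type} [TopologicalSpace X] (z : Chain k X) : z + z = 0 := by
  ext c
  exact CharTwo.add_self_eq_zero _

lemma add_self_cancel (z w : Chain k X) : z + (z + w) = w := by
  rw [← add_assoc, add_self, zero_add]

/-- The chain consisting of one cube. -/
abbrev gen (c : Cube k X) : Chain k X := Finsupp.single c 1

/-- The linear extension of a map defined on cubes. -/
def ext {l : ℕ} (φ : Cube k X → Chain l Y) : Chain k X →ₗ[ZMod 2] Chain l Y :=
  Finsupp.linearCombination (ZMod 2) φ

@[simp] lemma ext_gen {l : ℕ} (φ : Cube k X → Chain l Y) (c : Cube k X) : ext φ (gen c) = φ c := by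
  simp [ext]

/-- To prove a linear statement about chains it suffices to check cubes. -/
lemma chain_hom_ext {M : Type*} [AddCommMonoid M] [Module (ZMod 2) M]
    {f g : Chain k X →ₗ[ZMod 2] M} (h : ∀ c, f (gen c) = g (gen c)) : f = g :=
  Finsupp.lhom_ext' fun c => LinearMap.ext_ring (h c)

/-- The inclusion of a face of the cube. -/
def face (i : Fin (k + 1)) (b : I) : C(Fin k → I, Fin (k + 1) → I) where
  toFun x := i.insertNth b x
  continuous_toFun := continuous_const.finInsertNth i continuous_id

@[simp] lemma face_apply (i : Fin (k + 1)) (b : I) (x : Fin k → I) :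
    face i b x = i.insertNth b x := rfl

lemma face_comm (i : Fin (k + 2)) (j : Fin (k + 1)) (a b : I) :
    (face i a).comp (face j b) = (face (i.succAbove j) b).comp (face (j.predAbove i) a) := by
  ext1 x
  simp only [ContinuousMap.comp_apply, face_apply]
  rw [Fin.insertNth_eq_iff]
  refine ⟨?_, ?_⟩
  · have := Fin.insertNth_apply_succAbove (α := fun _ => I) (i.succAbove j) b
      ((j.predAbove i).insertNth a x) (j.predAbove i)
    rw [Fin.succAbove_succAbove_predAbove, Fin.insertNth_apply_same] at this
    exact this.symm
  · funext l
    simp only [Fin.removeNth]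
    rcases Fin.eq_self_or_eq_succAbove j l with rfl | ⟨m, rfl⟩
    · simp
    · rw [Fin.insertNth_apply_succAbove, ← Fin.succAbove_succAbove_succAbove_predAbove,
        Fin.insertNth_apply_succAbove, Fin.insertNth_apply_succAbove]

/-- The boundary operator. -/
def bd : Chain (k + 1) X →ₗ[ZMod 2] Chain k X :=
  ext fun c => ∑ i, (gen (c.comp (face i 0)) + gen (c.comp (face i 1)))

lemma bd_gen (c : Cube (k + 1) X) :
    bd (gen c) = ∑ i, (gen (c.comp (face i 0)) + gen (c.comp (face i 1))) := ext_gen _ _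

lemma bd_bd (z : Chain (k + 2) X) : bd (bd z) = 0 := by
  suffices h : (bd ∘ₗ bd : Chain (k + 2) X →ₗ[ZMod 2] Chain k X) = 0 from LinearMap.congr_fun h z
  refine chain_hom_ext fun c => ?_
  rw [LinearMap.comp_apply, LinearMap.zero_apply, bd_gen, map_sum]
  simp_rw [map_add, bd_gen, ContinuousMap.comp_assoc]
  simp_rw [← Finset.sum_add_distrib]
  rw [← Finset.sum_product', Finset.univ_product_univ]
  refine Finset.sum_involution (fun p _ => (p.1.succAbove p.2, p.2.predAbove p.1)) ?_ ?_ ?_ ?_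
  · rintro ⟨i, j⟩ -
    dsimp only
    simp only [face_comm i j]
    have h (a b e d : Chain k X) : a + b + (e + d) + (a + e + (b + d)) = 0 := by
      grind [add_self a, add_self b, add_self e, add_self d]
    exact h _ _ _ _
  · rintro ⟨i, j⟩ - - h
    exact Fin.succAbove_ne i j (congrArg Prod.fst h)
  · simp
  · rintro ⟨i, j⟩ -
    simp only [Fin.succAbove_succAbove_predAbove, Fin.predAbove_predAbove_succAbove]

/-- The chain map induced by a continuous map. -/
def map (f : C(X, Y)) : Chain k X →ₗ[ZMod 2] Chain k Y := ext fun c => gen (f.comp c)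

@[simp] lemma map_gen (f : C(X, Y)) (c : Cube k X) : map f (gen c) = gen (f.comp c) := ext_gen _ _

lemma bd_map (f : C(X, Y)) (z : Chain (k + 1) X) : bd (map f z) = map f (bd z) := by
  suffices h : (bd ∘ₗ map f : Chain (k + 1) X →ₗ[ZMod 2] Chain k Y) = map f ∘ₗ bd from
    LinearMap.congr_fun h z
  refine chain_hom_ext fun c => ?_
  simp [bd_gen, map_sum, ContinuousMap.comp_assoc]

lemma map_map (g : C(Y, Z)) (f : C(X, Y)) (z : Chain k X) : map g (map f z) = map (g.comp f) z := by
  suffices h : (map g ∘ₗ map f : Chain k X →ₗ[ZMod 2] Chain k Z) = map (g.comp f) from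
    LinearMap.congr_fun h z
  exact chain_hom_ext fun c => by simp [ContinuousMap.comp_assoc]

lemma map_id (z : Chain k X) : map (ContinuousMap.id X) z = z := by
  suffices h : (map (ContinuousMap.id X) : Chain k X →ₗ[ZMod 2] Chain k X) = LinearMap.id from
    LinearMap.congr_fun h z
  exact chain_hom_ext fun c => by simp

/-- A cube is degenerate if it does not depend on one of its coordinates. -/
def Degen (c : Cube k X) : Prop := ∃ i, ∀ x a, c (Function.update x i a) = c x

/-- The chains all of whose nondegenerate cubes lie in `U`. -/
def A (k : ℕ) (U : Set X) : Submodule (ZMod 2) (Chain k X) :=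
  Finsupp.supported (ZMod 2) (ZMod 2) {c | range c ⊆ U ∨ Degen c}

lemma gen_mem {U : Set X} {c : Cube k X} (h : range c ⊆ U ∨ Degen c) : gen c ∈ A k U :=
  Finsupp.single_mem_supported _ _ h

lemma ext_mem {l : ℕ} {U : Set X} {V : Submodule (ZMod 2) (Chain l Y)} {φ : Cube k X → Chain l Y}
    (h : ∀ c : Cube k X, range c ⊆ U ∨ Degen c → φ c ∈ V) {z : Chain k X} (hz : z ∈ A k U) : ext φ z ∈ V := by
  rw [ext, Finsupp.linearCombination_apply, Finsupp.sum]
  exact Submodule.sum_mem _ fun c hc => Submodule.smul_mem _ _ (h c (hz hc))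

lemma A_mono {U V : Set X} (h : U ⊆ V) : A k U ≤ A k V :=
  Finsupp.supported_mono fun _ hc => hc.imp_left fun hc => hc.trans h

lemma A_inter {U V : Set X} {z : Chain k X} (hU : z ∈ A k U) (hV : z ∈ A k V) :
    z ∈ A k (U ∩ V) := fun c hc => by
  rcases hU hc with h | h
  · rcases hV hc with h' | h'
    · exact Or.inl (subset_inter h h')
    · exact Or.inr h'
  · exact Or.inr h

lemma A_univ (z : Chain k X) : z ∈ A k (univ : Set X) := fun _ _ => Or.inl (subset_univ _)

lemma A_empty_le (U : Set X) : A k (∅ : Set X) ≤ A k U := A_mono (empty_subset U)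

/-- The union of the images of the nondegenerate cubes of a chain. -/
def supp (z : Chain k X) : Set X := ⋃ c ∈ {c ∈ (z.support : Set (Cube k X)) | ¬ Degen c}, range c

lemma mem_A_iff {z : Chain k X} {U : Set X} : z ∈ A k U ↔ supp z ⊆ U := by
  simp only [supp, iUnion_subset_iff]
  refine ⟨fun h c hc => (h hc.1).resolve_right hc.2, fun h c hc => ?_⟩
  by_cases hd : Degen c
  · exact Or.inr hd
  · exact Or.inl (h c ⟨hc, hd⟩)

lemma mem_A_supp (z : Chain k X) : z ∈ A k (supp z) := mem_A_iff.2 subset_rfl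

lemma isCompact_supp (z : Chain k X) : IsCompact (supp z) :=
  ((Finset.finite_toSet z.support).subset (sep_subset _ _)).isCompact_biUnion
    fun c _ => isCompact_range c.continuous

lemma Degen.comp {c : Cube k X} (h : Degen c) (f : C(X, Y)) : Degen (f.comp c) := by
  obtain ⟨i, hi⟩ := h
  exact ⟨i, fun x a => by simp [hi]⟩

lemma range_comp_subset (c : C(X, Y)) (f : C(Z, X)) : range (c.comp f) ⊆ range c :=
  range_subset_iff.2 fun _ => mem_range_self _

lemma bd_mem {U : Set X} {z : Chain (k + 1) X} (hz : z ∈ A (k + 1) U) : bd z ∈ A k U := by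
  refine ext_mem (fun c hc => ?_) hz
  rcases hc with hc | ⟨i, hi⟩
  · exact Submodule.sum_mem _ fun i _ => Submodule.add_mem _
      (gen_mem (Or.inl ((range_comp_subset _ _).trans hc)))
      (gen_mem (Or.inl ((range_comp_subset _ _).trans hc)))
  · refine Submodule.sum_mem _ fun j _ => ?_
    rcases Fin.eq_self_or_eq_succAbove j i with rfl | ⟨m, rfl⟩
    · have : c.comp (face i 0) = c.comp (face i 1) := by
        ext1 x
        have := hi (i.insertNth 0 x) 1
        simpa using this.symm
      rw [this, add_self]
      exact Submodule.zero_mem _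
    · have (b : I) : Degen (c.comp (face j b)) :=
        ⟨m, fun x a => by simpa [Fin.insertNth_update] using hi (j.insertNth b x) a⟩
      exact Submodule.add_mem _ (gen_mem (Or.inr (this 0))) (gen_mem (Or.inr (this 1)))

lemma map_mem {U : Set X} {V : Set Y} (f : C(X, Y)) (h : MapsTo f U V) {z : Chain k X}
    (hz : z ∈ A k U) : map f z ∈ A k V := by
  refine ext_mem (fun c hc => gen_mem ?_) hz
  refine hc.imp (fun hc => ?_) fun hc => hc.comp f
  rintro _ ⟨x, rfl⟩
  exact h (hc (mem_range_self x))

/-- The prism operator of a homotopy. -/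
def prismCube (H : C(I × X, Y)) (c : Cube k X) : Cube (k + 1) Y where
  toFun x := H (x 0, c (Fin.tail x))
  continuous_toFun := by unfold Fin.tail; fun_prop

/-- The prism operator of a homotopy. -/
def prism (H : C(I × X, Y)) : Chain k X →ₗ[ZMod 2] Chain (k + 1) Y :=
  ext fun c => gen (prismCube H c)

/-- The map at a fixed time of a homotopy. -/
def slice (H : C(I × X, Y)) (t : I) : C(X, Y) where
  toFun x := H (t, x)

@[simp] lemma slice_apply (H : C(I × X, Y)) (t : I) (x : X) : slice H t x = H (t, x) := rfl

@[simp] lemma prism_gen (H : C(I × X, Y)) (c : Cube k X) :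
    prism H (gen c) = gen (prismCube H c) := ext_gen _ _

lemma prismCube_face_zero (H : C(I × X, Y)) (c : Cube k X) (b : I) :
    (prismCube H c).comp (face 0 b) = (slice H b).comp c := by
  ext1 x
  simp [prismCube]

lemma prismCube_face_succ (H : C(I × X, Y)) (c : Cube (k + 1) X) (i : Fin (k + 1)) (b : I) :
    (prismCube H c).comp (face i.succ b) = prismCube H (c.comp (face i b)) := by
  ext1 x
  obtain ⟨t, y, rfl⟩ : ∃ t y, x = Fin.cons t y := ⟨x 0, Fin.tail x, (Fin.cons_self_tail x).symm⟩
  simp [prismCube, Fin.insertNth_succ_cons]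

lemma bd_prism (H : C(I × X, Y)) (z : Chain (k + 1) X) :
    bd (prism H z) = map (slice H 0) z + map (slice H 1) z + prism H (bd z) := by
  suffices h : (bd ∘ₗ prism H : Chain (k + 1) X →ₗ[ZMod 2] Chain (k + 1) Y) =
      map (slice H 0) + map (slice H 1) + prism H ∘ₗ bd from LinearMap.congr_fun h z
  refine chain_hom_ext fun c => ?_
  rw [LinearMap.comp_apply, prism_gen, bd_gen, Fin.sum_univ_succ]
  simp [prismCube_face_zero, prismCube_face_succ, bd_gen]

lemma bd_prism_zero (H : C(I × X, Y)) (z : Chain 0 X) :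
    bd (prism H z) = map (slice H 0) z + map (slice H 1) z := by
  suffices h : (bd ∘ₗ prism H : Chain 0 X →ₗ[ZMod 2] Chain 0 Y) =
      map (slice H 0) + map (slice H 1) from LinearMap.congr_fun h z
  refine chain_hom_ext fun c => ?_
  rw [LinearMap.comp_apply, prism_gen, bd_gen, Fin.sum_univ_succ]
  simp [prismCube_face_zero]

lemma prism_mem {U : Set X} {V : Set Y} (H : C(I × X, Y)) (h : ∀ t, ∀ x ∈ U, H (t, x) ∈ V)
    {z : Chain k X} (hz : z ∈ A k U) : prism H z ∈ A (k + 1) V := by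
  refine ext_mem (fun c hc => gen_mem ?_) hz
  refine hc.imp (fun hc => ?_) fun ⟨i, hi⟩ => ⟨i.succ, fun x a => ?_⟩
  · rintro _ ⟨x, rfl⟩
    exact h _ _ (hc (mem_range_self _))
  · obtain ⟨t, y, rfl⟩ : ∃ t y, x = Fin.cons t y := ⟨x 0, Fin.tail x, (Fin.cons_self_tail x).symm⟩
    simp [prismCube, ← Fin.cons_update, hi]

lemma map_const_mem (p : Y) (z : Chain (k + 1) X) :
    map (ContinuousMap.const X p) z ∈ A (k + 1) (∅ : Set Y) :=
  ext_mem (U := univ) (fun _ _ => gen_mem (Or.inr ⟨0, fun _ _ => rfl⟩)) (A_univ z)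

end CubicalChain

namespace CubicalChain

open Set Topology unitInterval

variable {X Y Z : Type} [TopologicalSpace X] [TopologicalSpace Y] [TopologicalSpace Z] {k : ℕ}

/-- The two affine halves of the unit interval. -/
def half (e : Bool) : C(I, I) where
  toFun t := ⟨((t : ℝ) + (if e then 1 else 0)) / 2, by
    have := t.2.1; have := t.2.2; cases e <;> constructor <;> simp <;> linarith⟩
  continuous_toFun := by
    refine Continuous.subtype_mk ?_ _
    fun_prop

lemma half_true_zero : half true 0 = half false 1 := by
  ext; simp [half]

lemma half_false_zero : half false 0 = 0 := by
  ext; simp [half]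

lemma half_true_one : half true 1 = 1 := by
  ext; simp [half]

/-- The affine inclusion of one of the `2 ^ k` subcubes. -/
def subcube (ε : Fin k → Bool) : C(Fin k → I, Fin k → I) where
  toFun x i := half (ε i) (x i)

@[simp] lemma subcube_apply (ε : Fin k → Bool) (x : Fin k → I) (i : Fin k) :
    subcube ε x i = half (ε i) (x i) := rfl

/-- Subdivision of cubes. -/
def sd : Chain k X →ₗ[ZMod 2] Chain k X := ext fun c => ∑ ε, gen (c.comp (subcube ε))

lemma sd_gen (c : Cube k X) : sd (gen c) = ∑ ε, gen (c.comp (subcube ε)) := ext_gen _ _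

lemma subcube_face (i : Fin (k + 1)) (e : Bool) (ε : Fin k → Bool) (b : I) :
    (subcube (i.insertNth e ε)).comp (face i b) = (face i (half e b)).comp (subcube ε) := by
  ext1 x
  funext j
  rcases Fin.eq_self_or_eq_succAbove i j with rfl | ⟨m, rfl⟩ <;> simp

lemma bd_sd (z : Chain (k + 1) X) : bd (sd z) = sd (bd z) := by
  suffices h : (bd ∘ₗ sd : Chain (k + 1) X →ₗ[ZMod 2] Chain k X) = sd ∘ₗ bd from
    LinearMap.congr_fun h z
  refine chain_hom_ext fun c => ?_
  simp only [LinearMap.comp_apply, sd_gen, bd_gen, map_sum, map_add]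
  rw [Finset.sum_comm]
  refine Finset.sum_congr rfl fun i _ => ?_
  let g (ε : Fin (k + 1) → Bool) : Chain k X :=
    gen ((c.comp (subcube ε)).comp (face i 0)) + gen ((c.comp (subcube ε)).comp (face i 1))
  have hg (ε : Fin k → Bool) : g (i.insertNth true ε) + g (i.insertNth false ε) =
      gen ((c.comp (face i 0)).comp (subcube ε)) + gen ((c.comp (face i 1)).comp (subcube ε)) := by
    have h (a b e : Chain k X) : a + b + (e + a) = e + b := by grind [add_self a]
    dsimp only [g]
    simp only [ContinuousMap.comp_assoc, subcube_face, half_true_zero, half_false_zero,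
      half_true_one]
    exact h _ _ _
  rw [← Finset.sum_add_distrib]
  calc ∑ ε, g ε = ∑ p : Bool × (Fin k → Bool), g (i.insertNth p.1 p.2) :=
        (Fintype.sum_equiv (Fin.insertNthEquiv (fun _ => Bool) i) _ g fun p => rfl).symm
    _ = _ := by
      rw [Fintype.sum_prod_type, Fintype.sum_bool, ← Finset.sum_add_distrib]
      exact Finset.sum_congr rfl fun ε _ => hg ε

lemma sd_mem {U : Set X} {z : Chain k X} (hz : z ∈ A k U) : sd z ∈ A k U := by
  refine ext_mem (fun c hc => Submodule.sum_mem _ fun ε _ => gen_mem ?_) hz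
  refine hc.imp (fun hc => (range_comp_subset _ _).trans hc) fun ⟨i, hi⟩ => ⟨i, fun x a => ?_⟩
  have : subcube ε (Function.update x i a) = Function.update (subcube ε x) i (half (ε i) a) := by
    funext j
    by_cases h : j = i
    · subst h; simp
    · simp [h]
  simp [this, hi]

lemma map_sd (f : C(X, Y)) (z : Chain k X) : map f (sd z) = sd (map f z) := by
  suffices h : (map f ∘ₗ sd : Chain k X →ₗ[ZMod 2] Chain k Y) = sd ∘ₗ map f from
    LinearMap.congr_fun h z
  exact chain_hom_ext fun c => by simp [sd_gen, map_sum, ContinuousMap.comp_assoc]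

lemma sd_zero (z : Chain 0 X) : sd z = z := by
  suffices h : (sd : Chain 0 X →ₗ[ZMod 2] Chain 0 X) = LinearMap.id from LinearMap.congr_fun h z
  refine chain_hom_ext fun c => ?_
  simp only [sd_gen, Finset.univ_unique, Finset.sum_singleton, LinearMap.id_apply]
  congr 1
  ext1 x
  exact congrArg c (Subsingleton.elim _ _)

/-- Contraction of the cube to its corner. -/
def shrink (k : ℕ) : C(I × (Fin k → I), Fin k → I) where
  toFun p i := p.1 * p.2 i

/-- The identity cube. -/
abbrev idCube (k : ℕ) : Cube k (Fin k → I) := ContinuousMap.id _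

/-- The universal chain of the homotopy between the identity and subdivision. -/
def univT : (k : ℕ) → Chain (k + 1) (Fin k → I)
  | 0 => 0
  | k + 1 => prism (shrink (k + 1)) (gen (idCube (k + 1)) + sd (gen (idCube (k + 1))) +
      ext (fun d => map d (univT k)) (bd (gen (idCube (k + 1)))))

/-- The natural homotopy between the identity and subdivision. -/
def T : Chain k X →ₗ[ZMod 2] Chain (k + 1) X := ext fun c => map c (univT k)

@[simp] lemma T_gen (c : Cube k X) : T (gen c) = map c (univT k) := ext_gen _ _

lemma univT_succ (k : ℕ) : univT (k + 1) = prism (shrink (k + 1)) (gen (idCube (k + 1)) +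
    sd (gen (idCube (k + 1))) + T (bd (gen (idCube (k + 1))))) := rfl

lemma map_T (f : C(X, Y)) (z : Chain k X) : map f (T z) = T (map f z) := by
  suffices h : (map f ∘ₗ T : Chain k X →ₗ[ZMod 2] Chain (k + 1) Y) = T ∘ₗ map f from
    LinearMap.congr_fun h z
  exact chain_hom_ext fun c => by simp [map_map]

lemma map_prism_shrink {l : ℕ} (r : C(Fin k → I, Fin k → I))
    (hr : ∀ t x, r (shrink k (t, x)) = shrink k (t, r x)) (z : Chain l (Fin k → I)) :
    map r (prism (shrink k) z) = prism (shrink k) (map r z) := by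
  suffices h : (map r ∘ₗ prism (shrink k) : Chain l (Fin k → I) →ₗ[ZMod 2] _) =
      prism (shrink k) ∘ₗ map r from LinearMap.congr_fun h z
  refine chain_hom_ext fun c => ?_
  simp only [LinearMap.comp_apply, prism_gen, map_gen]
  congr 1
  ext1 x
  exact hr _ _

lemma gen_eq_map_id (c : Cube k X) : gen c = map c (gen (idCube k)) := by simp

lemma T_mem {U : Set X} {z : Chain k X} (hz : z ∈ A k U) : T z ∈ A (k + 1) U := by
  induction k generalizing X with
  | zero =>
    have : (T : Chain 0 X →ₗ[ZMod 2] _) = 0 := chain_hom_ext fun c => by simp [univT]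
    simp [this]
  | succ k ih =>
    refine ext_mem (fun c hc => ?_) hz
    rcases hc with hc | ⟨i, hi⟩
    · exact map_mem c (U := univ) (fun x _ => hc (mem_range_self x)) (A_univ _)
    · let r : C(Fin (k + 1) → I, Fin (k + 1) → I) :=
        ⟨fun x => Function.update x i 0, by fun_prop⟩
      have hc : c = c.comp r := by ext1 x; simp [r, hi]
      have hrd : Degen r := ⟨i, fun x a => by simp [r, Function.update_idem]⟩
      rw [hc, ← map_map]
      refine map_mem (U := (∅ : Set (Fin (k + 1) → I))) c (mapsTo_empty _ _) ?_
      rw [univT_succ, map_prism_shrink]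
      · refine prism_mem (U := ∅) _ (by simp) ?_
        have hg : map r (gen (idCube (k + 1))) ∈ A (k + 1) ∅ := by
          rw [← gen_eq_map_id]; exact gen_mem (Or.inr hrd)
        rw [map_add, map_add, map_sd, map_T, ← bd_map]
        exact Submodule.add_mem _ (Submodule.add_mem _ hg (sd_mem hg)) (ih (bd_mem hg))
      · intro t x
        funext j
        by_cases h : j = i
        · subst h; simp [r, shrink]
        · simp [r, shrink, h]

lemma mem_of_gen {l : ℕ} (L : Chain k X →ₗ[ZMod 2] Chain l Y) {V : Submodule (ZMod 2) (Chain l Y)}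
    (h : ∀ c, L (gen c) ∈ V) (z : Chain k X) : L z ∈ V := by
  have : L = ext fun c => L (gen c) := chain_hom_ext fun c => by simp
  rw [this]
  exact ext_mem (U := univ) (fun c _ => h c) (A_univ z)

lemma T_zero (z : Chain 0 X) : T z = 0 := by
  have : (T : Chain 0 X →ₗ[ZMod 2] _) = 0 := chain_hom_ext fun c => by simp [univT]
  simp [this]

/-- The reduction of the homotopy formula to the universal case. -/
lemma T_homotopy_of_bd (h : bd (gen (idCube (k + 1))) + sd (bd (gen (idCube (k + 1)))) +
      bd (T (bd (gen (idCube (k + 1))))) ∈ A k ∅) (z : Chain (k + 1) X) :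
    bd (T z) + T (bd z) + z + sd z ∈ A (k + 1) (∅ : Set X) := by
  refine mem_of_gen (bd ∘ₗ T + T ∘ₗ bd + LinearMap.id + sd) (fun c => ?_) z
  simp only [LinearMap.add_apply, LinearMap.comp_apply, LinearMap.id_apply]
  rw [gen_eq_map_id, ← map_T, bd_map, bd_map, ← map_T, ← map_sd, ← map_add, ← map_add, ← map_add]
  refine map_mem (U := (∅ : Set (Fin (k + 1) → I))) c (mapsTo_empty _ _) ?_
  rw [T_gen, map_id, univT_succ, bd_prism]
  set w := gen (idCube (k + 1)) + sd (gen (idCube (k + 1))) + T (bd (gen (idCube (k + 1)))) with hw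
  have h0 : map (slice (shrink (k + 1)) 0) w ∈ A (k + 1) (∅ : Set (Fin (k + 1) → I)) := by
    have : slice (shrink (k + 1)) 0 = ContinuousMap.const _ 0 := by
      ext1 x; funext i; simp [shrink]
    rw [this]
    exact map_const_mem _ _
  have h1 : map (slice (shrink (k + 1)) 1) w = w := by
    have : slice (shrink (k + 1)) 1 = ContinuousMap.id _ := by
      ext1 x; funext i; simp [shrink]
    rw [this, map_id]
  have h2 : prism (shrink (k + 1)) (bd w) ∈ A (k + 1) (∅ : Set (Fin (k + 1) → I)) := by
    refine prism_mem (U := ∅) _ (by simp) ?_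
    rwa [hw, map_add, map_add, bd_sd]
  rw [h1]
  have key : ∀ a b p q r : Chain (k + 1) (Fin (k + 1) → I), w = p + q + r →
      a + w + b + r + p + q = a + b := by
    intro a b p q r hpqr
    rw [hpqr]
    grind [add_self p, add_self q, add_self r]
  rw [key _ _ _ _ _ hw]
  exact Submodule.add_mem _ h0 h2

lemma T_homotopy (z : Chain (k + 1) X) :
    bd (T z) + T (bd z) + z + sd z ∈ A (k + 1) (∅ : Set X) := by
  induction k generalizing X with
  | zero =>
    refine T_homotopy_of_bd ?_ z
    rw [T_zero, sd_zero, map_zero, add_self]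
    exact Submodule.zero_mem _
  | succ k ih =>
    refine T_homotopy_of_bd ?_ z
    have := ih (bd (gen (idCube (k + 2))))
    rw [bd_bd, map_zero, add_zero, add_assoc] at this
    convert this using 1
    exact add_comm _ _

/-- The homotopy between the identity and iterated subdivision. -/
def D (N : ℕ) : Chain k X →ₗ[ZMod 2] Chain (k + 1) X := ∑ n ∈ Finset.range N, T ∘ₗ (sd ^ n)

lemma sd_pow_succ (N : ℕ) (z : Chain k X) : (sd ^ (N + 1)) z = sd ((sd ^ N) z) := by
  rw [pow_succ']; rfl

lemma bd_sd_pow (N : ℕ) (z : Chain (k + 1) X) : bd ((sd ^ N) z) = (sd ^ N) (bd z) := by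
  induction N with
  | zero => rfl
  | succ N ih => rw [sd_pow_succ, sd_pow_succ, bd_sd, ih]

lemma sd_pow_mem {U : Set X} (N : ℕ) {z : Chain k X} (hz : z ∈ A k U) : (sd ^ N) z ∈ A k U := by
  induction N with
  | zero => exact hz
  | succ N ih => rw [sd_pow_succ]; exact sd_mem ih

lemma map_sd_pow (f : C(X, Y)) (N : ℕ) (z : Chain k X) :
    map f ((sd ^ N) z) = (sd ^ N) (map f z) := by
  induction N with
  | zero => rfl
  | succ N ih => rw [sd_pow_succ, sd_pow_succ, map_sd, ih]

lemma D_mem {U : Set X} (N : ℕ) {z : Chain k X} (hz : z ∈ A k U) : D N z ∈ A (k + 1) U := by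
  rw [D, LinearMap.sum_apply]
  exact Submodule.sum_mem _ fun n _ => T_mem (sd_pow_mem n hz)

lemma D_succ (N : ℕ) (z : Chain k X) : D (N + 1) z = D N z + T ((sd ^ N) z) := by
  simp [D, Finset.sum_range_succ]

lemma D_homotopy (N : ℕ) (z : Chain (k + 1) X) :
    bd (D N z) + D N (bd z) + z + (sd ^ N) z ∈ A (k + 1) (∅ : Set X) := by
  induction N with
  | zero =>
    have : bd (D 0 z) + D 0 (bd z) + z + (sd ^ 0) z = 0 := by simp [D, add_self]
    rw [this]
    exact Submodule.zero_mem _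
  | succ N ih =>
    have := Submodule.add_mem _ ih (T_homotopy ((sd ^ N) z))
    rw [D_succ, D_succ, map_add, sd_pow_succ, ← bd_sd_pow]
    convert this using 1
    grind [add_self ((sd ^ N) z)]

lemma sd_pow_zero_dim (N : ℕ) (z : Chain 0 X) : (sd ^ N) z = z := by
  induction N with
  | zero => rfl
  | succ N ih => rw [sd_pow_succ, ih, sd_zero]

/-- The cubes obtained from `c` by precomposing with a `2⁻ᴺ`-Lipschitz map. -/
def tinyCubes (c : Cube k X) (N : ℕ) : Set (Cube k X) :=
  {d | ∃ h : C(Fin k → I, Fin k → I), d = c.comp h ∧ ∀ x y, dist (h x) (h y) ≤ 2⁻¹ ^ N * dist x y}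

lemma dist_subcube (ε : Fin k → Bool) (x y : Fin k → I) :
    dist (subcube ε x) (subcube ε y) ≤ 2⁻¹ * dist x y := by
  refine (dist_pi_le_iff (by positivity)).2 fun i => ?_
  have : dist (subcube ε x i) (subcube ε y i) = 2⁻¹ * dist (x i) (y i) := by
    simp only [subcube_apply, half, ContinuousMap.coe_mk, Subtype.dist_eq, Real.dist_eq]
    rw [← sub_div, add_sub_add_right_eq_sub, abs_div]
    norm_num
    ring
  rw [this]
  gcongr
  exact dist_le_pi_dist x y i

lemma sd_pow_gen_mem (c : Cube k X) (N : ℕ) :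
    (sd ^ N) (gen c) ∈ Finsupp.supported (ZMod 2) (ZMod 2) (tinyCubes c N) := by
  induction N with
  | zero =>
    exact Finsupp.single_mem_supported _ _ ⟨ContinuousMap.id _, by simp, by simp⟩
  | succ N ih =>
    rw [sd_pow_succ]
    generalize (sd ^ N) (gen c) = z at ih
    rw [sd, ext, Finsupp.linearCombination_apply, Finsupp.sum]
    refine Submodule.sum_mem _ fun d hd => Submodule.smul_mem _ _ (Submodule.sum_mem _ fun ε _ => ?_)
    obtain ⟨h, rfl, hh⟩ := ih hd
    refine Finsupp.single_mem_supported _ _ ⟨h.comp (subcube ε), by simp [ContinuousMap.comp_assoc],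
      fun x y => (hh _ _).trans ?_⟩
    rw [pow_succ, mul_assoc]
    gcongr
    exact dist_subcube ε x y

/-- Chains in a union of two open sets become sums after sufficiently fine subdivision. -/
lemma exists_sd_pow_split {U V : Set X} (hU : IsOpen U) (hV : IsOpen V) {z : Chain k X}
    (hz : z ∈ A k (U ∪ V)) : ∃ N, ∀ n ≥ N, ∃ a ∈ A k U, ∃ b ∈ A k V, (sd ^ n) z = a + b := by
  suffices h : ∃ N, (sd ^ N) z ∈ A k U ⊔ A k V by
    obtain ⟨N, hN⟩ := h
    obtain ⟨a, ha, b, hb, hab⟩ := Submodule.mem_sup.1 hN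
    refine ⟨N, fun n hn => ?_⟩
    obtain ⟨m, rfl⟩ := Nat.exists_eq_add_of_le hn
    refine ⟨_, sd_pow_mem m ha, _, sd_pow_mem m hb, ?_⟩
    rw [← map_add, hab, add_comm N m, pow_add]
    rfl
  have hstep : ∀ N m (w : Chain k X), (sd ^ N) w ∈ A k U ⊔ A k V →
      (sd ^ (N + m)) w ∈ A k U ⊔ A k V := by
    intro N m w hw
    obtain ⟨a, ha, b, hb, hab⟩ := Submodule.mem_sup.1 hw
    rw [add_comm, pow_add, Module.End.mul_apply, ← hab, map_add]
    exact Submodule.add_mem_sup (sd_pow_mem m ha) (sd_pow_mem m hb)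
  have hgen : ∀ c : Cube k X, range c ⊆ U ∪ V ∨ Degen c → ∃ N, (sd ^ N) (gen c) ∈ A k U ⊔ A k V := by
    rintro c (hc | hc)
    · obtain ⟨δ, hδ, hball⟩ := lebesgue_number_lemma_of_metric_sUnion (s := univ)
        (c := {c ⁻¹' U, c ⁻¹' V}) isCompact_univ
        (by simp [hU.preimage c.continuous, hV.preimage c.continuous])
        (fun x _ => by simpa using range_subset_iff.1 hc x)
      obtain ⟨N, hN⟩ := exists_pow_lt_of_lt_one hδ (by norm_num : (2⁻¹ : ℝ) < 1)
      refine ⟨N, ?_⟩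
      rw [A, A, ← Finsupp.supported_union]
      refine Finsupp.supported_mono ?_ (sd_pow_gen_mem c N)
      rintro _ ⟨h, rfl, hh⟩
      obtain ⟨t, ht, hsub⟩ := hball (h 0) (mem_univ _)
      have hr : ∀ x, h x ∈ t := fun x => hsub <| by
        refine lt_of_le_of_lt ((hh x 0).trans ?_) hN
        have : dist x 0 ≤ 1 := (dist_pi_le_iff zero_le_one).2 fun i => by
          have := (x i).2
          simp [Subtype.dist_eq, abs_le]
          constructor <;> linarith [this.1, this.2]
        have h2 : (0 : ℝ) ≤ 2⁻¹ ^ N := by positivity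
        nlinarith
      rcases ht with rfl | rfl
      · exact Or.inl (Or.inl (range_subset_iff.2 hr))
      · exact Or.inr (Or.inl (range_subset_iff.2 hr))
    · exact ⟨0, Submodule.mem_sup_left (gen_mem (Or.inr hc))⟩
  choose! f hf using hgen
  refine ⟨z.support.sup f, ?_⟩
  have hz' : z = ∑ c ∈ z.support, z c • gen c := by
    conv_lhs => rw [← Finsupp.sum_single z]
    exact Finset.sum_congr rfl fun c _ => by simp
  suffices h : (sd ^ z.support.sup f) (∑ c ∈ z.support, z c • gen c) ∈ A k U ⊔ A k V by
    rwa [← hz'] at h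
  rw [map_sum]
  refine Submodule.sum_mem _ fun c hc => ?_
  rw [map_smul]
  refine Submodule.smul_mem _ _ ?_
  obtain ⟨m, hm⟩ := Nat.exists_eq_add_of_le (Finset.le_sup (f := f) hc)
  rw [hm]
  exact hstep _ _ _ (hf c (hz hc))

end CubicalChain

namespace CubicalChain

open Set Topology unitInterval

variable {X Y Z : Type} [TopologicalSpace X] [TopologicalSpace Y] [TopologicalSpace Z] {k : ℕ}
  {U V : Set X} {z w : Chain k X}

/-- The chain is a boundary relative to `U`. -/
def Zero (U : Set X) (z : Chain k X) : Prop := ∃ e : Chain (k + 1) X, z + bd e ∈ A k U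

/-- The chain is a cycle relative to `U`. -/
def Cyc (U : Set X) : {k : ℕ} → Chain k X → Prop
  | 0, _ => True
  | k + 1, z => bd z ∈ A k U

/-- Vanishing of the relative homology in degree `k`. -/
def Van (k : ℕ) (U : Set X) : Prop := ∀ z : Chain k X, Cyc U z → Zero U z

/-- The relative homology in degree `k` has exactly two elements. -/
def Two (k : ℕ) (U : Set X) : Prop := (∃ z : Chain k X, Cyc U z ∧ ¬ Zero U z) ∧
  ∀ z w : Chain k X, Cyc U z → Cyc U w → ¬ Zero U z → ¬ Zero U w → Zero U (z + w)

lemma zero_of_mem (h : z ∈ A k U) : Zero U z := ⟨0, by simpa⟩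

lemma zero_bd (e : Chain (k + 1) X) : Zero U (bd e) := ⟨e, by simp [add_self]⟩

lemma Zero.mono (h : Zero U z) (hUV : U ⊆ V) : Zero V z := h.imp fun _ he => A_mono hUV he

lemma Zero.add (hz : Zero U z) (hw : Zero U w) : Zero U (z + w) := by
  obtain ⟨e, he⟩ := hz
  obtain ⟨f, hf⟩ := hw
  refine ⟨e + f, ?_⟩
  rw [map_add, add_add_add_comm]
  exact Submodule.add_mem _ he hf

lemma Zero.of_add (hz : Zero U (z + w)) (hw : Zero U w) : Zero U z := by
  have := hz.add hw
  rwa [add_assoc, add_self, add_zero] at this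

lemma Zero.add_iff (hz : Zero U z) : Zero U (z + w) ↔ Zero U w :=
  ⟨fun h => by rw [add_comm] at h; exact h.of_add hz, fun h => hz.add h⟩

lemma Zero.trans {u : Chain k X} (h : Zero U (z + w)) (h' : Zero U (w + u)) : Zero U (z + u) := by
  have := h.add h'
  rwa [add_assoc, add_self_cancel] at this

lemma Zero.symm (h : Zero U (z + w)) : Zero U (w + z) := by rwa [add_comm]

lemma Zero.iff (h : Zero U (z + w)) : Zero U z ↔ Zero U w :=
  ⟨fun hz => h.symm.of_add hz, fun hw => h.of_add hw⟩

lemma Cyc.mono (h : Cyc U z) (hUV : U ⊆ V) : Cyc V z := by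
  cases k with
  | zero => trivial
  | succ k => exact A_mono hUV h

lemma Cyc.add (hz : Cyc U z) (hw : Cyc U w) : Cyc U (z + w) := by
  cases k with
  | zero => trivial
  | succ k =>
    change bd (z + w) ∈ A k U
    rw [map_add]
    exact Submodule.add_mem _ hz hw

lemma cyc_of_mem (hz : z ∈ A k U) : Cyc U z := by
  cases k with
  | zero => trivial
  | succ k => exact bd_mem hz

lemma cyc_bd (e : Chain (k + 1) X) : Cyc U (bd e) := by
  cases k with
  | zero => trivial
  | succ k =>
    change bd (bd e) ∈ A k U
    rw [bd_bd]
    exact Submodule.zero_mem _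

lemma Zero.cyc (h : Zero U z) : Cyc U z := by
  obtain ⟨e, he⟩ := h
  have := (cyc_of_mem he).add (cyc_bd e)
  rwa [add_assoc, add_self, add_zero] at this

lemma Cyc.congr (h : Zero U (z + w)) (hz : Cyc U z) : Cyc U w := by
  have := hz.add h.cyc
  rwa [add_self_cancel] at this

lemma zero_add_sd_pow (hz : Cyc U z) (N : ℕ) : Zero U (z + (sd ^ N) z) := by
  cases k with
  | zero =>
    rw [sd_pow_zero_dim, add_self]
    exact zero_of_mem (Submodule.zero_mem _)
  | succ k =>
    refine ⟨D N z, ?_⟩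
    have := Submodule.add_mem _ (A_empty_le U (D_homotopy N z)) (D_mem N (show bd z ∈ A k U from hz))
    convert this using 1
    grind [add_self (D N (bd z))]

/-- Gluing of relative null-homologies. -/
lemma glue {U₁ U₂ : Set X} (hU₁ : IsOpen U₁) (hU₂ : IsOpen U₂) {e₁ e₂ : Chain (k + 1) X}
    (h₁ : z + bd e₁ ∈ A k U₁) (h₂ : z + bd e₂ ∈ A k U₂) (h : Zero (U₁ ∪ U₂) (e₁ + e₂)) :
    ∃ e, z + bd e ∈ A k (U₁ ∩ U₂) ∧ Zero U₁ (e + e₁) ∧ Zero U₂ (e + e₂) := by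
  obtain ⟨g, hg⟩ := h
  obtain ⟨N, hN⟩ := exists_sd_pow_split hU₁ hU₂ hg
  obtain ⟨a, ha, b, hb, hab⟩ := hN N le_rfl
  obtain ⟨w, hw⟩ : ∃ w, w = e₁ + e₂ + bd g := ⟨_, rfl⟩
  rw [← hw] at hab
  have hd := D_homotopy N w
  have hbw : bd w = (z + bd e₁) + (z + bd e₂) := by
    rw [hw, map_add, map_add, bd_bd]
    grind [add_self z]
  rw [hbw, map_add (D N) (z + bd e₁), hab] at hd
  set p := D N (z + bd e₁) with hp
  set q := D N (z + bd e₂) with hq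
  have hpm : p ∈ A (k + 1) U₁ := D_mem N h₁
  have hqm : q ∈ A (k + 1) U₂ := D_mem N h₂
  set r := bd (D N w) + (p + q) + w + (a + b) with hr
  clear_value p q r
  have hs : (e₁ + a + p) + e₂ = (b + q + r) + bd (D N w + g) := by
    rw [hr, hw, map_add]
    grind [add_self b, add_self q, add_self (bd (D N w)), add_self p, add_self a, add_self (bd g)]
  refine ⟨e₁ + a + p, A_inter ?_ ?_, ?_, ?_⟩
  · have := Submodule.add_mem _ h₁ (bd_mem (Submodule.add_mem _ ha hpm))
    convert this using 1
    simp only [map_add]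
    abel
  · have e : e₁ + a + p = e₂ + (b + q + r) + bd (D N w + g) := by
      rw [add_assoc e₂, ← hs]
      grind [add_self e₂]
    rw [e, map_add, bd_bd, add_zero, map_add, ← add_assoc]
    exact Submodule.add_mem _ h₂ (bd_mem (Submodule.add_mem _ (Submodule.add_mem _ hb hqm)
      (A_empty_le _ hd)))
  · refine zero_of_mem ?_
    have : e₁ + a + p + e₁ = a + p := by grind [add_self e₁]
    rw [this]
    exact Submodule.add_mem _ ha hpm
  · rw [hs]
    exact (zero_of_mem (Submodule.add_mem _ (Submodule.add_mem _ hb hqm)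
      (A_empty_le _ hd))).add (zero_bd _)

/-- A chain that is zero relative to two open sets is zero relative to their intersection. -/
lemma Zero.inter {U₁ U₂ : Set X} (hU₁ : IsOpen U₁) (hU₂ : IsOpen U₂) (h₁ : Zero U₁ z)
    (h₂ : Zero U₂ z) (hv : Van (k + 1) (U₁ ∪ U₂)) : Zero (U₁ ∩ U₂) z := by
  obtain ⟨e₁, h₁⟩ := h₁
  obtain ⟨e₂, h₂⟩ := h₂
  obtain ⟨e, he, -⟩ := glue hU₁ hU₂ h₁ h₂ (hv _ (by
    change bd (e₁ + e₂) ∈ _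
    have : bd (e₁ + e₂) = (z + bd e₁) + (z + bd e₂) := by
      rw [map_add]; grind [add_self z]
    rw [this]
    exact Submodule.add_mem _ (A_mono subset_union_left h₁) (A_mono subset_union_right h₂)))
  exact ⟨e, he⟩

section Suspension

variable {U₁ U₂ : Set X}

/-- The connecting relation of the relative Mayer-Vietoris sequence. -/
def Conn (U₁ U₂ : Set X) (z : Chain (k + 1) X) (b : Chain k X) : Prop :=
  b ∈ A k U₁ ∧ ∃ z', Zero (U₁ ∪ U₂) (z + z') ∧ bd z' + b ∈ A k U₂

lemma exists_conn (hU₁ : IsOpen U₁) (hU₂ : IsOpen U₂) {z : Chain (k + 1) X}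
    (hz : Cyc (U₁ ∪ U₂) z) : ∃ b, Conn U₁ U₂ z b := by
  obtain ⟨N, hN⟩ := exists_sd_pow_split hU₁ hU₂ (show bd z ∈ A k _ from hz)
  obtain ⟨a, ha, b, hb, hab⟩ := hN N le_rfl
  refine ⟨a, ha, (sd ^ N) z, zero_add_sd_pow hz N, ?_⟩
  rw [bd_sd_pow, hab, add_comm a b, add_assoc, add_self, add_zero]
  exact hb

lemma Conn.cyc {z : Chain (k + 1) X} {b : Chain k X} (h : Conn U₁ U₂ z b) : Cyc (U₁ ∩ U₂) b := by
  cases k with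
  | zero => trivial
  | succ k =>
    obtain ⟨hb, z', -, h⟩ := h
    refine A_inter (bd_mem hb) ?_
    have := bd_mem h
    rwa [map_add, bd_bd, zero_add] at this

lemma Conn.add {z z' : Chain (k + 1) X} {b b' : Chain k X} (h : Conn U₁ U₂ z b)
    (h' : Conn U₁ U₂ z' b') : Conn U₁ U₂ (z + z') (b + b') := by
  obtain ⟨hb, y, hy, h⟩ := h
  obtain ⟨hb', y', hy', h'⟩ := h'
  refine ⟨Submodule.add_mem _ hb hb', y + y', ?_, ?_⟩
  · rw [add_add_add_comm]; exact hy.add hy'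
  · rw [map_add, add_add_add_comm]; exact Submodule.add_mem _ h h'

lemma Conn.zero {z : Chain (k + 1) X} {b : Chain k X} (h : Conn U₁ U₂ z b)
    (hv₁ : Van (k + 1) U₁) (hv₂ : Van (k + 1) U₂) (hb0 : Zero (U₁ ∩ U₂) b) : Zero (U₁ ∪ U₂) z := by
  obtain ⟨hb, z', hz, h⟩ := h
  obtain ⟨e, he⟩ := hb0
  refine hz.of_add ?_
  have h1 : Zero U₁ e := hv₁ e (by
    have := Submodule.add_mem _ (A_mono inter_subset_left he) hb
    rwa [add_comm, add_self_cancel] at this)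
  have h2 : Zero U₂ (z' + e) := hv₂ _ (by
    have := Submodule.add_mem _ (A_mono inter_subset_right he) h
    change bd (z' + e) ∈ _
    rw [map_add]
    convert this using 1
    grind [add_self b])
  have := (h2.mono subset_union_right).add (h1.mono (subset_union_left (t := U₂)))
  rwa [add_assoc, add_self, add_zero] at this

lemma Van.suspend (hU₁ : IsOpen U₁) (hU₂ : IsOpen U₂) (hv₁ : Van (k + 1) U₁)
    (hv₂ : Van (k + 1) U₂) (h : Van k (U₁ ∩ U₂)) : Van (k + 1) (U₁ ∪ U₂) := by
  intro z hz
  obtain ⟨b, hb⟩ := exists_conn hU₁ hU₂ hz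
  exact hb.zero hv₁ hv₂ (h b hb.cyc)

lemma Two.suspend (hU₁ : IsOpen U₁) (hU₂ : IsOpen U₂) (hv₁ : ∀ k, Van k U₁)
    (hv₂ : ∀ k, Van k U₂) (h : Two k (U₁ ∩ U₂)) : Two (k + 1) (U₁ ∪ U₂) := by
  constructor
  · obtain ⟨b, hb, hb0⟩ := h.1
    obtain ⟨e₁, h₁⟩ := hv₁ k b (hb.mono inter_subset_left)
    obtain ⟨e₂, h₂⟩ := hv₂ k b (hb.mono inter_subset_right)
    refine ⟨e₁ + e₂, ?_, fun h0 => hb0 ?_⟩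
    · change bd (e₁ + e₂) ∈ _
      have : bd (e₁ + e₂) = (b + bd e₁) + (b + bd e₂) := by
        rw [map_add]; grind [add_self b]
      rw [this]
      exact Submodule.add_mem _ (A_mono subset_union_left h₁) (A_mono subset_union_right h₂)
    · obtain ⟨e, he, -⟩ := glue hU₁ hU₂ h₁ h₂ h0
      exact ⟨e, he⟩
  · intro z w hz hw hz0 hw0
    obtain ⟨b, hb⟩ := exists_conn hU₁ hU₂ hz
    obtain ⟨c, hc⟩ := exists_conn hU₁ hU₂ hw
    refine (hb.add hc).zero (hv₁ _) (hv₂ _) (h.2 b c hb.cyc hc.cyc ?_ ?_)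
    · exact fun h => hz0 (hb.zero (hv₁ _) (hv₂ _) h)
    · exact fun h => hw0 (hc.zero (hv₁ _) (hv₂ _) h)

end Suspension

section Maps

lemma Zero.map {V : Set Y} (f : C(X, Y)) (h : MapsTo f U V) (hz : Zero U z) :
    Zero V (map f z) := by
  obtain ⟨e, he⟩ := hz
  refine ⟨CubicalChain.map f e, ?_⟩
  rw [bd_map, ← map_add]
  exact map_mem f h he

lemma Cyc.map {V : Set Y} (f : C(X, Y)) (h : MapsTo f U V) (hz : Cyc U z) :
    Cyc V (map f z) := by
  cases k with
  | zero => trivial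
  | succ k =>
    change bd _ ∈ _
    rw [bd_map]
    exact map_mem f h hz

/-- Homotopic maps of pairs induce the same map in relative homology. -/
lemma zero_slice {V : Set Y} (H : C(I × X, Y)) (h : ∀ t, ∀ x ∈ U, H (t, x) ∈ V) (hz : Cyc U z) :
    Zero V (CubicalChain.map (slice H 0) z + CubicalChain.map (slice H 1) z) := by
  refine ⟨prism H z, ?_⟩
  cases k with
  | zero =>
    rw [bd_prism_zero, add_self]
    exact Submodule.zero_mem _
  | succ k =>
    rw [bd_prism, ← add_assoc, add_self, zero_add]
    exact prism_mem H h hz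

variable {ψ : C(X, Y)}

lemma exists_pullback (hψ : IsInducing ψ) {z : Chain k Y} (hz : z ∈ A k (range ψ)) :
    ∃ z' : Chain k X, z + map ψ z' ∈ A k (∅ : Set Y) := by
  classical
  have hlift : ∀ c : Cube k Y, range c ⊆ range ψ → ∃ c' : Cube k X, ψ.comp c' = c := by
    intro c hc
    choose g hg using fun x => hc (mem_range_self x)
    refine ⟨⟨g, hψ.continuous_iff.2 ?_⟩, ContinuousMap.ext hg⟩
    convert c.continuous using 1
    exact funext hg
  choose f hf using hlift
  let φ : Cube k Y → Chain k X := fun c => if h : range c ⊆ range ψ then gen (f c h) else 0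
  refine ⟨ext φ z, ?_⟩
  have : z + map ψ (ext φ z) = ext (fun c => gen c + map ψ (φ c)) z := by
    have : LinearMap.id + map ψ ∘ₗ ext φ = ext (fun c => gen c + map ψ (φ c)) :=
      chain_hom_ext fun c => by simp
    exact LinearMap.congr_fun this z
  rw [this]
  refine ext_mem (fun c hc => ?_) hz
  by_cases h : range c ⊆ range ψ
  · simp [φ, h, hf, add_self]
  · simp only [φ, h, dite_false, map_zero, add_zero]
    exact gen_mem (Or.inr (hc.resolve_left h))

lemma mem_of_map_mem (hψ : Function.Injective ψ) {V : Set Y} (h : map ψ z ∈ A k V) :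
    z ∈ A k (ψ ⁻¹' V) := by
  classical
  have hinj : Function.Injective (fun c : Cube k X => ψ.comp c) := fun c d hcd =>
    ContinuousMap.ext fun x => hψ (ContinuousMap.congr_fun hcd x)
  have hm : map ψ z = Finsupp.mapDomain (fun c : Cube k X => ψ.comp c) z := by
    have : map ψ = Finsupp.lmapDomain (ZMod 2) (ZMod 2) (fun c : Cube k X => ψ.comp c) :=
      chain_hom_ext fun c => by simp
    exact LinearMap.congr_fun this z
  intro c hc
  have hc' : ψ.comp c ∈ (map ψ z).support := by
    rw [hm, Finsupp.mapDomain_support_of_injective hinj]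
    exact Finset.mem_image_of_mem _ hc
  rcases h hc' with h | ⟨i, hi⟩
  · exact Or.inl fun _ ⟨x, hx⟩ => hx ▸ h (mem_range_self x)
  · exact Or.inr ⟨i, fun x a => hψ (hi x a)⟩

lemma zero_of_zero_map (hψ : IsOpenEmbedding ψ) {V : Set Y} (hV : IsOpen V)
    (hc : range ψ ∪ V = univ) (hz : Cyc (ψ ⁻¹' V) z) (h : Zero V (map ψ z)) : Zero (ψ ⁻¹' V) z := by
  obtain ⟨e, he⟩ := h
  obtain ⟨N, hN⟩ := exists_sd_pow_split hψ.isOpen_range hV (hc ▸ A_univ e)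
  obtain ⟨a, ha, b, hb, hab⟩ := hN N le_rfl
  obtain ⟨a', ha'⟩ := exists_pullback hψ.isInducing ha
  refine (zero_add_sd_pow hz N).of_add ⟨a', mem_of_map_mem hψ.injective ?_⟩
  have h1 := sd_pow_mem N he
  rw [map_add, ← bd_sd_pow, hab, ← map_sd_pow] at h1
  have h2 := Submodule.add_mem _ h1 (bd_mem (Submodule.add_mem _ hb (A_empty_le V ha')))
  rw [map_add, ← bd_map]
  convert h2 using 1
  simp only [map_add]
  grind [add_self (bd a), add_self (bd b)]

lemma exists_cyc_map (hψ : IsOpenEmbedding ψ) {V : Set Y} (hV : IsOpen V)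
    (hc : range ψ ∪ V = univ) {y : Chain k Y} (hy : Cyc V y) :
    ∃ z : Chain k X, Cyc (ψ ⁻¹' V) z ∧ Zero V (y + map ψ z) := by
  obtain ⟨N, hN⟩ := exists_sd_pow_split hψ.isOpen_range hV (hc ▸ A_univ y)
  obtain ⟨a, ha, b, hb, hab⟩ := hN N le_rfl
  obtain ⟨a', ha'⟩ := exists_pullback hψ.isInducing ha
  have hz : Zero V (y + map ψ a') := by
    refine (zero_add_sd_pow hy N).trans (zero_of_mem ?_)
    rw [hab, add_comm a b, add_assoc]
    exact Submodule.add_mem _ hb (A_empty_le V ha')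
  refine ⟨a', ?_, hz⟩
  have := hy.congr hz
  cases k with
  | zero => trivial
  | succ k =>
    change bd _ ∈ _ at this
    rw [bd_map] at this
    exact mem_of_map_mem hψ.injective this

lemma van_iff (hψ : IsOpenEmbedding ψ) {V : Set Y} (hV : IsOpen V)
    (hc : range ψ ∪ V = univ) : Van k (ψ ⁻¹' V) ↔ Van k V := by
  constructor
  · intro h y hy
    obtain ⟨z, hz, hyz⟩ := exists_cyc_map hψ hV hc hy
    exact hyz.of_add ((h z hz).map ψ (mapsTo_preimage _ _))
  · intro h z hz
    exact zero_of_zero_map hψ hV hc hz (h _ (hz.map ψ (mapsTo_preimage _ _)))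

lemma two_iff (hψ : IsOpenEmbedding ψ) {V : Set Y} (hV : IsOpen V)
    (hc : range ψ ∪ V = univ) : Two k (ψ ⁻¹' V) ↔ Two k V := by
  constructor
  · intro h
    refine ⟨?_, fun y y' hy hy' h0 h0' => ?_⟩
    · obtain ⟨z, hz, hz0⟩ := h.1
      exact ⟨map ψ z, hz.map ψ (mapsTo_preimage _ _), fun h => hz0 (zero_of_zero_map hψ hV hc hz h)⟩
    · obtain ⟨z, hz, hyz⟩ := exists_cyc_map hψ hV hc hy
      obtain ⟨z', hz', hyz'⟩ := exists_cyc_map hψ hV hc hy'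
      have := h.2 z z' hz hz' (fun h => h0 (hyz.of_add (h.map ψ (mapsTo_preimage _ _))))
        (fun h => h0' (hyz'.of_add (h.map ψ (mapsTo_preimage _ _))))
      have h3 := this.map ψ (mapsTo_preimage _ V)
      rw [map_add] at h3
      have h4 := hyz.add hyz'
      rw [add_add_add_comm] at h4
      exact h4.of_add h3
  · intro h
    refine ⟨?_, fun z z' hz hz' h0 h0' => ?_⟩
    · obtain ⟨y, hy, hy0⟩ := h.1
      obtain ⟨z, hz, hyz⟩ := exists_cyc_map hψ hV hc hy
      exact ⟨z, hz, fun h => hy0 (hyz.of_add (h.map ψ (mapsTo_preimage _ _)))⟩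
    · refine zero_of_zero_map hψ hV hc (hz.add hz') ?_
      rw [map_add]
      exact h.2 _ _ (hz.map ψ (mapsTo_preimage _ _)) (hz'.map ψ (mapsTo_preimage _ _))
        (fun h => h0 (zero_of_zero_map hψ hV hc hz h))
        (fun h => h0' (zero_of_zero_map hψ hV hc hz' h))

end Maps

end CubicalChain

namespace CubicalChain

open Set Topology unitInterval

variable {X Y Z : Type} [TopologicalSpace X] [TopologicalSpace Y] [TopologicalSpace Z] {k n : ℕ}
  {U V : Set X} {z w : Chain k X}

lemma map_const_mem_of_mem {V : Set Y} {p : Y} (hp : p ∈ V) (z : Chain k X) :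
    map (ContinuousMap.const X p) z ∈ A k V :=
  map_mem (U := univ) _ (fun _ _ => hp) (A_univ z)

/-- Relative homology vanishes if a contraction of the space restricts to the subspace. -/
lemma van_of_contraction (H : C(I × X, X)) (h0 : ∀ x, H (0, x) = x) (p : X)
    (h1 : ∀ x, H (1, x) = p) (hp : p ∈ U) (hU : ∀ t, ∀ x ∈ U, H (t, x) ∈ U) : Van k U := by
  intro z hz
  have := zero_slice H hU hz
  rw [show slice H 0 = ContinuousMap.id X from ContinuousMap.ext h0, map_id,
    show slice H 1 = ContinuousMap.const X p from ContinuousMap.ext h1] at this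
  exact this.of_add (zero_of_mem (map_const_mem_of_mem hp z))

/-- A contractible space is acyclic in positive degrees. -/
lemma van_empty_of_contraction (H : C(I × X, X)) (h0 : ∀ x, H (0, x) = x) (p : X)
    (h1 : ∀ x, H (1, x) = p) : Van (k + 1) (∅ : Set X) := by
  intro z hz
  have := zero_slice H (V := ∅) (by simp) hz
  rw [show slice H 0 = ContinuousMap.id X from ContinuousMap.ext h0, map_id,
    show slice H 1 = ContinuousMap.const X p from ContinuousMap.ext h1] at this
  exact this.of_add (zero_of_mem (map_const_mem p z))

lemma zero_add_map_const (H : C(I × X, X)) (h0 : ∀ x, H (0, x) = x) (p : X)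
    (h1 : ∀ x, H (1, x) = p) (z : Chain 0 X) :
    Zero (∅ : Set X) (z + map (ContinuousMap.const X p) z) := by
  have := zero_slice H (V := ∅) (U := ∅) (by simp) (show Cyc ∅ z from trivial)
  rwa [show slice H 0 = ContinuousMap.id X from ContinuousMap.ext h0, map_id,
    show slice H 1 = ContinuousMap.const X p from ContinuousMap.ext h1] at this

/-- The augmentation of `0`-chains. -/
def aug : Chain 0 X →ₗ[ZMod 2] ZMod 2 := Finsupp.linearCombination (ZMod 2) fun _ => 1

@[simp] lemma aug_gen (c : Cube 0 X) : aug (gen c) = 1 := by simp [aug]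

lemma aug_bd (z : Chain 1 X) : aug (bd z) = 0 := by
  have : (aug ∘ₗ bd : Chain 1 X →ₗ[ZMod 2] ZMod 2) = 0 := chain_hom_ext fun c => by
    simp [bd_gen, CharTwo.add_self_eq_zero]
  exact LinearMap.congr_fun this z

lemma A_zero_empty {z : Chain 0 X} (hz : z ∈ A 0 (∅ : Set X)) : z = 0 := by
  rw [← Finsupp.support_eq_empty, Finset.eq_empty_iff_forall_notMem]
  intro c hc
  rcases hz hc with h | ⟨i, -⟩
  · exact h (mem_range_self 0)
  · exact i.elim0

/-- A point as a `0`-cube. -/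
abbrev pt (x : X) : Cube 0 X := ContinuousMap.const _ x

lemma map_const_zero (p : Y) (z : Chain 0 X) :
    map (ContinuousMap.const X p) z = aug z • gen (pt p) := by
  have : (map (ContinuousMap.const X p) : Chain 0 X →ₗ[ZMod 2] _) =
      LinearMap.smulRight aug (gen (pt p)) := chain_hom_ext fun c => by
    simp only [map_gen, LinearMap.smulRight_apply, aug_gen, one_smul]
    rfl
  exact LinearMap.congr_fun this z

lemma zmod_two_cases (a : ZMod 2) : a = 0 ∨ a = 1 := by revert a; decide

lemma two_zero_of_contraction (H : C(I × X, X)) (h0 : ∀ x, H (0, x) = x) (p : X)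
    (h1 : ∀ x, H (1, x) = p) : Two 0 (∅ : Set X) := by
  have key : ∀ z : Chain 0 X, Zero (∅ : Set X) z ↔ aug z = 0 := by
    refine fun z => ⟨fun ⟨e, he⟩ => ?_, fun h => ?_⟩
    · have := congrArg aug (A_zero_empty he)
      rwa [map_add, aug_bd, add_zero, map_zero] at this
    · have := zero_add_map_const H h0 p h1 z
      rwa [map_const_zero, h, zero_smul, add_zero] at this
  refine ⟨⟨gen (pt p), trivial, by rw [key]; simp⟩, fun z w _ _ hz hw => ?_⟩
  rw [key] at *
  rw [map_add, (zmod_two_cases _).resolve_left hz, (zmod_two_cases _).resolve_left hw]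
  decide

section Euclidean

/-- Real coordinate space. -/
abbrev E (n : ℕ) := Fin n → ℝ

/-- The straight-line contraction to a point. -/
def lineTo (p : E n) : C(I × E n, E n) where
  toFun x := (1 - (x.1 : ℝ)) • x.2 + (x.1 : ℝ) • p

@[simp] lemma lineTo_apply (p x : E n) (t : I) :
    lineTo p (t, x) = (1 - (t : ℝ)) • x + (t : ℝ) • p := rfl

/-- The complement of a coordinate subspace. -/
def offCoord (n j : ℕ) : Set (E n) := {x | ∃ i : Fin n, j ≤ i ∧ x i ≠ 0}

/-- The complement of half of a coordinate subspace. -/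
def offHalf (j : Fin n) (s : ℝ) : Set (E n) := {x | x ∈ offCoord n (j + 1) ∨ s * x j < 0}

lemma isOpen_offCoord (j : ℕ) : IsOpen (offCoord n j) := by
  have : offCoord n j = ⋃ i : Fin n, ⋃ _ : j ≤ i, {x | x i ≠ 0} := by
    ext x; simp [offCoord]
  rw [this]
  exact isOpen_iUnion fun i => isOpen_iUnion fun _ =>
    isOpen_ne_fun (continuous_apply i) continuous_const

lemma isOpen_offHalf (j : Fin n) (s : ℝ) : IsOpen (offHalf j s) :=
  (isOpen_offCoord _).union
    (isOpen_lt (f := fun x : E n => s * x j) (g := fun _ => 0) (by fun_prop) (by fun_prop))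

lemma van_offHalf (j : Fin n) {s : ℝ} (hs : s * s = 1) : Van k (offHalf j s) := by
  refine van_of_contraction (lineTo (Pi.single j (-s))) (by simp) (Pi.single j (-s)) (by simp)
    (Or.inr (by simp [hs])) ?_
  rintro t x (⟨i, hi, hx⟩ | hx)
  · rcases eq_or_ne (t : ℝ) 1 with ht | ht
    · exact Or.inr (by simp [ht, hs])
    · refine Or.inl ⟨i, hi, ?_⟩
      have : i ≠ j := fun h => by subst h; omega
      have h2 : 1 - (t : ℝ) ≠ 0 := sub_ne_zero.2 ht.symm
      simp [this, hx, h2]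
  · refine Or.inr ?_
    have h1 := t.2.1
    have h2 := t.2.2
    simp only [lineTo_apply, Pi.add_apply, Pi.smul_apply, smul_eq_mul, Pi.single_eq_same]
    have : s * ((1 - (t : ℝ)) * x j + t * -s) = (1 - (t : ℝ)) * (s * x j) - t * (s * s) := by ring
    rw [this, hs]
    rcases h1.eq_or_lt with h | h
    · rw [← h]; linarith
    · nlinarith

lemma offHalf_inter (j : Fin n) : offHalf j 1 ∩ offHalf j (-1) = offCoord n (j + 1) := by
  ext x
  simp only [offHalf, mem_inter_iff, mem_ofPred_eq]
  refine ⟨?_, fun h => ⟨Or.inl h, Or.inl h⟩⟩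
  rintro ⟨h | h, h' | h'⟩
  all_goals first | assumption | (exfalso; linarith)

lemma offHalf_union (j : Fin n) : offHalf j 1 ∪ offHalf j (-1) = offCoord n j := by
  ext x
  simp only [offHalf, mem_union, mem_ofPred_eq, offCoord]
  constructor
  · rintro ((⟨i, hi, hx⟩ | h) | (⟨i, hi, hx⟩ | h))
    · exact ⟨i, by omega, hx⟩
    · exact ⟨j, le_rfl, by intro h0; simp [h0] at h⟩
    · exact ⟨i, by omega, hx⟩
    · exact ⟨j, le_rfl, by intro h0; simp [h0] at h⟩
  · rintro ⟨i, hi, hx⟩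
    rcases eq_or_ne i j with rfl | hij
    · rcases lt_or_gt_of_ne hx with h | h
      · exact Or.inl (Or.inr (by linarith))
      · exact Or.inr (Or.inr (by linarith))
    · exact Or.inl (Or.inl ⟨i, by have := Fin.val_ne_of_ne hij; omega, hx⟩)

lemma van_offCoord_zero {j : ℕ} (hj : j ≤ n) (h : Van k (offCoord n j)) :
    Van (k + j) (offCoord n 0) := by
  induction j generalizing k with
  | zero => exact h
  | succ j ih =>
    have := ih (k := k + 1) (by omega) (by
      have := Van.suspend (k := k) (isOpen_offHalf ⟨j, hj⟩ 1) (isOpen_offHalf ⟨j, hj⟩ (-1))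
        (van_offHalf _ (by norm_num)) (van_offHalf _ (by norm_num)) (by rwa [offHalf_inter])
      rwa [offHalf_union] at this)
    rwa [show k + (j + 1) = k + 1 + j by ring]

lemma two_offCoord_zero {j : ℕ} (hj : j ≤ n) (h : Two k (offCoord n j)) :
    Two (k + j) (offCoord n 0) := by
  induction j generalizing k with
  | zero => exact h
  | succ j ih =>
    have := ih (k := k + 1) (by omega) (by
      have := Two.suspend (k := k) (isOpen_offHalf ⟨j, hj⟩ 1) (isOpen_offHalf ⟨j, hj⟩ (-1))
        (fun _ => van_offHalf _ (by norm_num)) (fun _ => van_offHalf _ (by norm_num))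
        (by rwa [offHalf_inter])
      rwa [offHalf_union] at this)
    rwa [show k + (j + 1) = k + 1 + j by ring]

lemma offCoord_self : offCoord n n = ∅ := by
  ext x
  simp only [offCoord, mem_ofPred_eq, mem_empty_iff_false, iff_false, not_exists, not_and]
  intro i hi
  omega

lemma offCoord_zero : offCoord n 0 = {0}ᶜ := by
  ext x
  simp [offCoord, funext_iff]

lemma van_origin (hk : k ≠ n) : Van k ({0}ᶜ : Set (E n)) := by
  rw [← offCoord_zero]
  rcases lt_or_gt_of_ne hk with h | h
  · rw [← Nat.zero_add k]
    refine van_offCoord_zero h.le fun z _ => ?_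
    have := zero_add_map_const (lineTo (Pi.single (⟨k, h⟩ : Fin n) (1 : ℝ))) (by simp)
      (Pi.single (⟨k, h⟩ : Fin n) (1 : ℝ)) (by simp) z
    have hp : Pi.single (⟨k, h⟩ : Fin n) (1 : ℝ) ∈ offCoord n k := ⟨⟨k, h⟩, le_rfl, by simp⟩
    exact (this.mono (empty_subset _)).of_add (zero_of_mem (map_const_mem_of_mem hp z))
  · obtain ⟨m, rfl⟩ := Nat.exists_eq_add_of_lt h
    rw [show n + m + 1 = m + 1 + n by ring]
    refine van_offCoord_zero le_rfl ?_
    rw [offCoord_self]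
    exact van_empty_of_contraction (lineTo 0) (by simp) 0 (by simp)

lemma two_origin : Two n ({0}ᶜ : Set (E n)) := by
  rw [← offCoord_zero, ← Nat.zero_add n]
  rw [Nat.zero_add]
  have := two_offCoord_zero (n := n) (k := 0) le_rfl (by
    rw [offCoord_self]
    exact two_zero_of_contraction (lineTo 0) (by simp) 0 (by simp))
  rwa [Nat.zero_add] at this

/-- Translation. -/
def translate (y : E n) : C(E n, E n) := ⟨fun x => x + y, by fun_prop⟩

lemma isOpenEmbedding_translate (y : E n) : IsOpenEmbedding (translate y) :=
  (Homeomorph.addRight y).isOpenEmbedding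

lemma van_point (hk : k ≠ n) (y : E n) : Van k ({y}ᶜ : Set (E n)) := by
  rw [← van_iff (isOpenEmbedding_translate y) isOpen_compl_singleton
    (by rw [(show range (translate y) = univ from (Homeomorph.addRight y).surjective.range_eq)]; simp)]
  convert van_origin (n := n) hk using 2
  ext x
  simp [translate]

lemma two_point (y : E n) : Two n ({y}ᶜ : Set (E n)) := by
  rw [← two_iff (isOpenEmbedding_translate y) isOpen_compl_singleton
    (by rw [(show range (translate y) = univ from (Homeomorph.addRight y).surjective.range_eq)]; simp)]
  convert two_origin (n := n) using 2
  ext x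
  simp [translate]

/-- Radial expansion from a point. -/
def expand (y : E n) (R : ℝ) : C(I × E n, E n) where
  toFun x := y + (1 + (x.1 : ℝ) * R) • (x.2 - y)

lemma zero_of_zero_point {K : Set (E n)} (hK : IsCompact K) (hc : Convex ℝ K) {y : E n}
    (hy : y ∈ K) {z : Chain k (E n)} (hz : Cyc Kᶜ z) (h : Zero {y}ᶜ z) : Zero Kᶜ z := by
  obtain ⟨e, he⟩ := h
  have hS := isCompact_supp (z + bd e)
  have hyS : y ∉ supp (z + bd e) := fun h => mem_A_iff.1 he h rfl
  obtain ⟨ε, hε, hball⟩ := Metric.isOpen_iff.1 hS.isClosed.isOpen_compl y hyS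
  obtain ⟨M, hM⟩ := hK.isBounded.subset_ball y
  set R : ℝ := |M| / ε with hR
  have hR0 : 0 ≤ R := by positivity
  have hpres : ∀ t : I, ∀ x ∈ Kᶜ, expand y R (t, x) ∈ Kᶜ := by
    intro t x hx hmem
    apply hx
    have ht : 0 < 1 + (t : ℝ) * R := by have := t.2.1; positivity
    have := hc.add_smul_sub_mem hy hmem (t := (1 + (t : ℝ) * R)⁻¹)
      ⟨by positivity, inv_le_one_of_one_le₀ (by have := mul_nonneg t.2.1 hR0; linarith)⟩
    simpa [expand, smul_smul, inv_mul_cancel₀ ht.ne'] using this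
  have h1 := zero_slice (expand y R) hpres hz
  rw [show slice (expand y R) 0 = ContinuousMap.id _ from ContinuousMap.ext fun x => by
    simp [expand], map_id] at h1
  refine h1.of_add ⟨map (slice (expand y R) 1) e, ?_⟩
  rw [bd_map, ← map_add]
  refine map_mem _ (fun x hx => ?_) (mem_A_supp _)
  intro hmem
  have hxε : ε ≤ dist x y := by
    by_contra hlt
    exact hball (Metric.mem_ball.2 (not_le.1 hlt)) hx
  have hd := Metric.mem_ball.1 (hM hmem)
  simp only [slice_apply, expand, ContinuousMap.coe_mk, dist_eq_norm, Set.Icc.coe_one, one_mul,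
    add_sub_cancel_left, norm_smul, Real.norm_eq_abs] at hd
  rw [abs_of_pos (by positivity), ← dist_eq_norm] at hd
  have : |M| = R * ε := by rw [hR]; field_simp
  nlinarith [le_abs_self M]

lemma van_compl_convex {K : Set (E n)} (hK : IsCompact K) (hc : Convex ℝ K) (hne : K.Nonempty)
    (hk : k ≠ n) : Van k Kᶜ := by
  obtain ⟨y, hy⟩ := hne
  intro z hz
  exact zero_of_zero_point hK hc hy hz (van_point hk y z
    (hz.mono (compl_subset_compl.2 (singleton_subset_iff.2 hy))))

lemma van_univ : Van k (univ : Set X) := fun z _ => zero_of_mem (A_univ z)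

lemma van_compl_biUnion_convex {ι : Type} (s : Finset ι) (B : ι → Set (E n))
    (hB : ∀ i, IsCompact (B i)) (hc : ∀ i, Convex ℝ (B i)) (hk : n < k) :
    Van k (⋃ i ∈ s, B i)ᶜ := by
  classical
  induction s using Finset.induction_on generalizing k B with
  | empty => simpa using van_univ
  | insert a s ha ih =>
    rw [Finset.set_biUnion_insert, compl_union]
    have hcl : IsClosed (⋃ i ∈ s, B i) := (s.isCompact_biUnion fun i _ => hB i).isClosed
    intro z hz
    refine Zero.inter (hB a).isClosed.isOpen_compl hcl.isOpen_compl ?_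
      (ih B hB hc hk z (hz.mono inter_subset_right)) ?_
    · rcases (B a).eq_empty_or_nonempty with h | h
      · rw [h, compl_empty]; exact van_univ z (hz.mono (by simp [h]))
      · exact van_compl_convex (hB a) (hc a) h hk.ne' z (hz.mono inter_subset_left)
    · rw [← compl_inter, inter_iUnion₂]
      exact ih (fun i => B a ∩ B i) (fun i => (hB a).inter_right (hB i).isClosed)
        (fun i => (hc a).inter (hc i)) (by omega)

/-- A compact set disjoint from the support of a chain is covered by finitely many small closed
balls with the same property. -/
lemma exists_balls {K S : Set (E n)} (hK : IsCompact K) (hS : IsCompact S) (h : Disjoint K S) :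
    ∃ (s : Finset (E n)) (B : E n → Set (E n)), (∀ i, IsCompact (B i)) ∧ (∀ i, Convex ℝ (B i)) ∧
      (∀ i ∈ s, i ∈ K ∧ i ∈ B i) ∧ K ⊆ ⋃ i ∈ s, B i ∧ ∀ i ∈ s, Disjoint (B i) S := by
  have : ∀ x ∈ K, ∃ r > 0, Disjoint (Metric.closedBall x r) S := by
    intro x hx
    obtain ⟨ε, hε, hball⟩ := Metric.isOpen_iff.1 hS.isClosed.isOpen_compl x (h.notMem_of_mem_left hx)
    exact ⟨ε / 2, by positivity, disjoint_left.2 fun y hy hyS =>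
      hball (Metric.closedBall_subset_ball (by linarith) hy) hyS⟩
  choose! r hr hd using this
  obtain ⟨s, hs, hcov⟩ := hK.elim_nhds_subcover (fun x => Metric.closedBall x (r x))
    fun x hx => Metric.closedBall_mem_nhds x (hr x hx)
  exact ⟨s, fun x => Metric.closedBall x (r x), fun x => isCompact_closedBall _ _,
    fun x => convex_closedBall _ _, fun i hi => ⟨hs i hi, Metric.mem_closedBall_self
      (hr i (hs i hi)).le⟩, hcov, fun i hi => hd i (hs i hi)⟩

lemma cyc_iff_disjoint {K : Set X} {z : Chain (k + 1) X} :
    Cyc Kᶜ z ↔ Disjoint K (supp (bd z)) := by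
  rw [disjoint_comm, ← subset_compl_iff_disjoint_right, ← mem_A_iff]
  rfl

/-- A chain of top degree or more that is zero at every point of a compact set is zero over it. -/
lemma zero_of_zero_points {K : Set (E n)} (hK : IsCompact K) (hk : n ≤ k) (hk0 : k ≠ 0)
    {z : Chain k (E n)} (hz : Cyc Kᶜ z) (h : ∀ y ∈ K, Zero {y}ᶜ z) : Zero Kᶜ z := by
  classical
  obtain ⟨k, rfl⟩ := Nat.exists_eq_succ_of_ne_zero hk0
  obtain ⟨s, B, hB, hc, hs, hcov, hd⟩ := exists_balls hK (isCompact_supp (bd z))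
    (cyc_iff_disjoint.1 hz)
  refine Zero.mono (U := (⋃ i ∈ s, B i)ᶜ) ?_ (compl_subset_compl.2 hcov)
  clear hcov
  induction s using Finset.induction_on with
  | empty => simpa using zero_of_mem (A_univ z)
  | insert a s ha ih =>
    rw [Finset.set_biUnion_insert, compl_union]
    have hcl : IsClosed (⋃ i ∈ s, B i) := (s.isCompact_biUnion fun i _ => hB i).isClosed
    refine Zero.inter (hB a).isClosed.isOpen_compl hcl.isOpen_compl ?_
      (ih (fun i hi => hs i (Finset.mem_insert_of_mem hi))
        fun i hi => hd i (Finset.mem_insert_of_mem hi)) ?_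
    · obtain ⟨ha1, ha2⟩ := hs a (Finset.mem_insert_self _ _)
      exact zero_of_zero_point (hB a) (hc a) ha2
        (cyc_iff_disjoint.2 (hd a (Finset.mem_insert_self _ _))) (h a ha1)
    · rw [← compl_inter, inter_iUnion₂]
      exact van_compl_biUnion_convex s (fun i => B a ∩ B i)
        (fun i => (hB a).inter_right (hB i).isClosed) (fun i => (hc a).inter (hc i)) (by omega)

end Euclidean

end CubicalChain

namespace CubicalChain

open Set Topology unitInterval

section Transfer

variable {X Y : Type} [TopologicalSpace X] [TopologicalSpace Y] {k n : ℕ}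

/-- The restriction of a partial homeomorphism to its source. -/
def sourceMap (φ : OpenPartialHomeomorph X Y) : C(φ.source, Y) :=
  ⟨φ.source.domRestrict φ, φ.isOpenEmbedding_restrict.continuous⟩

/-- The inclusion of the source of a partial homeomorphism. -/
def sourceIncl (φ : OpenPartialHomeomorph X Y) : C(φ.source, X) := ⟨Subtype.val, by fun_prop⟩

lemma isOpenEmbedding_sourceMap (φ : OpenPartialHomeomorph X Y) :
    IsOpenEmbedding (sourceMap φ) := φ.isOpenEmbedding_restrict

lemma isOpenEmbedding_sourceIncl (φ : OpenPartialHomeomorph X Y) :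
    IsOpenEmbedding (sourceIncl φ) := φ.open_source.isOpenEmbedding_subtypeVal

lemma sourceMap_preimage (φ : OpenPartialHomeomorph X Y) {L : Set X} (hL : L ⊆ φ.source) :
    sourceMap φ ⁻¹' (φ '' L)ᶜ = sourceIncl φ ⁻¹' Lᶜ := by
  ext x
  simp only [mem_preimage, mem_compl_iff, mem_image, not_iff_not]
  constructor
  · rintro ⟨y, hy, h⟩
    rwa [show sourceIncl φ x = y from (φ.injOn (hL hy) x.2 h).symm]
  · exact fun h => ⟨x, h, rfl⟩

lemma union_compl_of_subset {α : Type} {s t : Set α} (h : s ⊆ t) : t ∪ sᶜ = univ := by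
  rw [eq_univ_iff_forall]
  intro x
  by_cases hx : x ∈ s
  exacts [Or.inl (h hx), Or.inr hx]

lemma range_sourceIncl_union (φ : OpenPartialHomeomorph X Y) {L : Set X} (hL : L ⊆ φ.source) :
    range (sourceIncl φ) ∪ Lᶜ = univ := by
  rw [show range (sourceIncl φ) = φ.source from Subtype.range_coe]
  exact union_compl_of_subset hL

lemma range_sourceMap_union (φ : OpenPartialHomeomorph X Y) {L : Set X} (hL : L ⊆ φ.source) :
    range (sourceMap φ) ∪ (φ '' L)ᶜ = univ := by
  refine union_compl_of_subset ?_
  rintro _ ⟨x, hx, rfl⟩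
  exact ⟨⟨x, hL hx⟩, rfl⟩

variable [T2Space X] [T2Space Y]

lemma isOpen_compl_image (φ : OpenPartialHomeomorph X Y) {L : Set X} (hLc : IsCompact L)
    (hL : L ⊆ φ.source) : IsOpen (φ '' L)ᶜ :=
  (hLc.image_of_continuousOn (φ.continuousOn.mono hL)).isClosed.isOpen_compl

lemma exists_transfer (φ : OpenPartialHomeomorph X Y) {K : Set X} (hKc : IsCompact K)
    (hK : K ⊆ φ.source) {z : Chain k X} (hz : Cyc Kᶜ z) :
    ∃ y : Chain k Y, Cyc (φ '' K)ᶜ y ∧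
      ∀ L ⊆ K, IsCompact L → (Zero Lᶜ z ↔ Zero (φ '' L)ᶜ y) := by
  obtain ⟨z', hz', h⟩ := exists_cyc_map (isOpenEmbedding_sourceIncl φ)
    hKc.isClosed.isOpen_compl (range_sourceIncl_union φ hK) hz
  refine ⟨map (sourceMap φ) z', ?_, fun L hL hLc => ?_⟩
  · refine hz'.map _ ?_
    rw [← sourceMap_preimage φ hK]
    exact mapsTo_preimage _ _
  · rw [(h.mono (compl_subset_compl.2 hL)).iff]
    have hL' := hL.trans hK
    have hc := hz'.mono (preimage_mono (compl_subset_compl.2 hL))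
    constructor
    · intro h
      refine Zero.map _ ?_ (zero_of_zero_map (isOpenEmbedding_sourceIncl φ)
        hLc.isClosed.isOpen_compl (range_sourceIncl_union φ hL') hc h)
      rw [← sourceMap_preimage φ hL']
      exact mapsTo_preimage _ _
    · intro h
      rw [← sourceMap_preimage φ hL'] at hc
      have := zero_of_zero_map (isOpenEmbedding_sourceMap φ) (isOpen_compl_image φ hLc hL')
        (range_sourceMap_union φ hL') hc h
      rw [sourceMap_preimage φ hL'] at this
      exact this.map _ (mapsTo_preimage _ _)

lemma van_transfer (φ : OpenPartialHomeomorph X Y) {K : Set X} (hKc : IsCompact K)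
    (hK : K ⊆ φ.source) : Van k Kᶜ ↔ Van k (φ '' K)ᶜ := by
  rw [← van_iff (isOpenEmbedding_sourceIncl φ) hKc.isClosed.isOpen_compl
    (range_sourceIncl_union φ hK), ← van_iff (isOpenEmbedding_sourceMap φ)
    (isOpen_compl_image φ hKc hK) (range_sourceMap_union φ hK), sourceMap_preimage φ hK]

lemma two_transfer (φ : OpenPartialHomeomorph X Y) {K : Set X} (hKc : IsCompact K)
    (hK : K ⊆ φ.source) : Two k Kᶜ ↔ Two k (φ '' K)ᶜ := by
  rw [← two_iff (isOpenEmbedding_sourceIncl φ) hKc.isClosed.isOpen_compl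
    (range_sourceIncl_union φ hK), ← two_iff (isOpenEmbedding_sourceMap φ)
    (isOpen_compl_image φ hKc hK) (range_sourceMap_union φ hK), sourceMap_preimage φ hK]

end Transfer

/-- Every point has a chart to Euclidean space. -/
def LocEuc (n : ℕ) (M : Type) [TopologicalSpace M] : Prop :=
  ∀ x : M, ∃ φ : OpenPartialHomeomorph M (E n), x ∈ φ.source

namespace LocEuc

variable {M : Type} [TopologicalSpace M] [T2Space M] {k n : ℕ}

lemma van_point (hM : LocEuc n M) (hk : k ≠ n) (x : M) : Van k ({x}ᶜ : Set M) := by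
  obtain ⟨φ, hφ⟩ := hM x
  rw [van_transfer φ isCompact_singleton (singleton_subset_iff.2 hφ), image_singleton]
  exact CubicalChain.van_point hk _

lemma two_point (hM : LocEuc n M) (x : M) : Two n ({x}ᶜ : Set M) := by
  obtain ⟨φ, hφ⟩ := hM x
  rw [two_transfer φ isCompact_singleton (singleton_subset_iff.2 hφ), image_singleton]
  exact CubicalChain.two_point _

lemma image_isCompact {φ : OpenPartialHomeomorph M (E n)} {K : Set M} (hKc : IsCompact K)
    (hK : K ⊆ φ.source) : IsCompact (φ '' K) :=
  hKc.image_of_continuousOn (φ.continuousOn.mono hK)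

lemma zero_of_chart {φ : OpenPartialHomeomorph M (E n)} {K : Set M} (hKc : IsCompact K)
    (hK : K ⊆ φ.source) (hk : n ≤ k) (hk0 : k ≠ 0) {z : Chain k M} (hz : Cyc Kᶜ z)
    (h : ∀ y ∈ K, Zero {y}ᶜ z) : Zero Kᶜ z := by
  obtain ⟨y, hy, hyz⟩ := exists_transfer φ hKc hK hz
  rw [hyz K subset_rfl hKc]
  refine zero_of_zero_points (image_isCompact hKc hK) hk hk0 hy ?_
  rintro _ ⟨x, hx, rfl⟩
  have := (hyz {x} (singleton_subset_iff.2 hx) isCompact_singleton).1 (h x hx)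
  rwa [image_singleton] at this

lemma van_chart (hM : LocEuc n M) {φ : OpenPartialHomeomorph M (E n)} {K : Set M}
    (hKc : IsCompact K) (hK : K ⊆ φ.source) (hk : n < k) : Van k Kᶜ := fun z hz =>
  zero_of_chart hKc hK hk.le (by omega) hz fun y hy =>
    hM.van_point hk.ne' y z (hz.mono (compl_subset_compl.2 (singleton_subset_iff.2 hy)))

/-- A compact set is a finite union of compact sets subordinate to a family of neighbourhoods. -/
lemma exists_compact_cover {K : Set M} (hK : IsCompact K) (N : M → Set M)
    (hN : ∀ x ∈ K, N x ∈ 𝓝 x) : ∃ (s : Finset M) (C : M → Set M), (∀ x, IsCompact (C x)) ∧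
      (∀ x, C x ⊆ N x) ∧ (∀ x ∈ s, x ∈ K) ∧ K = ⋃ x ∈ s, C x := by
  obtain ⟨s, hs, hcov⟩ := hK.elim_nhds_subcover (fun x => interior (N x))
    fun x hx => interior_mem_nhds.2 (hN x hx)
  obtain ⟨C, hC, hCN, hKC⟩ := hK.finite_compact_cover s (fun x => interior (N x))
    (fun _ _ => isOpen_interior) hcov
  exact ⟨s, C, hC, fun x => (hCN x).trans interior_subset, hs, hKC⟩

lemma zero_of_points (hM : LocEuc n M) {K : Set M} (hK : IsCompact K) (hk : n ≤ k) (hk0 : k ≠ 0)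
    {z : Chain k M} (hz : Cyc Kᶜ z) (h : ∀ y ∈ K, Zero {y}ᶜ z) : Zero Kᶜ z := by
  classical
  choose φ hφ using hM
  obtain ⟨s, C, hC, hCN, -, rfl⟩ := exists_compact_cover hK (fun x => (φ x).source)
    fun x _ => (φ x).open_source.mem_nhds (hφ x)
  clear hK
  induction s using Finset.induction_on with
  | empty => simpa using zero_of_mem (A_univ z)
  | insert a s ha ih =>
    rw [Finset.set_biUnion_insert] at h hz ⊢
    rw [compl_union] at hz ⊢
    have hcl : IsClosed (⋃ i ∈ s, C i) := (s.isCompact_biUnion fun i _ => hC i).isClosed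
    refine Zero.inter (hC a).isClosed.isOpen_compl hcl.isOpen_compl
      (zero_of_chart (hC a) (hCN a) hk hk0 (hz.mono inter_subset_left) fun y hy => h y (Or.inl hy))
      (ih (hz.mono inter_subset_right) fun y hy => h y (Or.inr hy)) ?_
    rw [← compl_inter]
    exact van_chart (fun x => ⟨φ x, hφ x⟩) ((hC a).inter_right hcl)
      (inter_subset_left.trans (hCN a)) (by omega)

/-- Every neighbourhood contains a neighbourhood over which vanishing can be tested at a point. -/
lemma exists_cell (hM : LocEuc n M) {x : M} {N : Set M} (hN : N ∈ 𝓝 x) :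
    ∃ B ⊆ N, B ∈ 𝓝 x ∧ IsCompact B ∧ ∀ (k : ℕ) (z : Chain k M), Cyc Bᶜ z →
      ∀ y ∈ B, Zero {y}ᶜ z → Zero Bᶜ z := by
  obtain ⟨φ, hφ⟩ := hM x
  have hmem : φ.target ∩ φ.symm ⁻¹' N ∈ 𝓝 (φ x) := by
    refine Filter.inter_mem (φ.open_target.mem_nhds (φ.map_source hφ)) ?_
    exact (φ.continuousAt_symm (φ.map_source hφ)).preimage_mem_nhds (by rwa [φ.left_inv hφ])
  obtain ⟨r, hr, hball⟩ := Metric.nhds_basis_closedBall.mem_iff.1 hmem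
  have hsub : Metric.closedBall (φ x) r ⊆ φ.target := hball.trans inter_subset_left
  have himg : φ '' (φ.symm '' Metric.closedBall (φ x) r) = Metric.closedBall (φ x) r := by
    rw [← image_comp]
    exact (image_congr fun y hy => φ.right_inv (hsub hy)).trans (image_id _)
  have hsrc : φ.symm '' Metric.closedBall (φ x) r ⊆ φ.source := by
    rintro _ ⟨y, hy, rfl⟩
    exact φ.map_target (hsub hy)
  have hcomp : IsCompact (φ.symm '' Metric.closedBall (φ x) r) :=
    (isCompact_closedBall _ _).image_of_continuousOn (φ.symm.continuousOn.mono hsub)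
  refine ⟨φ.symm '' Metric.closedBall (φ x) r, ?_, ?_, hcomp, ?_⟩
  · rintro _ ⟨y, hy, rfl⟩
    exact (hball hy).2
  · have := φ.symm.image_mem_nhds (x := φ x) (φ.map_source hφ)
      (Metric.closedBall_mem_nhds (φ x) hr)
    rwa [φ.left_inv hφ] at this
  · intro k z hz y hy h
    obtain ⟨w, hw, hwz⟩ := exists_transfer φ hcomp hsrc hz
    rw [hwz _ subset_rfl hcomp]
    rw [hwz {y} (singleton_subset_iff.2 hy) isCompact_singleton, image_singleton] at h
    rw [himg] at hw ⊢
    exact zero_of_zero_point (isCompact_closedBall _ _) (convex_closedBall _ _)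
      (himg ▸ mem_image_of_mem φ hy) hw h

lemma cyc_of_cyc_points {K : Set M} {z : Chain k M} (h : ∀ y ∈ K, Cyc {y}ᶜ z) : Cyc Kᶜ z := by
  cases k with
  | zero => trivial
  | succ k =>
    rw [cyc_iff_disjoint, disjoint_left]
    intro y hy hs
    exact disjoint_left.1 (cyc_iff_disjoint.1 (h y hy)) rfl hs

lemma zero_compl_mono {K L : Set M} {z : Chain k M} (h : Zero Kᶜ z) (hL : L ⊆ K) : Zero Lᶜ z :=
  h.mono (compl_subset_compl.2 hL)

lemma cyc_compl_mono {K L : Set M} {z : Chain k M} (h : Cyc Kᶜ z) (hL : L ⊆ K) : Cyc Lᶜ z :=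
  h.mono (compl_subset_compl.2 hL)

/-- Vanishing at points is locally constant. -/
lemma eventually_zero_iff (hM : LocEuc n M) {x : M} {z : Chain k M} {N : Set M} (hN : N ∈ 𝓝 x)
    (hz : Cyc Nᶜ z) : ∀ᶠ y in 𝓝 x, Zero {y}ᶜ z ↔ Zero {x}ᶜ z := by
  obtain ⟨B, hBN, hB, -, h⟩ := hM.exists_cell hN
  filter_upwards [hB] with y hy
  have hz' := cyc_compl_mono hz hBN
  have hx := mem_of_mem_nhds hB
  exact ⟨fun h' => zero_compl_mono (h _ z hz' y hy h') (singleton_subset_iff.2 hx),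
    fun h' => zero_compl_mono (h _ z hz' x hx h') (singleton_subset_iff.2 hy)⟩

lemma exists_nhds_cyc {x : M} {z : Chain k M} (hz : Cyc {x}ᶜ z) :
    ∃ N ∈ 𝓝 x, Cyc Nᶜ z := by
  cases k with
  | zero => exact ⟨univ, Filter.univ_mem, trivial⟩
  | succ k =>
    refine ⟨(supp (bd z))ᶜ, (isCompact_supp _).isClosed.isOpen_compl.mem_nhds fun hs => ?_,
      cyc_iff_disjoint.2 disjoint_compl_left⟩
    exact disjoint_left.1 (cyc_iff_disjoint.1 hz) rfl hs

lemma exists_nhds_zero {x : M} {z : Chain k M} (hz : Zero {x}ᶜ z) :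
    ∃ N ∈ 𝓝 x, ∃ e, z + bd e ∈ A k Nᶜ := by
  obtain ⟨e, he⟩ := hz
  refine ⟨(supp (z + bd e))ᶜ, (isCompact_supp _).isClosed.isOpen_compl.mem_nhds fun hs => ?_,
    e, mem_A_iff.2 (by simp)⟩
  exact mem_A_iff.1 he hs rfl

/-- Local fundamental chains. -/
lemma exists_local_fund (hM : LocEuc n M) (x : M) : ∃ g : Chain n M, ∃ N ∈ 𝓝 x,
    ∀ y ∈ N, Cyc {y}ᶜ g ∧ ¬ Zero {y}ᶜ g := by
  obtain ⟨⟨g, hg, hg0⟩, -⟩ := hM.two_point x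
  obtain ⟨N, hN, hgN⟩ := exists_nhds_cyc hg
  refine ⟨g, _, Filter.inter_mem hN (hM.eventually_zero_iff hN hgN), fun y hy => ?_⟩
  exact ⟨cyc_compl_mono hgN (singleton_subset_iff.2 hy.1), fun h => hg0 (hy.2.1 h)⟩

/-- Gluing of local null-homologies in codimension one. -/
lemma exists_glue {m : ℕ} (hM : LocEuc (m + 1) M) {K : Set M} (hK : IsCompact K) {z : Chain m M}
    (e : M → Chain (m + 1) M) (N : M → Set M) (hN : ∀ x ∈ K, N x ∈ 𝓝 x)
    (he : ∀ x, z + bd (e x) ∈ A m (N x)ᶜ)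
    (hd : ∀ x ∈ K, ∀ y ∈ K, ∀ w ∈ K, w ∈ N x → w ∈ N y → Zero {w}ᶜ (e x + e y)) :
    ∃ c, z + bd c ∈ A m Kᶜ ∧ ∀ x ∈ K, ∀ w ∈ K, w ∈ N x → Zero {w}ᶜ (c + e x) := by
  classical
  obtain ⟨s, C, hC, hCN, hsK, hKC⟩ := exists_compact_cover hK N hN
  have key : ∀ t ⊆ s, ∃ c, z + bd c ∈ A m (⋃ i ∈ t, C i)ᶜ ∧
      ∀ x ∈ K, ∀ w ∈ ⋃ i ∈ t, C i, w ∈ N x → Zero {w}ᶜ (c + e x) := by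
    intro t
    induction t using Finset.induction_on with
    | empty => exact fun _ => ⟨0, by simp [A_univ], by simp⟩
    | insert a t ha ih =>
      intro hts
      obtain ⟨hat, hts'⟩ := Finset.insert_subset_iff.1 hts
      obtain ⟨c, hc, hcw⟩ := ih hts'
      have hsub : ∀ i ∈ s, C i ⊆ K := fun i hi => by
        rw [hKC]; exact subset_biUnion_of_mem (u := C) (Finset.mem_coe.2 hi)
      have hcmp : IsCompact (⋃ i ∈ t, C i) := t.isCompact_biUnion fun i _ => hC i
      have hea : z + bd (e a) ∈ A m (C a)ᶜ := A_mono (compl_subset_compl.2 (hCN a)) (he a)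
      have hz : Zero ((⋃ i ∈ t, C i)ᶜ ∪ (C a)ᶜ) (c + e a) := by
        rw [← compl_inter]
        refine hM.zero_of_points (hcmp.inter_right (hC a).isClosed) le_rfl (by omega) ?_
          fun y hy => hcw a (hsK a hat) y hy.1 (hCN a hy.2)
        have h1 := Submodule.add_mem _ (A_mono (compl_subset_compl.2 inter_subset_left) hc :
          _ ∈ A m ((⋃ i ∈ t, C i) ∩ C a)ᶜ) (A_mono (compl_subset_compl.2 inter_subset_right) hea)
        show bd (c + e a) ∈ _
        rw [map_add]
        convert h1 using 1
        grind [add_self z]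
      obtain ⟨c', hc', h1, h2⟩ := glue hcmp.isClosed.isOpen_compl (hC a).isClosed.isOpen_compl
        hc hea hz
      refine ⟨c', ?_, ?_⟩
      · rwa [Finset.set_biUnion_insert, compl_union, inter_comm]
      · intro x hx w hw hwx
        rw [Finset.set_biUnion_insert] at hw
        rcases hw with hw | hw
        · exact (zero_compl_mono h2 (singleton_subset_iff.2 hw)).trans
            (hd a (hsK a hat) x hx w (hsub a hat hw) (hCN a hw) hwx)
        · exact (zero_compl_mono h1 (singleton_subset_iff.2 hw)).trans (hcw x hx w hw hwx)
  obtain ⟨c, hc, hcw⟩ := key s subset_rfl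
  rw [← hKC] at hc hcw
  exact ⟨c, hc, hcw⟩

/-- The fundamental chain of a closed manifold. -/
lemma exists_fund {m : ℕ} [CompactSpace M] (hM : LocEuc (m + 1) M) :
    ∃ c : Chain (m + 1) M, bd c ∈ A m (∅ : Set M) ∧ ∀ x, ¬ Zero {x}ᶜ c := by
  choose g N hN hg using hM.exists_local_fund
  obtain ⟨c, hc, hcw⟩ := hM.exists_glue isCompact_univ (z := 0) g N (fun x _ => hN x)
    (fun x => by simpa [Cyc] using cyc_of_cyc_points fun y hy => (hg x y hy).1)
    (fun x _ y _ w _ hx hy => (hM.two_point w).2 _ _ (hg x w hx).1 (hg y w hy).1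
      (hg x w hx).2 (hg y w hy).2)
  refine ⟨c, by simpa using hc, fun x h => ?_⟩
  have hx := mem_of_mem_nhds (hN x)
  exact (hg x x hx).2 (((hcw x trivial x trivial hx).iff).1 h)

/-- In a closed manifold without homology in codimension one, the complement of a connected set
has none either. -/
lemma exists_bd_compl {m : ℕ} [CompactSpace M] (hM : LocEuc (m + 1) M)
    (h1 : Van m (∅ : Set M)) {F : Set M} (hF : IsClosed F) (hFc : IsPreconnected F)
    {u : Chain m M} (hu : u ∈ A m Fᶜ) (hu0 : Cyc ∅ u) :
    ∃ r ∈ A (m + 1) Fᶜ, u + bd r ∈ A m (∅ : Set M) := by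
  obtain ⟨r, hr⟩ := h1 u hu0
  suffices ∃ r', u + bd r' ∈ A m (∅ : Set M) ∧ Zero Fᶜ r' by
    obtain ⟨r', hr', q, hq⟩ := this
    exact ⟨_, hq, by simpa [bd_bd] using hr'⟩
  have hcyc : ∀ r, u + bd r ∈ A m (∅ : Set M) → Cyc Fᶜ r := fun r hr => by
    have := Submodule.add_mem _ (A_empty_le Fᶜ hr) hu
    show bd r ∈ _
    convert this using 1
    grind [add_self u]
  have hN : ∀ x ∈ F, ∃ N ∈ 𝓝 x, Cyc Nᶜ r := fun x hx =>
    exists_nhds_cyc (cyc_compl_mono (hcyc r hr) (singleton_subset_iff.2 hx))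
  have hconst : ∀ x ∈ F, ∀ y ∈ F, (Zero {x}ᶜ r ↔ Zero {y}ᶜ r) := by
    have hloc : ∀ x ∈ F, ∀ᶠ y in 𝓝[F] x, Zero {y}ᶜ r ↔ Zero {x}ᶜ r := fun x hx => by
      obtain ⟨N, hN, hNr⟩ := hN x hx
      exact nhdsWithin_le_nhds (hM.eventually_zero_iff hN hNr)
    intro x hx y hy
    exact hFc.induction₂ (fun x y => Zero {x}ᶜ r ↔ Zero {y}ᶜ r)
      (fun x hx => (hloc x hx).mono fun y h => h.symm)
      (fun x y z hx hy hz h1 h2 => h1.trans h2) (fun x y hx hy h => h.symm) hx hy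
  by_cases hall : ∀ x ∈ F, Zero {x}ᶜ r
  · exact ⟨r, hr, hM.zero_of_points hF.isCompact le_rfl (by omega) (hcyc r hr) hall⟩
  · push Not at hall
    obtain ⟨x, hx, hx0⟩ := hall
    obtain ⟨c, hc, hc0⟩ := hM.exists_fund
    have hr' : u + bd (r + c) ∈ A m (∅ : Set M) := by
      rw [map_add, ← add_assoc]
      exact Submodule.add_mem _ hr hc
    refine ⟨r + c, hr', hM.zero_of_points hF.isCompact le_rfl (by omega) (hcyc _ hr') ?_⟩
    intro y hy
    refine (hM.two_point y).2 _ _ (cyc_compl_mono (hcyc r hr) (singleton_subset_iff.2 hy))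
      (Cyc.mono (U := ∅) hc (empty_subset _)) (fun h => hx0 ((hconst x hx y hy).2 h)) (hc0 y)

end LocEuc

end CubicalChain

namespace CubicalChain

open Set Topology unitInterval

variable {X : Type} [TopologicalSpace X]

/-- The 1-cube of a path. -/
def edge {x y : X} (γ : Path x y) : Cube 1 X := γ.toContinuousMap.comp ⟨fun v => v 0, by fun_prop⟩

@[simp] lemma edge_apply {x y : X} (γ : Path x y) (v : Fin 1 → I) : edge γ v = γ (v 0) := rfl

lemma bd_gen_one (c : Cube 1 X) : bd (gen c) = gen (pt (c 0)) + gen (pt (c 1)) := by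
  rw [bd_gen, Fin.sum_univ_one]
  have (b : I) : c.comp (face 0 b) = pt (c fun _ => b) := by
    ext1 x
    simp only [ContinuousMap.comp_apply, ContinuousMap.const_apply]
    congr 1
    funext i
    rw [Subsingleton.elim i 0]
    simp
  rw [this, this]
  rfl

lemma bd_edge {x y : X} (γ : Path x y) : bd (gen (edge γ)) = gen (pt x) + gen (pt y) := by
  simp [bd_gen_one]

/-- The path of a 1-cube. -/
def cubePath (c : Cube 1 X) : Path (c 0) (c 1) where
  toFun t := c fun _ => t
  source' := rfl
  target' := rfl

lemma edge_cubePath (c : Cube 1 X) : edge (cubePath c) = c := by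
  ext1 v
  refine congrArg c (funext fun i => ?_)
  rw [Subsingleton.elim i 0]
  rfl

lemma exists_chain_of_joinedIn {U : Set X} {x y : X} (h : JoinedIn U x y) :
    ∃ a ∈ A 1 U, bd a = gen (pt x) + gen (pt y) := by
  refine ⟨gen (edge h.somePath), gen_mem (Or.inl ?_), bd_edge _⟩
  rintro _ ⟨v, rfl⟩
  exact h.somePath_mem _

open Classical in
/-- The indicator of the 0-cubes in a path component. -/
def pathInd (U : Set X) (x : X) : Chain 0 X →ₗ[ZMod 2] ZMod 2 :=
  Finsupp.linearCombination (ZMod 2) fun c => if JoinedIn U x (c 0) then 1 else 0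

open Classical in
lemma pathInd_gen (U : Set X) (x : X) (c : Cube 0 X) :
    pathInd U x (gen c) = if JoinedIn U x (c 0) then 1 else 0 := by
  simp [pathInd]

lemma pathInd_bd {U : Set X} {x : X} {a : Chain 1 X} (ha : a ∈ A 1 U) :
    pathInd U x (bd a) = 0 := by
  have key : ∀ c : Cube 1 X, range c ⊆ U ∨ Degen c → pathInd U x (bd (gen c)) = 0 := by
    intro c hc
    rw [bd_gen_one, map_add, pathInd_gen, pathInd_gen]
    have : JoinedIn U x (c 0) ↔ JoinedIn U x (c 1) := by
      rcases hc with hc | ⟨i, hi⟩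
      · have hj : JoinedIn U (c 0) (c 1) := ⟨cubePath c, fun t => hc ⟨_, rfl⟩⟩
        exact ⟨fun h => h.trans hj, fun h => h.trans hj.symm⟩
      · rw [show c 0 = c 1 by
          rw [← hi 0 1]
          congr 1
          funext j
          rw [Subsingleton.elim j i]
          simp]
    have h' : JoinedIn U x (pt (c 0) 0) ↔ JoinedIn U x (pt (c 1) 0) := this
    by_cases h : JoinedIn U x (pt (c 1) 0)
    · rw [if_pos (h'.2 h), if_pos h]; rfl
    · rw [if_neg (mt h'.1 h), if_neg h]; rfl
  rw [← Finsupp.sum_single a, Finsupp.sum, map_sum, map_sum]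
  refine Finset.sum_eq_zero fun c hc => ?_
  have h1 : Finsupp.single c (a c) = a c • gen c := by simp
  rw [h1, map_smul, map_smul, key c (ha hc), smul_zero]

lemma joinedIn_of_chain {U : Set X} {x y : X} (hx : x ∈ U) {a : Chain 1 X} (ha : a ∈ A 1 U)
    (h : bd a = gen (pt x) + gen (pt y)) : JoinedIn U x y := by
  by_contra hn
  have := pathInd_bd (x := x) ha
  rw [h, map_add, pathInd_gen, pathInd_gen] at this
  simp [hn, JoinedIn.refl hx] at this

/-- **Janiszewski's theorem.** -/
theorem joinedIn_compl_union [T2Space X] [CompactSpace X] (hX : LocEuc 2 X)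
    (h1 : Van 1 (∅ : Set X)) {K L : Set X} (hK : IsClosed K) (hL : IsClosed L)
    (hKL : IsPreconnected (K ∩ L)) {x y : X} (hxK : JoinedIn Kᶜ x y) (hxL : JoinedIn Lᶜ x y) :
    JoinedIn (K ∪ L)ᶜ x y := by
  obtain ⟨a, ha, ha'⟩ := exists_chain_of_joinedIn hxK
  obtain ⟨b, hb, hb'⟩ := exists_chain_of_joinedIn hxL
  obtain ⟨r, hr, hr'⟩ := hX.exists_bd_compl h1 (hK.inter hL) hKL (u := a + b)
    (Submodule.add_mem _ (A_mono (compl_subset_compl.2 inter_subset_left) ha)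
      (A_mono (compl_subset_compl.2 inter_subset_right) hb))
    (by show bd (a + b) ∈ _; rw [map_add, ha', hb', add_self]; exact Submodule.zero_mem _)
  rw [compl_inter] at hr
  obtain ⟨N, hN⟩ := exists_sd_pow_split hK.isOpen_compl hL.isOpen_compl hr
  obtain ⟨r₁, hr₁, r₂, hr₂, hrr⟩ := hN N le_rfl
  rw [compl_union]
  have hx : x ∈ Kᶜ ∩ Lᶜ := ⟨hxK.source_mem, hxL.source_mem⟩
  have e1 : (sd ^ N) a + bd r₁ ∈ A 1 Kᶜ := Submodule.add_mem _ (sd_pow_mem N ha) (bd_mem hr₁)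
  have e2 : (sd ^ N) b + bd r₂ ∈ A 1 Lᶜ := Submodule.add_mem _ (sd_pow_mem N hb) (bd_mem hr₂)
  have e3 := sd_pow_mem N hr'
  rw [map_add, map_add, ← bd_sd_pow, hrr, map_add] at e3
  refine joinedIn_of_chain hx (A_inter e1 ?_) ?_
  · have := Submodule.add_mem _ e2 (A_empty_le Lᶜ e3)
    convert this using 1
    grind [add_self ((sd ^ N) b), add_self (bd r₂)]
  · rw [map_add, bd_bd, add_zero, bd_sd_pow, sd_pow_zero_dim, ha']

lemma sd_edge_trans {x y z : X} (γ : Path x y) (δ : Path y z) :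
    sd (gen (edge (γ.trans δ))) = gen (edge γ) + gen (edge δ) := by
  rw [sd_gen, ← (Equiv.funUnique (Fin 1) Bool).symm.sum_comp, Fintype.sum_bool, add_comm]
  congr 2
  · ext1 v
    have h1 := (v 0).2.1
    have h2 := (v 0).2.2
    simp only [ContinuousMap.comp_apply, edge_apply, subcube_apply, Path.trans_apply]
    rw [dif_pos (by simp [half]; linarith)]
    congr 1
    ext
    simp [half]
    ring
  · ext1 v
    have h1 := (v 0).2.1
    have h2 := (v 0).2.2
    simp only [ContinuousMap.comp_apply, edge_apply, subcube_apply, Path.trans_apply]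
    by_cases h : v 0 = 0
    · rw [dif_pos (by simp [half, h])]
      have e : δ (v 0) = y := by rw [h, δ.source]
      rw [e]
      convert γ.target
      simp [half, h]
    · have : (0 : ℝ) < v 0 := lt_of_le_of_ne h1 fun h' => h (Subtype.ext h'.symm)
      rw [dif_neg (by simp [half]; linarith)]
      congr 1
      ext
      simp [half]
      ring

lemma zero_edge_of_homotopic {x y : X} {γ δ : Path x y} (h : γ.Homotopic δ) :
    Zero (∅ : Set X) (gen (edge γ) + gen (edge δ)) := by
  obtain ⟨F⟩ := h
  obtain ⟨q, hq⟩ : ∃ q : Cube 2 X, ∀ v, q v = F (v 0, v 1) :=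
    ⟨F.toContinuousMap.comp ⟨fun v => (v 0, v 1), by fun_prop⟩, fun _ => rfl⟩
  refine ⟨gen q, ?_⟩
  have e0 : q.comp (face 0 0) = edge γ := by
    ext1 v; simp [hq, Fin.insertNth_zero']
  have e1 : q.comp (face 0 1) = edge δ := by
    ext1 v; simp [hq, Fin.insertNth_zero']
  have hd (b : I) (hb : b = 0 ∨ b = 1) : gen (q.comp (face 1 b)) ∈ A 1 (∅ : Set X) := by
    refine gen_mem (Or.inr ⟨0, fun v a => ?_⟩)
    rcases hb with rfl | rfl <;> simp [hq]
  rw [bd_gen, Fin.sum_univ_two, e0, e1, ← add_assoc, add_self, zero_add]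
  exact Submodule.add_mem _ (hd 0 (Or.inl rfl)) (hd 1 (Or.inr rfl))

lemma zero_edge_trans {x y z : X} (γ : Path x y) (δ : Path y z) :
    Zero (∅ : Set X) (gen (edge (γ.trans δ)) + (gen (edge γ) + gen (edge δ))) := by
  refine ⟨T (gen (edge (γ.trans δ))), ?_⟩
  have := T_homotopy (gen (edge (γ.trans δ)))
  rw [sd_edge_trans, T_zero, add_zero] at this
  convert this using 1
  grind

/-- A simply connected space has no first homology. -/
theorem van_one_of_simplyConnected [SimplyConnectedSpace X] : Van 1 (∅ : Set X) := by
  obtain ⟨p⟩ := (inferInstance : Nonempty X)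
  obtain ⟨γ⟩ : Nonempty (∀ x : X, Path x p) := ⟨fun x => PathConnectedSpace.somePath x p⟩
  let G : Chain 0 X →ₗ[ZMod 2] Chain 1 X := ext fun c => gen (edge (γ (c 0)))
  have key : ∀ z : Chain 1 X, Zero (∅ : Set X) (z + G (bd z)) := by
    intro z
    induction z using Finsupp.induction_linear with
    | zero => simpa using zero_of_mem (Submodule.zero_mem _)
    | add z w hz hw =>
      convert hz.add hw using 1
      rw [map_add, map_add]
      abel
    | single c a =>
      rcases zmod_two_cases a with rfl | rfl
      · simpa using zero_of_mem (Submodule.zero_mem _)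
      · have h1 := zero_edge_of_homotopic (SimplyConnectedSpace.paths_homotopic (γ (c 0))
          ((cubePath c).trans (γ (c 1))))
        have h2 := h1.trans (zero_edge_trans (cubePath c) (γ (c 1)))
        have h3 : G (bd (gen c)) = gen (edge (γ (c 0))) + gen (edge (γ (c 1))) := by
          simp [G, bd_gen_one, ext_gen]
        rw [edge_cubePath] at h2
        rw [h3]
        convert h2 using 1
        abel
  intro z hz
  have := key z
  rwa [A_zero_empty hz, map_zero, add_zero] at this

end CubicalChain

namespace CubicalChain

open Set Topology unitInterval

/-- The double cover defined by a cocycle with values in `ℤ/2`. -/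
def cocycleCore {X : Type} [TopologicalSpace X] (F : Type) [TopologicalSpace F]
    [DiscreteTopology F] [AddCommGroup F] (U : X → Set X)
    (hU : ∀ x, IsOpen (U x)) (hxU : ∀ x, x ∈ U x) (d : X → X → X → F)
    (hd : ∀ i j, ∀ p ∈ U i ∩ U j, ∀ᶠ q in 𝓝 p, d i j q = d i j p)
    (hc : ∀ i j k, ∀ p ∈ U i ∩ U j ∩ U k, d i j p + d j k p = d i k p) :
    FiberBundleCore X X F where
  baseSet := U
  isOpen_baseSet := hU
  indexAt := id
  mem_baseSet_at := hxU
  coordChange i j p v := v + d i j p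
  coordChange_self i p hp v := by
    have := hc i i i p ⟨⟨hp, hp⟩, hp⟩
    simpa using this
  continuousOn_coordChange i j := by
    refine continuousOn_snd.add fun p hp => ?_
    refine (continuousAt_const (y := d i j p.1)).congr ?_ |>.continuousWithinAt
    filter_upwards [continuousAt_fst.eventually (hd i j p.1 hp.1)] with q hq
    exact hq.symm
  coordChange_comp i j k p hp v := by
    rw [add_assoc, hc i j k p hp]

lemma exists_cochain {X : Type} [TopologicalSpace X] [SimplyConnectedSpace X]
    [LocallyPathConnectedSpace X] (F : Type) [TopologicalSpace F]
    [DiscreteTopology F] [AddCommGroup F] (U : X → Set X)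
    (hU : ∀ x, IsOpen (U x)) (hxU : ∀ x, x ∈ U x) (d : X → X → X → F)
    (hd : ∀ i j, ∀ p ∈ U i ∩ U j, ∀ᶠ q in 𝓝 p, d i j q = d i j p)
    (hc : ∀ i j k, ∀ p ∈ U i ∩ U j ∩ U k, d i j p + d j k p = d i k p) :
    ∃ v : X → X → F, (∀ i, ∀ p ∈ U i, ∀ᶠ q in 𝓝 p, v i q = v i p) ∧
      ∀ i j, ∀ p ∈ U i ∩ U j, v j p = v i p + d i j p := by
  obtain ⟨Z, hZ⟩ : ∃ Z, Z = cocycleCore F U hU hxU d hd hc := ⟨_, rfl⟩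
  have cov : IsCoveringMap (Z.proj) := FiberBundle.isCoveringMap (F := F) (E := Z.Fiber)
  obtain ⟨x₀⟩ := (inferInstance : Nonempty X)
  obtain ⟨G, ⟨-, hG⟩, -⟩ := cov.existsUnique_continuousMap_lifts (ContinuousMap.id X) x₀
    ⟨x₀, (0 : F)⟩ rfl
  have hG1 : ∀ x, (G x).1 = x := fun x => congrFun hG x
  have hcont : ∀ i, ∀ p ∈ U i, ContinuousAt (fun q => Z.localTriv i (G q)) p := by
    intro i p hp
    have : G p ∈ (Z.localTriv i).source := by
      rw [FiberBundleCore.mem_localTriv_source, ← FiberBundleCore.baseSet_at, hG1, hZ]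
      exact hp
    exact ((Z.localTriv i).toOpenPartialHomeomorph.continuousAt this).comp G.continuous.continuousAt
  have hv : ∀ i p, (Z.localTriv i (G p)).2 = (show F from (G p).2) + d p i p := by
    intro i p
    rw [FiberBundleCore.localTriv_apply]
    subst hZ
    show (show F from (G p).2) + d (G p).1 i (G p).1 = _
    rw [hG1]
  refine ⟨fun i p => (Z.localTriv i (G p)).2, fun i p hp => ?_, fun i j p hp => ?_⟩
  · have h1 : ContinuousAt (fun q => (Z.localTriv i (G q)).2) p :=
      continuousAt_snd.comp (hcont i p hp)
    exact h1.eventually (isOpen_discrete {(Z.localTriv i (G p)).2} |>.mem_nhds rfl)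
  · simp only [hv]
    rw [← hc p i j p ⟨⟨hxU p, hp.1⟩, hp.2⟩]
    exact (add_assoc (G := F) _ _ _).symm

namespace LocEuc
variable {M : Type} [TopologicalSpace M] [T2Space M]

open Classical in
/-- The local degree of a chain at a point. -/
def deg {k : ℕ} (w : M) (z : Chain k M) : ZMod 2 := if Zero {w}ᶜ z then 0 else 1

lemma deg_eq_zero {k : ℕ} {w : M} {z : Chain k M} : deg w z = 0 ↔ Zero {w}ᶜ z := by
  unfold deg; split_ifs with h <;> simp [h]

lemma deg_add {n : ℕ} (hM : LocEuc n M) {w : M} {y z : Chain n M} (hy : Cyc {w}ᶜ y)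
    (hz : Cyc {w}ᶜ z) : deg w (y + z) = deg w y + deg w z := by
  unfold deg
  by_cases h1 : Zero {w}ᶜ y
  · rw [if_pos h1, zero_add]
    by_cases h2 : Zero {w}ᶜ z
    · rw [if_pos (h1.add h2), if_pos h2]
    · rw [if_neg (mt h1.add_iff.1 h2), if_neg h2]
  · by_cases h2 : Zero {w}ᶜ z
    · rw [if_neg h1, if_pos h2, if_neg fun h => h1 (h.of_add h2), add_zero]
    · rw [if_neg h1, if_neg h2, if_pos ((hM.two_point w).2 _ _ hy hz h1 h2)]
      rfl

lemma deg_smul {k : ℕ} {w : M} {z : Chain k M} (hz : ¬ Zero {w}ᶜ z) (a : ZMod 2) :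
    deg w (a • z) = a := by
  rcases zmod_two_cases a with rfl | rfl
  · rw [zero_smul, deg_eq_zero]
    exact zero_of_mem (Submodule.zero_mem _)
  · rw [one_smul, deg, if_neg hz]

/-- Relative cycles in codimension one vanish over a simply connected compact set. -/
theorem zero_of_simplyConnected {m : ℕ} (hM : LocEuc (m + 1) M) {X : Type} [TopologicalSpace X]
    [SimplyConnectedSpace X] [LocallyPathConnectedSpace X] [CompactSpace X] {j : X → M}
    (hj : IsEmbedding j) {f : Chain m M} (hf : Cyc (range j)ᶜ f) : Zero (range j)ᶜ f := by
  have h0 : ∀ x, ∃ N, IsOpen N ∧ j x ∈ N ∧ ∃ e, f + bd e ∈ A m Nᶜ := fun x => by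
    obtain ⟨N, hN, e, he⟩ := exists_nhds_zero (hM.van_point (by omega) _ _
      (cyc_compl_mono hf (singleton_subset_iff.2 ⟨x, rfl⟩)))
    exact ⟨interior N, isOpen_interior, mem_interior_iff_mem_nhds.2 hN, e,
      A_mono (compl_subset_compl.2 interior_subset) he⟩
  choose N hNo hxN e he using h0
  have hcyc : ∀ x y, ∀ w ∈ N x ∩ N y, Cyc {w}ᶜ (e x + e y) := by
    intro x y w hw
    have h1 := Submodule.add_mem _
      (A_mono (compl_subset_compl.2 (singleton_subset_iff.2 hw.1)) (he x))
      (A_mono (compl_subset_compl.2 (singleton_subset_iff.2 hw.2)) (he y))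
    show bd (e x + e y) ∈ _
    rw [map_add]
    convert h1 using 1
    grind [add_self f]
  obtain ⟨v, hv, hvd⟩ := exists_cochain (ZMod 2) (fun x => j ⁻¹' N x)
    (fun x => (hNo x).preimage hj.continuous) hxN (fun x y p => deg (j p) (e x + e y))
    (fun x y p hp => by
      have := hM.eventually_zero_iff (((hNo x).inter (hNo y)).mem_nhds hp)
        (cyc_of_cyc_points (hcyc x y))
      filter_upwards [hj.continuous.continuousAt.eventually this] with q hq
      unfold deg
      by_cases h : Zero {j p}ᶜ (e x + e y)
      · rw [if_pos h, if_pos (hq.2 h)]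
      · rw [if_neg h, if_neg (mt hq.1 h)])
    (fun x y z p hp => by
      rw [← hM.deg_add (hcyc x y _ hp.1) (hcyc y z _ ⟨hp.1.2, hp.2⟩)]
      congr 1
      grind [add_self (e y)])
  choose g G hG hg using hM.exists_local_fund
  have hP : ∀ x, ∃ P ∈ 𝓝 (j x), ∀ q, j q ∈ P → v x q = v x x := fun x => by
    have := hv x x (hxN x)
    rw [hj.nhds_eq_comap] at this
    exact Filter.eventually_comap.1 this |> fun h => ⟨_, h, fun q hq => hq q rfl⟩
  choose P hP hPv using hP
  have hpre : ∀ y : M, ∃ x, y ∈ range j → j x = y := fun y => by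
    by_cases h : y ∈ range j
    · exact h.imp fun x hx _ => hx
    · exact ⟨Classical.arbitrary X, fun h' => absurd h' h⟩
  choose s hs using hpre
  obtain ⟨c, hc, -⟩ := hM.exists_glue (isCompact_range hj.continuous) (z := f)
    (fun y => e (s y) + v (s y) (s y) • g (j (s y)))
    (fun y => N (s y) ∩ G (j (s y)) ∩ P (s y))
    (fun y hy => by
      have h := hs y hy
      have := Filter.inter_mem (Filter.inter_mem ((hNo (s y)).mem_nhds (hxN _)) (hG (j (s y))))
        (hP (s y))
      rwa [h] at this ⊢)
    (fun y => by
      rw [map_add, ← add_assoc]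
      refine Submodule.add_mem _ (A_mono (compl_subset_compl.2 fun w hw => hw.1.1) (he _)) ?_
      rw [map_smul]
      refine Submodule.smul_mem _ _ ?_
      exact cyc_of_cyc_points fun w hw => (hg _ w hw.1.2).1)
    (by
      rintro y - z - _ ⟨p, rfl⟩ hy hz
      have h1 := hcyc (s y) (s z) (j p) ⟨hy.1.1, hz.1.1⟩
      have h2 : ∀ (a : ZMod 2) y, j p ∈ G y → Cyc {j p}ᶜ (a • g y) := fun a y hy => by
        show bd _ ∈ _
        rw [map_smul]
        exact Submodule.smul_mem _ _ (hg y _ hy).1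
      have h3 := h2 (v (s y) (s y)) _ hy.1.2
      have h4 := h2 (v (s z) (s z)) _ hz.1.2
      rw [show e (s y) + v (s y) (s y) • g (j (s y)) + (e (s z) + v (s z) (s z) • g (j (s z))) =
        e (s y) + e (s z) + (v (s y) (s y) • g (j (s y)) + v (s z) (s z) • g (j (s z))) by abel,
        ← deg_eq_zero, hM.deg_add h1 (h3.add h4), hM.deg_add h3 h4,
        deg_smul (hg _ _ hy.1.2).2, deg_smul (hg _ _ hz.1.2).2]
      have h5 := hvd (s y) (s z) p ⟨hy.1.1, hz.1.1⟩
      rw [hPv _ p hy.2, hPv _ p hz.2] at h5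
      rw [h5]
      generalize deg (j p) (e (s y) + e (s z)) = a
      generalize v (s y) (s y) = b
      revert a b
      decide)
  exact ⟨c, hc⟩

end LocEuc

end CubicalChain

namespace CubicalChain

open Set Topology unitInterval

lemma zero_of_project {B Y : Type} [TopologicalSpace B] [TopologicalSpace Y] {W : Set Y} {k : ℕ}
    (t : C(B, W)) (π : C(W, B)) (h : ∀ b, π (t b) = b) {u : Chain k B} {f : Chain (k + 1) Y}
    (hf : bd f + map (ContinuousMap.comp ⟨Subtype.val, continuous_subtype_val⟩ t) u ∈
      A k (∅ : Set Y)) (hz : Zero W f) : Zero ∅ u := by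
  obtain ⟨e, he⟩ := hz
  let ψ : C(W, Y) := ⟨Subtype.val, continuous_subtype_val⟩
  obtain ⟨r, hr⟩ := exists_pullback (ψ := ψ) IsInducing.subtypeVal
    (by rwa [show range ψ = W from Subtype.range_coe])
  have h1 : map ψ (bd r + map t u) ∈ A k (∅ : Set Y) := by
    have h2 := bd_mem hr
    rw [map_add, map_add, bd_bd, add_zero, bd_map] at h2
    have h3 := Submodule.add_mem _ h2 hf
    rw [map_add, map_map]
    have h4 : ∀ a b c : Chain k Y, (a + b) + (a + c) = b + c := by
      intro a b c
      grind [add_self a]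
    rwa [h4] at h3
  have h2 := map_mem π (V := ∅) (fun _ h => h) (mem_of_map_mem (ψ := ψ) Subtype.val_injective h1)
  rw [map_add, map_map, ← bd_map, show π.comp t = ContinuousMap.id _ from ContinuousMap.ext h,
    map_id] at h2
  exact ⟨map π r, by rwa [add_comm]⟩

section HalfSpace

instance : T2Space (EuclideanHalfSpace 3) :=
  inferInstanceAs (T2Space {x : EuclideanSpace ℝ (Fin 3) // 0 ≤ x 0})

/-- The coordinates of a point of the half-space. -/
def co (h : EuclideanHalfSpace 3) : E 3 := fun i => h.1 i

/-- The retraction of Euclidean space onto the half-space. -/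
def hs (y : E 3) : EuclideanHalfSpace 3 :=
  ⟨WithLp.toLp 2 (Function.update y 0 (max (y 0) 0)), by simp⟩

lemma co_hs (y : E 3) : co (hs y) = Function.update y 0 (max (y 0) 0) := rfl

lemma co_nonneg (h : EuclideanHalfSpace 3) : 0 ≤ co h 0 := h.2

lemma co_hs_of_nonneg {y : E 3} (hy : 0 ≤ y 0) : co (hs y) = y := by
  rw [co_hs, max_eq_left hy, Function.update_eq_self]

lemma co_injective : Function.Injective co := by
  intro a b h
  apply Subtype.ext
  ext i
  exact congrFun h i

lemma hs_co (h : EuclideanHalfSpace 3) : hs (co h) = h :=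
  co_injective (co_hs_of_nonneg (co_nonneg h))

@[fun_prop]
lemma continuous_co : Continuous co := by
  unfold co
  fun_prop

@[fun_prop]
lemma continuous_hs : Continuous hs := by
  unfold hs
  refine Continuous.subtype_mk ?_ _
  refine (PiLp.continuous_toLp 2 _).comp ?_
  exact continuous_id.update 0 (by fun_prop)

lemma van_edge {h : EuclideanHalfSpace 3} (h0 : co h 0 = 0) :
    Van 3 ({h}ᶜ : Set (EuclideanHalfSpace 3)) := by
  let p : E 3 := Function.update (co h) 0 1
  have hp0 : p 0 = 1 := by simp [p]
  let F : C(I × EuclideanHalfSpace 3, EuclideanHalfSpace 3) :=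
    ⟨fun q => hs ((1 - (q.1 : ℝ)) • co q.2 + (q.1 : ℝ) • p), by fun_prop⟩
  have hF : ∀ t x, F (t, x) = hs ((1 - (t : ℝ)) • co x + (t : ℝ) • p) := fun _ _ => rfl
  refine van_of_contraction F ?_ (hs p) ?_ ?_ ?_
  · intro x
    simp [hF, hs_co]
  · intro x
    simp [hF]
  · intro hh
    have := congrFun (congrArg co (mem_singleton_iff.1 hh)) 0
    rw [co_hs_of_nonneg (by rw [hp0]; norm_num), hp0, h0] at this
    norm_num at this
  · intro t x hx hh
    have ht := t.2
    have hx0 := co_nonneg x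
    have hnn : 0 ≤ ((1 - (t : ℝ)) • co x + (t : ℝ) • p) 0 := by
      simp only [Pi.add_apply, Pi.smul_apply, smul_eq_mul, hp0]
      have := mul_nonneg (sub_nonneg.2 ht.2) hx0
      linarith [ht.1]
    have h1 := congrFun (congrArg co (mem_singleton_iff.1 hh)) 0
    rw [hF, co_hs_of_nonneg hnn, h0] at h1
    simp only [Pi.add_apply, Pi.smul_apply, smul_eq_mul, hp0] at h1
    have ht0 : (t : ℝ) = 0 := by
      have := mul_nonneg (sub_nonneg.2 ht.2) hx0
      linarith [ht.1]
    apply hx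
    rw [mem_singleton_iff, ← mem_singleton_iff.1 hh, hF, ht0]
    simp [hs_co]

/-- The inclusion of the open half-space into Euclidean space. -/
def openHalf : OpenPartialHomeomorph (EuclideanHalfSpace 3) (E 3) where
  toFun := co
  invFun := hs
  source := {h | 0 < co h 0}
  target := {y | 0 < y 0}
  map_source' := fun _ h => h
  map_target' := fun y hy => by
    rw [mem_ofPred_eq, co_hs_of_nonneg (le_of_lt hy)]
    exact hy
  left_inv' := fun h _ => hs_co h
  right_inv' := fun y hy => co_hs_of_nonneg (le_of_lt hy)
  open_source := isOpen_lt (f := fun _ => (0 : ℝ)) (g := fun h => co h 0) (by fun_prop) (by fun_prop)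
  open_target := isOpen_lt (f := fun _ => (0 : ℝ)) (g := fun y : E 3 => y 0) (by fun_prop) (by fun_prop)
  continuousOn_toFun := continuous_co.continuousOn
  continuousOn_invFun := continuous_hs.continuousOn

lemma two_inside {h : EuclideanHalfSpace 3} (h0 : 0 < co h 0) :
    Two 3 ({h}ᶜ : Set (EuclideanHalfSpace 3)) := by
  rw [two_transfer openHalf isCompact_singleton (singleton_subset_iff.2 h0), image_singleton]
  exact two_point _

lemma Two.not_van {X : Type} [TopologicalSpace X] {k : ℕ} {U : Set X} (h : Two k U) : ¬ Van k U :=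
  fun hv => let ⟨⟨z, hz, hn⟩, _⟩ := h; hn (hv z hz)

end HalfSpace

section Boundary

variable {X : Type} [TopologicalSpace X] [T2Space X]

/-- The points at which the local homology vanishes: the boundary of a 3-manifold. -/
def bdry (X : Type) [TopologicalSpace X] : Set X := {x | Van 3 ({x}ᶜ : Set X)}

lemma mem_bdry_iff {φ : OpenPartialHomeomorph X (EuclideanHalfSpace 3)} {x : X}
    (hx : x ∈ φ.source) : x ∈ bdry X ↔ co (φ x) 0 = 0 := by
  have h := van_transfer (k := 3) φ isCompact_singleton (singleton_subset_iff.2 hx)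
  rw [image_singleton] at h
  rw [bdry, mem_ofPred_eq, h]
  refine ⟨fun hv => ?_, van_edge⟩
  by_contra h0
  exact (two_inside (lt_of_le_of_ne (co_nonneg _) (Ne.symm h0))).not_van hv

lemma boundary_eq_bdry [ChartedSpace (EuclideanHalfSpace 3) X] :
    (modelWithCornersEuclideanHalfSpace 3).boundary X = bdry X := by
  ext x
  rw [mem_bdry_iff (mem_chart_source (EuclideanHalfSpace 3) x)]
  change ModelWithCorners.IsBoundaryPoint _ x ↔ _
  rw [ModelWithCorners.isBoundaryPoint_iff, frontier_range_modelWithCornersEuclideanHalfSpace]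
  simp only [extChartAt, mem_ofPred_eq]
  exact ⟨fun h => h.symm, fun h => h.symm⟩

/-- The property of being locally modelled on the half-space. -/
def LocHalf (X : Type) [TopologicalSpace X] : Prop :=
  ∀ x : X, ∃ φ : OpenPartialHomeomorph X (EuclideanHalfSpace 3), x ∈ φ.source

lemma isClosed_bdry (hX : LocHalf X) : IsClosed (bdry X) := by
  rw [← isOpen_compl_iff, isOpen_iff_mem_nhds]
  intro x hx
  obtain ⟨φ, hφ⟩ := hX x
  have hc : ContinuousAt (fun y => co (φ y) 0) x := by
    have : ContinuousAt (fun h => co h 0) (φ x) := by fun_prop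
    exact this.comp (φ.continuousAt hφ)
  rw [mem_compl_iff, mem_bdry_iff hφ] at hx
  filter_upwards [hc.eventually_ne hx, φ.open_source.mem_nhds hφ] with y hy hys
  rwa [mem_compl_iff, mem_bdry_iff hys]

/-- The embedding of the plane as the edge of the half-space. -/
def edgePt (y : E 2) : EuclideanHalfSpace 3 := hs ![0, y 0, y 1]

lemma co_edgePt (y : E 2) : co (edgePt y) = ![0, y 0, y 1] := co_hs_of_nonneg (by simp)

@[fun_prop]
lemma continuous_edgePt : Continuous edgePt := by
  unfold edgePt
  refine continuous_hs.comp (continuous_pi fun i => ?_)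
  fin_cases i <;> simp <;> fun_prop

lemma locEuc_bdry (hX : LocHalf X) : LocEuc 2 (bdry X) := by
  classical
  intro x
  obtain ⟨φ, hφ⟩ := hX x
  have hmem : ∀ y : E 2, edgePt y ∈ φ.target → φ.symm (edgePt y) ∈ bdry X := fun y hy => by
    rw [mem_bdry_iff (φ.map_target hy), φ.right_inv hy, co_edgePt]
    rfl
  let f : bdry X → E 2 := fun b => ![co (φ b) 1, co (φ b) 2]
  let g : E 2 → bdry X := fun y =>
    if h : edgePt y ∈ φ.target then ⟨φ.symm (edgePt y), hmem y h⟩ else x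
  have hg : ∀ y, edgePt y ∈ φ.target → (g y : X) = φ.symm (edgePt y) := fun y hy => by
    simp only [g, dif_pos hy]
  have hef : ∀ b : bdry X, (b : X) ∈ φ.source → edgePt (f b) = φ b := fun b hb => by
    apply co_injective
    rw [co_edgePt]
    have := (mem_bdry_iff hb).1 b.2
    ext i
    fin_cases i
    · simp [this]
    · simp [f]
    · simp [f]
  refine ⟨{ toFun := f, invFun := g, source := {b | (b : X) ∈ φ.source},
            target := {y | edgePt y ∈ φ.target}, map_source' := ?_, map_target' := ?_,
            left_inv' := ?_, right_inv' := ?_, open_source := ?_, open_target := ?_,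
            continuousOn_toFun := ?_, continuousOn_invFun := ?_ }, hφ⟩
  · intro b hb
    rw [mem_ofPred_eq, hef b hb]
    exact φ.map_source hb
  · intro y hy
    rw [mem_ofPred_eq, hg y hy]
    exact φ.map_target hy
  · intro b hb
    apply Subtype.ext
    rw [hg _ (by rw [hef b hb]; exact φ.map_source hb), hef b hb, φ.left_inv hb]
  · intro y hy
    simp only [f]
    rw [hg y hy, φ.right_inv hy, co_edgePt]
    ext i
    fin_cases i <;> simp
  rotate_left 2
  · exact φ.open_source.preimage continuous_subtype_val
  · exact φ.open_target.preimage continuous_edgePt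
  · have h1 : ContinuousOn (fun b : bdry X => co (φ b)) {b | (b : X) ∈ φ.source} :=
      continuous_co.comp_continuousOn
        (φ.continuousOn.comp continuous_subtype_val.continuousOn fun _ h => h)
    refine continuousOn_pi.2 fun i => ?_
    fin_cases i
    · exact (continuous_apply 1).comp_continuousOn h1
    · exact (continuous_apply 2).comp_continuousOn h1
  · rw [IsInducing.subtypeVal.continuousOn_iff]
    refine ContinuousOn.congr ?_ hg
    exact φ.continuousOn_symm.comp continuous_edgePt.continuousOn fun _ h => h

/-- The space with an external collar attached along the boundary. -/
abbrev Collar (X : Type) [TopologicalSpace X] : Type :=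
  {p : X × ℝ // 0 ≤ p.2 ∧ (p.2 = 0 ∨ p.1 ∈ bdry X)}

lemma locEuc_collar (hX : LocHalf X) : LocEuc 3 (Collar X) := by
  classical
  intro x
  obtain ⟨φ, hφ⟩ := hX x.1.1
  have hmem : ∀ y : E 3, hs y ∈ φ.target →
      0 ≤ max (-y 0) 0 ∧ (max (-y 0) 0 = 0 ∨ φ.symm (hs y) ∈ bdry X) := fun y hy => by
    refine ⟨le_max_right _ _, ?_⟩
    rcases le_total 0 (y 0) with h | h
    · exact Or.inl (max_eq_right (by linarith))
    · right
      rw [mem_bdry_iff (φ.map_target hy), φ.right_inv hy, co_hs]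
      simp [h]
  let f : Collar X → E 3 := fun p => Function.update (co (φ p.1.1)) 0 (co (φ p.1.1) 0 - p.1.2)
  let g : E 3 → Collar X := fun y =>
    if h : hs y ∈ φ.target then ⟨(φ.symm (hs y), max (-y 0) 0), hmem y h⟩ else x
  have hg : ∀ y, hs y ∈ φ.target → (g y : X × ℝ) = (φ.symm (hs y), max (-y 0) 0) :=
    fun y hy => by simp only [g, dif_pos hy]
  have hc : ∀ p : Collar X, p.1.1 ∈ φ.source →
      max (co (φ p.1.1) 0 - p.1.2) 0 = co (φ p.1.1) 0 ∧
      max (-(co (φ p.1.1) 0 - p.1.2)) 0 = p.1.2 := fun p hp => by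
    have h0 := co_nonneg (φ p.1.1)
    rcases p.2.2 with h | h
    · rw [h]
      simp [h0]
    · rw [(mem_bdry_iff hp).1 h]
      simp [p.2.1]
  have hef : ∀ p : Collar X, p.1.1 ∈ φ.source → hs (f p) = φ p.1.1 := fun p hp => by
    apply co_injective
    rw [co_hs]
    simp [f, hc p hp]
  refine ⟨{ toFun := f, invFun := g, source := {b | b.1.1 ∈ φ.source},
            target := {y | hs y ∈ φ.target}, map_source' := ?_, map_target' := ?_,
            left_inv' := ?_, right_inv' := ?_, open_source := ?_, open_target := ?_,
            continuousOn_toFun := ?_, continuousOn_invFun := ?_ }, hφ⟩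
  · intro b hb
    rw [mem_ofPred_eq, hef b hb]
    exact φ.map_source hb
  · intro y hy
    rw [mem_ofPred_eq, hg y hy]
    exact φ.map_target hy
  · intro b hb
    apply Subtype.ext
    rw [hg _ (by rw [hef b hb]; exact φ.map_source hb), hef b hb, φ.left_inv hb]
    refine Prod.ext rfl ?_
    simp only [f, Function.update_self]
    exact (hc b hb).2
  · intro y hy
    simp only [f]
    rw [hg y hy, φ.right_inv hy, co_hs]
    rcases le_total 0 (y 0) with h | h <;> simp [h]
  rotate_left 2
  · exact φ.open_source.preimage (continuous_fst.comp continuous_subtype_val)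
  · exact φ.open_target.preimage continuous_hs
  · have h1 : ContinuousOn (fun b : Collar X => co (φ b.1.1)) {b | b.1.1 ∈ φ.source} :=
      continuous_co.comp_continuousOn
        (φ.continuousOn.comp (by fun_prop) fun _ h => h)
    exact fun p hp => (h1 p hp).update 0
      (((continuous_apply 0).comp_continuousOn h1 p hp).sub (by fun_prop))
  · refine (IsInducing.subtypeVal (t := {p : X × ℝ | 0 ≤ p.2 ∧ (p.2 = 0 ∨ p.1 ∈ bdry X)})).continuousOn_iff.2 ?_
    refine ContinuousOn.congr ?_ hg
    exact (φ.continuousOn_symm.comp continuous_hs.continuousOn fun _ h => h).prodMk (by fun_prop)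

theorem van_one_bdry [SimplyConnectedSpace X] [LocallyPathConnectedSpace X] [CompactSpace X]
    (hX : LocHalf X) : Van 1 (∅ : Set (bdry X)) := by
  intro u hu
  let ι : C(bdry X, X) := ⟨Subtype.val, continuous_subtype_val⟩
  let j : C(X, Collar X) := ⟨fun x => ⟨(x, 0), le_rfl, Or.inl rfl⟩, by fun_prop⟩
  have hj : IsEmbedding j := by
    refine IsEmbedding.of_leftInverse (f := fun p : Collar X => p.1.1) (fun _ => rfl) ?_ j.continuous
    fun_prop
  let H : C(I × bdry X, Collar X) :=
    ⟨fun q => ⟨(q.2, q.1), q.1.2.1, Or.inr q.2.2⟩, by fun_prop⟩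
  let top : C(bdry X, Collar X) := ⟨fun b => ⟨(b, 1), zero_le_one, Or.inr b.2⟩, by fun_prop⟩
  have hnr : ∀ p : Collar X, p ∈ (range j)ᶜ → p.1.2 ≠ 0 := by
    rintro p hp h
    exact hp ⟨p.1.1, Subtype.ext (Prod.ext rfl h.symm)⟩
  have htop : ∀ b, top b ∈ (range j)ᶜ := by
    rintro b ⟨x, hx⟩
    have : (0 : ℝ) = 1 := congrArg (fun p : Collar X => p.1.2) hx
    norm_num at this
  obtain ⟨f₀, hf₀⟩ := van_one_of_simplyConnected (X := X) (map ι u) (hu.map ι (mapsTo_empty _ _))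
  have hH0 : slice H 0 = j.comp ι := by ext1 b; rfl
  have hH1 : slice H 1 = top := by ext1 b; rfl
  obtain ⟨f, hf⟩ : ∃ f : Chain 2 (Collar X), bd f + map top u ∈ A 1 (∅ : Set (Collar X)) := by
    refine ⟨map j f₀ + prism H u, ?_⟩
    have h1 := map_mem j (mapsTo_empty _ (∅ : Set (Collar X))) hf₀
    have h2 := prism_mem (V := (∅ : Set (Collar X))) H (fun _ _ h => h.elim) hu
    rw [map_add, bd_map, bd_prism, hH0, hH1, ← map_map]
    rw [map_add] at h1
    have h3 := Submodule.add_mem _ h1 h2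
    have h4 : ∀ a b c d : Chain 1 (Collar X), a + (b + d + c) + d = b + a + c := by
      intro a b c d
      grind [add_self d]
    rwa [h4]
  have hcyc : Cyc (range j)ᶜ f := by
    have h1 : map top u ∈ A 1 (range j)ᶜ :=
      map_mem (U := univ) top (fun b _ => htop b) (A_univ u)
    have h2 := Submodule.add_mem _ (A_mono (empty_subset _) hf) h1
    rwa [add_assoc, add_self, add_zero] at h2
  let t : C(bdry X, ((range j)ᶜ : Set (Collar X))) := ⟨fun b => ⟨top b, htop b⟩, by fun_prop⟩
  let π : C(((range j)ᶜ : Set (Collar X)), bdry X) :=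
    ⟨fun p => ⟨p.1.1.1, p.1.2.2.resolve_left (hnr _ p.2)⟩, by fun_prop⟩
  exact zero_of_project t π (fun _ => rfl) hf
    ((locEuc_collar hX).zero_of_simplyConnected hj hcyc)

end Boundary

end CubicalChain

namespace CubicalChain

open Set Topology unitInterval

lemma Van.of_retract {X Y : Type} [TopologicalSpace X] [TopologicalSpace Y] {k : ℕ}
    (hY : Van k (∅ : Set Y)) (i : C(X, Y)) (r : C(Y, X)) (h : ∀ x, r (i x) = x) :
    Van k (∅ : Set X) := by
  intro z hz
  have h1 := (hY _ (hz.map i (mapsTo_empty _ _))).map (V := ∅) r (mapsTo_empty _ _)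
  rwa [map_map, show r.comp i = ContinuousMap.id _ from ContinuousMap.ext h, map_id] at h1

section LocEuc

variable {n : ℕ} {M N : Type} [TopologicalSpace M] [TopologicalSpace N]

lemma LocEuc.of_isOpenEmbedding (hN : LocEuc n N) {f : M → N} (hf : IsOpenEmbedding f) :
    LocEuc n M := by
  intro x
  obtain ⟨φ, hφ⟩ := hN (f x)
  have : Nonempty M := ⟨x⟩
  exact ⟨(hf.toOpenPartialHomeomorph f).trans φ, by simpa using hφ⟩

/-- The charted space structure of a locally Euclidean space. -/
@[reducible] def LocEuc.chartedSpace (hM : LocEuc n M) : ChartedSpace (E n) M where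
  atlas := univ
  chartAt x := (hM x).choose
  mem_chart_source x := (hM x).choose_spec
  chart_mem_atlas _ := mem_univ _

lemma LocEuc.of_chartedSpace {H : Type} [TopologicalSpace H] [ChartedSpace H M] (e : H ≃ₜ E n) :
    LocEuc n M := fun x =>
  ⟨(chartAt H x).trans e.toOpenPartialHomeomorph, by simp⟩

lemma LocEuc.locPathConnectedSpace (hM : LocEuc n M) : LocallyPathConnectedSpace M :=
  let := hM.chartedSpace
  ChartedSpace.locallyPathConnectedSpace (E n) M

lemma LocEuc.metrizableSpace [T2Space M] [CompactSpace M] (hM : LocEuc n M) :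
    TopologicalSpace.MetrizableSpace M := by
  let := hM.chartedSpace
  have := ChartedSpace.secondCountable_of_sigmaCompact (E n) M
  infer_instance

end LocEuc

/-- The connected surfaces with trivial first homology. -/
class IsSph (S : Type) [TopologicalSpace S] : Prop
    extends T2Space S, CompactSpace S, ConnectedSpace S where
  loc : LocEuc 2 S
  van : Van 1 (∅ : Set S)

lemma isSph_connectedComponent {B : Type} [TopologicalSpace B] [T2Space B] [CompactSpace B]
    (hB : LocEuc 2 B) (hv : Van 1 (∅ : Set B)) (b : B) : IsSph (connectedComponent b) := by
  classical
  have := hB.locPathConnectedSpace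
  have hclopen : IsClopen (connectedComponent b) :=
    ⟨isClosed_connectedComponent, isOpen_connectedComponent⟩
  have := isCompact_iff_compactSpace.1 (isClosed_connectedComponent (x := b)).isCompact
  have := isConnected_iff_connectedSpace.1 (isConnected_connectedComponent (x := b))
  refine { loc := hB.of_isOpenEmbedding hclopen.isOpen.isOpenEmbedding_subtypeVal, van := ?_ }
  let b' : connectedComponent b := ⟨b, mem_connectedComponent⟩
  let r : B → connectedComponent b := fun x => if h : x ∈ connectedComponent b then ⟨x, h⟩ else b'
  have hr : Continuous r := by
    rw [IsInducing.subtypeVal.continuous_iff]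
    have : (Subtype.val ∘ r) = (connectedComponent b).piecewise id (fun _ => b) := by
      ext x
      by_cases h : x ∈ connectedComponent b <;> simp [r, h, b']
    rw [this]
    refine Continuous.piecewise (fun a ha => ?_) continuous_id continuous_const
    simp [hclopen.frontier_eq] at ha
  exact hv.of_retract ⟨Subtype.val, continuous_subtype_val⟩ ⟨r, hr⟩ fun x => by simp [r]

lemma isSph_component (X : Type) [TopologicalSpace X] [T2Space X] [CompactSpace X]
    [SimplyConnectedSpace X] [ChartedSpace (EuclideanHalfSpace 3) X] {x : X} (hx : x ∈ bdry X) :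
    ∃ (S : Type) (_ : TopologicalSpace S), IsSph S ∧
      Nonempty (connectedComponentIn (bdry X) x ≃ₜ S) := by
  have := ChartedSpace.locallyPathConnectedSpace (EuclideanHalfSpace 3) X
  have hX : LocHalf X := fun x => ⟨_, mem_chart_source (EuclideanHalfSpace 3) x⟩
  have : CompactSpace (bdry X) := isCompact_iff_compactSpace.1 (isClosed_bdry hX).isCompact
  refine ⟨connectedComponent (⟨x, hx⟩ : bdry X), inferInstance,
    isSph_connectedComponent (locEuc_bdry hX) (van_one_bdry hX) _, ?_⟩
  rw [connectedComponentIn_eq_image hx]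
  exact ⟨(IsEmbedding.subtypeVal.homeomorphImage _).symm⟩

lemma isSph_sphere : IsSph (Metric.sphere (0 : EuclideanSpace ℝ (Fin 3)) 1) := by
  have : Fact (Module.finrank ℝ (EuclideanSpace ℝ (Fin 3)) = 2 + 1) := ⟨by simp⟩
  have : ConnectedSpace (Metric.sphere (0 : EuclideanSpace ℝ (Fin 3)) 1) := by
    rw [← isConnected_iff_connectedSpace]
    refine isConnected_sphere ?_ _ zero_le_one
    rw [← Module.finrank_eq_rank]
    simp
  refine { loc := ?_, van := ?_ }
  · exact LocEuc.of_chartedSpace (EuclideanSpace.equiv (Fin 2) ℝ).toHomeomorph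
  · intro u hu
    let t : C(Metric.sphere (0 : EuclideanSpace ℝ (Fin 3)) 1, ({0}ᶜ : Set (E 3))) :=
      ⟨fun x => ⟨fun i => x.1 i, fun h => ne_zero_of_mem_unit_sphere x
        (PiLp.ext fun i => congrFun (mem_singleton_iff.1 h) i)⟩, by fun_prop⟩
    have hne : ∀ y : ({0}ᶜ : Set (E 3)), ‖WithLp.toLp 2 y.1‖ ≠ 0 := fun y h => y.2 (by
      simpa using h)
    let π : C(({0}ᶜ : Set (E 3)), Metric.sphere (0 : EuclideanSpace ℝ (Fin 3)) 1) :=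
      ⟨fun y => ⟨‖WithLp.toLp 2 y.1‖⁻¹ • WithLp.toLp 2 y.1, by
        rw [mem_sphere_zero_iff_norm, norm_smul, norm_inv, norm_norm, inv_mul_cancel₀ (hne y)]⟩, by
        have h1 : Continuous fun y : ({0}ᶜ : Set (E 3)) => WithLp.toLp 2 y.1 :=
          (PiLp.continuous_toLp 2 _).comp continuous_subtype_val
        exact Continuous.subtype_mk ((h1.norm.inv₀ hne).smul h1) _⟩
    let ι : C(({0}ᶜ : Set (E 3)), E 3) := ⟨Subtype.val, continuous_subtype_val⟩
    have hπ : ∀ x, π (t x) = x := fun x => by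
      apply Subtype.ext
      have h1 : WithLp.toLp 2 (t x).1 = x.1 := rfl
      change ‖WithLp.toLp 2 (t x).1‖⁻¹ • WithLp.toLp 2 (t x).1 = x.1
      rw [h1, norm_eq_of_mem_sphere, inv_one, one_smul]
    obtain ⟨f, hf⟩ := van_empty_of_contraction (lineTo (0 : E 3)) (by simp [lineTo]) 0
      (by simp [lineTo]) (map (ι.comp t) u) (hu.map _ (mapsTo_empty _ _))
    rw [add_comm (map _ u)] at hf
    refine zero_of_project t π hπ hf (van_origin (by norm_num) f ?_)
    have h1 : map (ι.comp t) u ∈ A 1 ({0}ᶜ : Set (E 3)) :=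
      map_mem (U := univ) _ (fun b _ => (t b).2) (A_univ u)
    have h2 := Submodule.add_mem _ (A_mono (empty_subset _) hf) h1
    rwa [add_assoc, add_self, add_zero] at h2

end CubicalChain

namespace CubicalChain

open Set Topology unitInterval

section JoinedSets

variable {X : Type} [TopologicalSpace X]

lemma joinedIn_inter_of_disjoint {W U V : Set X} (hU : IsOpen U) (hV : IsOpen V)
    (hW : W ⊆ U ∪ V) (hUV : Disjoint U V) {x y : X} (h : JoinedIn W x y) (hx : x ∈ U) :
    JoinedIn (W ∩ U) x y := by
  obtain ⟨γ, hγ⟩ := h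
  have h1 : range γ ⊆ U := by
    refine (isPreconnected_range γ.continuous).subset_left_of_subset_union hU hV hUV
      (fun z ⟨t, ht⟩ => hW (ht ▸ hγ t)) ⟨x, ⟨0, γ.source⟩, hx⟩
  exact ⟨γ, fun t => ⟨hγ t, h1 (mem_range_self t)⟩⟩

lemma isOpen_joinedIn [LocallyPathConnectedSpace X] {U : Set X} (hU : IsOpen U) (x : X) :
    IsOpen {y | JoinedIn U x y} :=
  hU.pathComponentIn x

lemma isOpen_joinedIn_not [LocallyPathConnectedSpace X] {U : Set X} (hU : IsOpen U) (x : X) :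
    IsOpen {y | y ∈ U ∧ ¬ JoinedIn U x y} := by
  rw [show {y | y ∈ U ∧ ¬ JoinedIn U x y} = ⋃ z ∈ {z | z ∈ U ∧ ¬ JoinedIn U x z},
    {y | JoinedIn U z y} from ?_]
  · exact isOpen_biUnion fun z _ => isOpen_joinedIn hU z
  · ext y
    simp only [Set.mem_ofPred_eq, mem_iUnion, exists_prop]
    constructor
    · exact fun h => ⟨y, h, .refl h.1⟩
    · rintro ⟨z, ⟨hz, hz'⟩, h⟩
      exact ⟨h.target_mem, fun h' => hz' (h'.trans h.symm)⟩

lemma exists_joinedIn_of_mem_closure [LocallyPathConnectedSpace X] {U W : Set X} (hU : IsOpen U)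
    {z : X} (hz : z ∈ closure W) (hzU : z ∈ U) : ∃ w ∈ W, JoinedIn U z w := by
  obtain ⟨w, hw, hw'⟩ := mem_closure_iff.1 hz _ (isOpen_joinedIn hU z) (.refl hzU)
  exact ⟨w, hw', hw⟩

end JoinedSets

variable {S : Type} [TopologicalSpace S] [IsSph S]

instance : LocallyPathConnectedSpace S := (IsSph.loc (S := S)).locPathConnectedSpace

instance : PathConnectedSpace S := pathConnectedSpace_iff_connectedSpace.2 inferInstance

/-- The complement of the set is path connected. -/
def NonSep (K : Set S) : Prop := ∀ ⦃x y⦄, x ∉ K → y ∉ K → JoinedIn Kᶜ x y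

lemma jan {K L : Set S} (hK : IsClosed K) (hL : IsClosed L) (hKL : IsPreconnected (K ∩ L))
    {x y : S} (hxK : JoinedIn Kᶜ x y) (hxL : JoinedIn Lᶜ x y) : JoinedIn (K ∪ L)ᶜ x y :=
  joinedIn_compl_union IsSph.loc IsSph.van hK hL hKL hxK hxL

lemma nonSep_of_van {K : Set S} (hv : Van 1 Kᶜ) : NonSep K := by
  intro x y hx hy
  obtain ⟨a, -, ha⟩ := exists_chain_of_joinedIn (joinedIn_univ.2 (PathConnectedSpace.joined x y))
  obtain ⟨e, he⟩ := hv a (by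
    show bd a ∈ _
    rw [ha]
    exact Submodule.add_mem _ (gen_mem (.inl (by rintro _ ⟨t, rfl⟩; exact hx)))
      (gen_mem (.inl (by rintro _ ⟨t, rfl⟩; exact hy))))
  exact joinedIn_of_chain hx he (by rw [map_add, bd_bd, add_zero, ha])

lemma nonSep_singleton (x : S) : NonSep {x} :=
  nonSep_of_van ((IsSph.loc (S := S)).van_point (by norm_num) x)

lemma isClosed_image_Icc {f : ℝ → S} {a b : ℝ} (hf : ContinuousOn f (Icc a b)) :
    IsClosed (f '' Icc a b) := (isCompact_Icc.image_of_continuousOn hf).isClosed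

/-- An arc does not separate. -/
lemma nonSep_arc {f : ℝ → S} {a b : ℝ} (hab : a ≤ b) (hf : ContinuousOn f (Icc a b))
    (hi : InjOn f (Icc a b)) : NonSep (f '' Icc a b) := by
  intro x y hx hy
  have h1 : ∀ u : Icc a b, JoinedIn {f u}ᶜ x y := fun u => nonSep_singleton _
    (fun h => hx ⟨u, u.2, h.symm⟩) (fun h => hy ⟨u, u.2, h.symm⟩)
  choose γ hγ using h1
  obtain ⟨t, h0, hm, ⟨m, hm'⟩, ht⟩ := exists_monotone_Icc_subset_open_cover_Icc hab
    (c := fun u => {t : Icc a b | f t ∉ range (γ u)})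
    (fun u => (isCompact_range (γ u).continuous).isClosed.isOpen_compl.preimage
      (continuousOn_iff_continuous_domRestrict.1 hf))
    (fun u _ => mem_iUnion.2 ⟨u, fun ⟨s, hs⟩ => hγ u s hs⟩)
  have h2 : ∀ n, JoinedIn (f '' Icc a (t n))ᶜ x y := by
    intro n
    induction n with
    | zero =>
      rw [h0, Icc_self, image_singleton]
      exact ⟨γ ⟨a, left_mem_Icc.2 hab⟩, hγ ⟨a, left_mem_Icc.2 hab⟩⟩
    | succ n ih =>
      have e1 : Icc a (t n : ℝ) ⊆ Icc a b := Icc_subset_Icc_right (t n).2.2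
      have e2 : Icc (t n : ℝ) (t (n + 1)) ⊆ Icc a b := Icc_subset_Icc (t n).2.1 (t (n + 1)).2.2
      have e3 : (t n : ℝ) ≤ t (n + 1) := hm n.le_succ
      rw [← Icc_union_Icc_eq_Icc (t n).2.1 e3, image_union]
      refine jan (isClosed_image_Icc (hf.mono e1)) (isClosed_image_Icc (hf.mono e2)) ?_ ih ?_
      · rw [← hi.image_inter e1 e2, Icc_inter_Icc_eq_singleton (t n).2.1 e3, image_singleton]
        exact isPreconnected_singleton
      · obtain ⟨u, hu⟩ := ht n
        refine ⟨γ u, ?_⟩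
        rintro s ⟨v, hv, hv'⟩
        exact hu (a := ⟨v, e2 hv⟩) hv ⟨s, hv'.symm⟩
  simpa [hm' m le_rfl] using h2 m

/-- The set `F` is one of the two faces of the separating closed set `C`. -/
structure IsFace (C F : Set S) : Prop where
  isClosed : IsClosed C
  isOpen : IsOpen F
  isOpen_compl : IsOpen (C ∪ F)ᶜ
  nonempty : F.Nonempty
  nonempty_compl : (C ∪ F)ᶜ.Nonempty
  disjoint : Disjoint C F
  joined : ∀ ⦃x y⦄, x ∈ F → y ∈ F → JoinedIn Cᶜ x y
  joined_compl : ∀ ⦃x y⦄, x ∈ (C ∪ F)ᶜ → y ∈ (C ∪ F)ᶜ → JoinedIn Cᶜ x y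

/-- Every point of the set has arbitrarily small neighbourhoods with nonseparating connected
complement in the set. -/
def Fine (C : Set S) : Prop := ∀ z ∈ C, ∀ N : Set S, IsOpen N → z ∈ N →
  ∃ A ⊆ C, IsClosed A ∧ IsPreconnected A ∧ NonSep A ∧ z ∉ A ∧ C \ A ⊆ N

namespace IsFace

variable {C F : Set S}

lemma compl (h : IsFace C F) : IsFace C (C ∪ F)ᶜ := by
  have e : (C ∪ (C ∪ F)ᶜ)ᶜ = F := by
    ext x
    have := h.disjoint.notMem_of_mem_left (a := x)
    simp only [mem_compl_iff, mem_union]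
    tauto
  exact ⟨h.isClosed, h.isOpen_compl, e.symm ▸ h.isOpen, h.nonempty_compl, e.symm ▸ h.nonempty,
    disjoint_left.2 fun x hx hx' => hx' (.inl hx), h.joined_compl, e.symm ▸ h.joined⟩

lemma subset_compl (h : IsFace C F) : F ⊆ Cᶜ := fun _ hx hx' => h.disjoint.notMem_of_mem_left hx' hx

lemma compl_subset (h : IsFace C F) : Cᶜ ⊆ F ∪ (C ∪ F)ᶜ := by
  intro x hx
  by_cases hxF : x ∈ F
  · exact .inl hxF
  · exact .inr (by rintro (h | h) <;> contradiction)

lemma disjoint_compl (h : IsFace C F) : Disjoint F (C ∪ F)ᶜ :=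
  disjoint_left.2 fun _ hx hx' => hx' (.inr hx)

lemma joinedIn (h : IsFace C F) {x y : S} (hx : x ∈ F) (hy : y ∈ F) : JoinedIn F x y :=
  (joinedIn_inter_of_disjoint h.isOpen h.isOpen_compl h.compl_subset h.disjoint_compl
    (h.joined hx hy) hx).mono inter_subset_right

lemma mem_of_joinedIn (h : IsFace C F) {x y : S} (hx : x ∈ F) (hxy : JoinedIn Cᶜ x y) : y ∈ F :=
  (joinedIn_inter_of_disjoint h.isOpen h.isOpen_compl h.compl_subset h.disjoint_compl
    hxy hx).target_mem.2

lemma subset_closure (h : IsFace C F) (hC : Fine C) : C ⊆ closure F := by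
  intro z hz
  by_contra hn
  obtain ⟨A, hAC, hA, -, hA', hzA, hN⟩ := hC z hz (closure F)ᶜ isClosed_closure.isOpen_compl hn
  obtain ⟨x, hx⟩ := h.nonempty
  obtain ⟨y, hy⟩ := h.nonempty_compl
  have h1 := hA' (fun h' => h.subset_compl hx (hAC h')) (fun h' => hy (.inl (hAC h')))
  have h2 := joinedIn_inter_of_disjoint h.isOpen (V := (closure F)ᶜ ∪ (C ∪ F)ᶜ)
    (isClosed_closure.isOpen_compl.union h.isOpen_compl) ?_ ?_ h1 hx
  · exact hy (.inr h2.target_mem.2)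
  · intro w hw
    by_cases hwC : w ∈ C
    · exact .inr (.inl (hN ⟨hwC, hw⟩))
    · exact (h.compl_subset hwC).imp id .inr
  · refine disjoint_left.2 fun w hw => ?_
    rintro (hw' | hw')
    · exact hw' (_root_.subset_closure hw)
    · exact hw' (.inr hw)

lemma closure_eq (h : IsFace C F) (hC : Fine C) : closure F = C ∪ F := by
  refine Subset.antisymm (closure_minimal subset_union_right ?_)
    (union_subset (h.subset_closure hC) _root_.subset_closure)
  exact isOpen_compl_iff.1 h.isOpen_compl

end IsFace

/-- A connected closed set `α` cuts the face `F` of `A₁ ∪ A₂` across. -/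
structure Theta (A₁ A₂ α F : Set S) : Prop where
  face : IsFace (A₁ ∪ A₂) F
  fine : Fine (A₁ ∪ A₂)
  closed₁ : IsClosed A₁
  closed₂ : IsClosed A₂
  closed : IsClosed α
  conn₁ : IsPreconnected A₁
  conn₂ : IsPreconnected A₂
  conn : IsPreconnected α
  inter : A₁ ∩ A₂ ⊆ α
  subset₁ : α ∩ A₁ ⊆ A₂
  subset₂ : α ∩ A₂ ⊆ A₁
  subset : α ⊆ A₁ ∪ A₂ ∪ F
  nonSep : NonSep α
  ne₁ : (A₁ \ A₂).Nonempty
  ne₂ : (A₂ \ A₁).Nonempty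

namespace Theta

variable {A₁ A₂ α F : Set S} {o x y z : S}

/-- The part of the face cut off by `A₁ ∪ α`. -/
def cut (A₁ α F : Set S) (o : S) : Set S := {x | x ∈ F \ α ∧ ¬ JoinedIn (A₁ ∪ α)ᶜ x o}

lemma symm (h : Theta A₁ A₂ α F) : Theta A₂ A₁ α F :=
  ⟨union_comm A₁ A₂ ▸ h.face, union_comm A₁ A₂ ▸ h.fine, h.closed₂, h.closed₁, h.closed, h.conn₂,
    h.conn₁, h.conn, inter_comm A₁ A₂ ▸ h.inter, h.subset₂, h.subset₁,
    union_comm A₁ A₂ ▸ h.subset, h.nonSep, h.ne₂, h.ne₁⟩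

lemma outer_subset (h : Theta A₁ A₂ α F) : (A₁ ∪ A₂ ∪ F)ᶜ ⊆ (A₁ ∪ A₂ ∪ α)ᶜ :=
  compl_subset_compl.2 (union_subset subset_union_left h.subset)

lemma joined_outer (h : Theta A₁ A₂ α F) (hx : x ∈ (A₁ ∪ A₂ ∪ F)ᶜ) (ho : o ∈ (A₁ ∪ A₂ ∪ F)ᶜ) :
    JoinedIn (A₁ ∪ α)ᶜ x o :=
  (h.face.compl.joinedIn hx ho).mono (h.outer_subset.trans
    (compl_subset_compl.2 (union_subset_union_left α subset_union_left)))

lemma joined_edge (h : Theta A₁ A₂ α F) (ho : o ∈ (A₁ ∪ A₂ ∪ F)ᶜ) (hz : z ∈ A₂ \ A₁) :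
    JoinedIn (A₁ ∪ α)ᶜ z o := by
  have hz' : z ∈ (A₁ ∪ α)ᶜ := by
    rintro (h' | h')
    · exact hz.2 h'
    · exact hz.2 (h.subset₂ ⟨h', hz.1⟩)
  obtain ⟨w, hw, hzw⟩ := exists_joinedIn_of_mem_closure (h.closed₁.union h.closed).isOpen_compl
    (h.face.compl.subset_closure h.fine (.inr hz.1)) hz'
  exact hzw.trans (h.joined_outer hw ho)

lemma not_joined (h : Theta A₁ A₂ α F) (ho : o ∈ (A₁ ∪ A₂ ∪ F)ᶜ) (hx : x ∈ F)
    (h1 : JoinedIn (A₁ ∪ α)ᶜ x o) (h2 : JoinedIn (A₂ ∪ α)ᶜ x o) : False := by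
  have h3 := jan (h.closed₁.union h.closed) (h.closed₂.union h.closed) (by
    rw [← inter_union_distrib_right, union_eq_self_of_subset_left h.inter]; exact h.conn) h1 h2
  exact ho (.inr (h.face.mem_of_joinedIn hx (h3.mono (compl_subset_compl.2
    (union_subset_union subset_union_left subset_union_left)))))

lemma joined_or (h : Theta A₁ A₂ α F) (ho : o ∈ (A₁ ∪ A₂ ∪ F)ᶜ) (hx : x ∈ F) (hxα : x ∉ α) :
    JoinedIn (A₁ ∪ α)ᶜ x o ∨ JoinedIn (A₂ ∪ α)ᶜ x o := by
  by_contra! hn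
  have hop : IsOpen (A₁ ∪ A₂ ∪ α)ᶜ := (h.face.isClosed.union h.closed).isOpen_compl
  have hxm : x ∈ (A₁ ∪ A₂ ∪ α)ᶜ := by
    rintro (h' | h')
    · exact h.face.subset_compl hx h'
    · exact hxα h'
  have key := joinedIn_inter_of_disjoint (isOpen_joinedIn hop x)
    (V := (closure {y | JoinedIn (A₁ ∪ A₂ ∪ α)ᶜ x y})ᶜ) isClosed_closure.isOpen_compl ?_
    (disjoint_left.2 fun w hw hw' => hw' (subset_closure hw))
    (h.nonSep hxα fun h' => h.outer_subset ho (.inr h')) (.refl hxm)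
  · exact hn.1 (JoinedIn.mono key.target_mem.2 (compl_subset_compl.2
      (union_subset_union_left α subset_union_left)))
  intro z hz
  by_cases hzW : z ∈ closure {y | JoinedIn (A₁ ∪ A₂ ∪ α)ᶜ x y}
  swap
  · exact .inr hzW
  left
  by_cases hzC : z ∈ A₁ ∪ A₂
  · exfalso
    have hz2 : z ∈ A₂ \ A₁ ∨ z ∈ A₁ \ A₂ := by
      have := fun h1 h2 => hz (h.inter ⟨h1, h2⟩)
      rcases hzC with h1 | h1
      · exact .inr ⟨h1, this h1⟩
      · exact .inl ⟨h1, fun h2 => this h2 h1⟩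
    rcases hz2 with hz2 | hz2
    · have e := h.joined_edge ho hz2
      obtain ⟨w, hw, hzw⟩ := exists_joinedIn_of_mem_closure
        (h.closed₁.union h.closed).isOpen_compl hzW e.source_mem
      exact hn.1 ((JoinedIn.mono hw (compl_subset_compl.2
        (union_subset_union_left α subset_union_left))).trans (hzw.symm.trans e))
    · have e := h.symm.joined_edge (union_comm A₁ A₂ ▸ ho) hz2
      obtain ⟨w, hw, hzw⟩ := exists_joinedIn_of_mem_closure
        (h.closed₂.union h.closed).isOpen_compl hzW e.source_mem
      exact hn.2 ((JoinedIn.mono hw (compl_subset_compl.2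
        (union_subset_union_left α subset_union_right))).trans (hzw.symm.trans e))
  · obtain ⟨w, hw, hzw⟩ := exists_joinedIn_of_mem_closure hop hzW (by
      rintro (h' | h') <;> contradiction)
    exact JoinedIn.trans hw hzw.symm

lemma isFace_cut (h : Theta A₁ A₂ α F) (ho : o ∈ (A₁ ∪ A₂ ∪ F)ᶜ) :
    IsFace (A₁ ∪ α) (cut A₁ α F o) := by
  have hcl := h.closed₁.union h.closed
  have hsub : F \ α ⊆ (A₁ ∪ α)ᶜ := by
    rintro x hx (h' | h')
    · exact h.face.subset_compl hx.1 (.inl h')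
    · exact hx.2 h'
  have hcompl : (A₁ ∪ α ∪ cut A₁ α F o)ᶜ = {x | JoinedIn (A₁ ∪ α)ᶜ o x} := by
    ext x
    constructor
    · intro hx
      by_cases hxF : x ∈ F
      · by_contra hn
        exact hx (.inr ⟨⟨hxF, fun h' => hx (.inl (.inr h'))⟩, fun h' => hn h'.symm⟩)
      by_cases hxC : x ∈ A₁ ∪ A₂
      · exact (h.joined_edge ho ⟨hxC.resolve_left fun h' => hx (.inl (.inl h')),
          fun h' => hx (.inl (.inl h'))⟩).symm
      · exact (h.joined_outer (by rintro (h' | h') <;> contradiction) ho).symm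
    · rintro hx (h' | h')
      · exact hx.target_mem h'
      · exact h'.2 (JoinedIn.symm hx)
  refine ⟨hcl, ?_, ?_, ?_, ⟨o, ?_⟩, ?_, ?_, ?_⟩
  · have e : cut A₁ α F o =
        F \ α ∩ {x | x ∈ (A₁ ∪ α)ᶜ ∧ ¬ JoinedIn (A₁ ∪ α)ᶜ o x} := by
      ext x
      constructor
      · exact fun hx => ⟨hx.1, hsub hx.1, fun h' => hx.2 h'.symm⟩
      · exact fun hx => ⟨hx.1, fun h' => hx.2.2 h'.symm⟩
    rw [e]
    exact (h.face.isOpen.sdiff h.closed).inter (isOpen_joinedIn_not hcl.isOpen_compl o)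
  · rw [hcompl]
    exact isOpen_joinedIn hcl.isOpen_compl o
  · obtain ⟨z, hz⟩ := h.ne₁
    have e := h.symm.joined_edge (union_comm A₁ A₂ ▸ ho) hz
    obtain ⟨w, hw, hzw⟩ := exists_joinedIn_of_mem_closure
      (h.closed₂.union h.closed).isOpen_compl (h.face.subset_closure h.fine (.inl hz.1))
      e.source_mem
    exact ⟨w, ⟨hw, fun h' => hzw.target_mem (.inr h')⟩, fun h' =>
      h.not_joined ho hw h' (hzw.symm.trans e)⟩
  · rw [hcompl]
    exact JoinedIn.refl (h.joined_outer ho ho).source_mem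
  · exact disjoint_left.2 fun x hx hx' => hsub hx'.1 hx
  · intro x y hx hy
    have e1 := (h.joined_or ho hx.1.1 hx.1.2).resolve_left hx.2
    have e2 := (h.joined_or ho hy.1.1 hy.1.2).resolve_left hy.2
    have e3 := jan h.face.isClosed (h.closed₂.union h.closed) (by
      rw [show (A₁ ∪ A₂) ∩ (A₂ ∪ α) = A₂ from ?_]
      · exact h.conn₂
      · ext x
        have := @h.inter x
        have := @h.subset₁ x
        simp only [mem_inter_iff, mem_union] at *
        tauto) (h.face.joined hx.1.1 hy.1.1) (e1.trans e2.symm)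
    exact e3.mono (compl_subset_compl.2 (union_subset_union subset_union_left subset_union_right))
  · intro x y hx hy
    rw [hcompl] at hx hy
    exact JoinedIn.trans (JoinedIn.symm hx) hy

/-- The theta curve theorem. -/
theorem exists_faces (h : Theta A₁ A₂ α F) : ∃ G₁ G₂ : Set S, IsFace (A₁ ∪ α) G₁ ∧
    IsFace (A₂ ∪ α) G₂ ∧ Disjoint G₁ G₂ ∧ G₁ ∪ G₂ = F \ α := by
  obtain ⟨o, ho⟩ := h.face.nonempty_compl
  refine ⟨_, _, h.isFace_cut ho, h.symm.isFace_cut (union_comm A₁ A₂ ▸ ho),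
    disjoint_left.2 fun x hx hx' => ?_, Subset.antisymm ?_ ?_⟩
  · exact (h.joined_or ho hx.1.1 hx.1.2).elim hx.2 hx'.2
  · rintro x (hx | hx) <;> exact hx.1
  · intro x hx
    by_contra hn
    simp only [mem_union, cut, Set.mem_ofPred_eq, not_or, not_and, not_not] at hn
    exact h.not_joined ho hx.1 (hn.1 hx) (hn.2 hx)

end Theta

end CubicalChain

namespace CubicalChain

open Set Topology unitInterval

variable {S : Type} [TopologicalSpace S] [IsSph S]

/-- A simple closed curve, parametrized with period one. -/
structure IsLoop (κ : ℝ → S) : Prop where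
  cont : Continuous κ
  eq_iff : ∀ s t, κ s = κ t ↔ ∃ n : ℤ, t = s + n

/-- A simple arc, parametrized by the unit interval. -/
structure IsArc (f : ℝ → S) : Prop where
  cont : ContinuousOn f (Icc 0 1)
  inj : InjOn f (Icc 0 1)

/-- Two arcs which share exactly their end points. -/
structure IsPair (f g : ℝ → S) : Prop where
  left : IsArc f
  right : IsArc g
  eq_iff : ∀ s ∈ Icc (0 : ℝ) 1, ∀ t ∈ Icc (0 : ℝ) 1, f s = g t ↔ s = t ∧ (s = 0 ∨ s = 1)

namespace IsArc

variable {f : ℝ → S}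

lemma isClosed (h : IsArc f) : IsClosed (f '' Icc 0 1) := isClosed_image_Icc h.cont

lemma nonSep (h : IsArc f) : NonSep (f '' Icc 0 1) := nonSep_arc zero_le_one h.cont h.inj

lemma conn (h : IsArc f) : IsPreconnected (f '' Icc 0 1) := isPreconnected_Icc.image f h.cont

lemma comp_affine {κ : ℝ → S} {a b c d : ℝ} (hκ : ContinuousOn κ (Icc a b))
    (hi : InjOn κ (Icc a b)) (hcd : c ≠ d) (hc : c ∈ Icc a b) (hd : d ∈ Icc a b) :
    IsArc fun t => κ (c + (d - c) * t) := by
  have hm : MapsTo (fun t : ℝ => c + (d - c) * t) (Icc 0 1) (Icc a b) := by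
    intro t ht
    have := (convex_Icc a b).add_smul_sub_mem hc hd ht
    simpa [mul_comm] using this
  refine ⟨hκ.comp (by fun_prop) hm, fun s hs t ht h => ?_⟩
  have := hi (hm hs) (hm ht) h
  have e : d - c ≠ 0 := sub_ne_zero.2 hcd.symm
  simpa [e] using this

end IsArc

namespace IsLoop

variable {κ : ℝ → S}

lemma shift (h : IsLoop κ) (a : ℝ) : IsLoop fun t => κ (a + t) := by
  refine ⟨h.cont.comp (by fun_prop), fun s t => ?_⟩
  rw [h.eq_iff]
  simp only [add_assoc, add_right_inj]

lemma add_int (h : IsLoop κ) (t : ℝ) (n : ℤ) : κ (t + n) = κ t := ((h.eq_iff _ _).2 ⟨n, rfl⟩).symm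

lemma add_one (h : IsLoop κ) (t : ℝ) : κ (t + 1) = κ t := by simpa using h.add_int t 1

lemma range_eq (h : IsLoop κ) (a : ℝ) : range κ = κ '' Icc a (a + 1) := by
  refine Subset.antisymm ?_ (image_subset_range _ _)
  rintro _ ⟨t, rfl⟩
  refine ⟨a + Int.fract (t - a), ⟨by linarith [Int.fract_nonneg (t - a)],
    by linarith [Int.fract_lt_one (t - a)]⟩, ?_⟩
  rw [← h.add_int _ ⌊t - a⌋, add_assoc, Int.fract_add_floor]
  congr 1; ring

lemma injOn (h : IsLoop κ) {a b : ℝ} (hb : b < a + 1) : InjOn κ (Icc a b) := by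
  intro s hs t ht hst
  obtain ⟨n, hn⟩ := (h.eq_iff s t).1 hst
  have h1 : (n : ℝ) < 1 := by linarith [hs.1, ht.2]
  have h2 : (-1 : ℝ) < n := by linarith [hs.2, ht.1]
  have h3 : n = 0 := by
    have h1' : n < 1 := by exact_mod_cast h1
    have h2' : -1 < n := by exact_mod_cast h2
    omega
  simp [hn, h3]

lemma exists_small (h : IsLoop κ) (a : ℝ) {N : Set S} (hN : IsOpen N) (ha : κ a ∈ N) :
    ∃ ε ∈ Ioo (0 : ℝ) (1 / 2), κ '' Icc (a - ε) (a + ε) ⊆ N ∧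
      κ a ∉ κ '' Icc (a + ε) (a + 1 - ε) ∧
      range κ = κ '' Icc (a - ε) (a + ε) ∪ κ '' Icc (a + ε) (a + 1 - ε) := by
  obtain ⟨δ, hδ, hδ'⟩ := Metric.isOpen_iff.1 (hN.preimage h.cont) a ha
  have h1 : min (δ / 2) (1 / 4) ≤ 1 / 4 := min_le_right _ _
  have h2 : min (δ / 2) (1 / 4) ≤ δ / 2 := min_le_left _ _
  have h3 : 0 < min (δ / 2) (1 / 4) := by positivity
  generalize min (δ / 2) (1 / 4) = ε at *
  refine ⟨ε, ⟨h3, by linarith⟩, ?_, ?_, ?_⟩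
  · rintro _ ⟨t, ht, rfl⟩
    refine hδ' ?_
    rw [Metric.mem_ball, Real.dist_eq, abs_lt]
    constructor <;> linarith [ht.1, ht.2]
  · rintro ⟨t, ht, hta⟩
    have := h.injOn (a := a) (b := a + 1 - ε) (by linarith) ⟨by linarith [ht.1], ht.2⟩
      ⟨le_rfl, by linarith⟩ hta
    linarith [ht.1]
  · rw [← image_union, Icc_union_Icc_eq_Icc (by linarith) (by linarith), h.range_eq (a - ε)]
    congr 2; ring

lemma fine (h : IsLoop κ) : Fine (range κ) := by
  rintro _ ⟨a, rfl⟩ N hN ha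
  obtain ⟨ε, hε, h1, h2, h3⟩ := h.exists_small a hN ha
  refine ⟨_, image_subset_range _ _, isClosed_image_Icc h.cont.continuousOn,
    isPreconnected_Icc.image κ h.cont.continuousOn,
    nonSep_arc (by linarith [hε.2]) h.cont.continuousOn (h.injOn (by linarith [hε.1])), h2, ?_⟩
  rw [h3]
  rintro z ⟨hz | hz, hz'⟩
  · exact h1 hz
  · exact (hz' hz).elim

/-- Two points of a loop split it into two arcs. -/
lemma split (h : IsLoop κ) {s : ℝ} (hs : s ∈ Ioo (0 : ℝ) 1) :
    IsPair (fun t => κ (s * t)) (fun t => κ (1 - (1 - s) * t)) ∧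
    range κ = (fun t => κ (s * t)) '' Icc 0 1 ∪ (fun t => κ (1 - (1 - s) * t)) '' Icc 0 1 := by
  have e1 := IsArc.comp_affine (κ := κ) (a := 0) (b := s) (c := 0) (d := s) h.cont.continuousOn
    (h.injOn (by linarith [hs.2])) hs.1.ne ⟨le_rfl, hs.1.le⟩ ⟨hs.1.le, le_rfl⟩
  have e2 := IsArc.comp_affine (κ := κ) (a := s) (b := 1) (c := 1) (d := s) h.cont.continuousOn
    (h.injOn (by linarith [hs.1])) hs.2.ne' ⟨hs.2.le, le_rfl⟩ ⟨le_rfl, hs.2.le⟩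
  have e3 : (fun t => κ (1 + (s - 1) * t)) = fun t => κ (1 - (1 - s) * t) := by
    ext t; congr 1; ring
  have e4 : (fun t => κ (0 + (s - 0) * t)) = fun t => κ (s * t) := by
    ext t; congr 1; ring
  rw [e3] at e2
  rw [e4] at e1
  have hs1 : 0 < 1 - s := by linarith [hs.2]
  refine ⟨⟨e1, e2, fun u hu v hv => ?_⟩, ?_⟩
  · rw [h.eq_iff]
    constructor
    · rintro ⟨n, hn⟩
      have b1 : 0 ≤ s * u := mul_nonneg hs.1.le hu.1
      have b2 : s * u ≤ s := by nlinarith [hu.2, hs.1]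
      have b3 : 0 ≤ (1 - s) * v := mul_nonneg hs1.le hv.1
      have b4 : (1 - s) * v ≤ 1 - s := by nlinarith [hv.2]
      have h1 : (n : ℝ) ≤ 1 := by linarith
      have h2 : (0 : ℝ) ≤ n := by linarith
      have h1' : n ≤ 1 := by exact_mod_cast h1
      have h2' : 0 ≤ n := by exact_mod_cast h2
      obtain rfl | rfl : n = 0 ∨ n = 1 := by omega
      · have c1 : s * u = s := by push_cast at hn; linarith
        have c2 : (1 - s) * v = 1 - s := by push_cast at hn; linarith
        have d1 : u = 1 := by simpa [hs.1.ne'] using c1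
        have d2 : v = 1 := by simpa [hs1.ne'] using c2
        simp [d1, d2]
      · have c1 : s * u = 0 := by push_cast at hn; linarith
        have c2 : (1 - s) * v = 0 := by push_cast at hn; linarith
        have d1 : u = 0 := by simpa [hs.1.ne'] using c1
        have d2 : v = 0 := by simpa [hs1.ne'] using c2
        simp [d1, d2]
    · rintro ⟨rfl, rfl | rfl⟩
      · exact ⟨1, by simp⟩
      · exact ⟨0, by simp⟩
  · refine Subset.antisymm ?_ ?_
    · rw [h.range_eq 0]
      rintro _ ⟨t, ht, rfl⟩
      rcases le_total t s with hts | hts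
      · refine .inl ⟨t / s, ⟨div_nonneg ht.1 hs.1.le, (div_le_one hs.1).2 hts⟩, ?_⟩
        simp only; congr 1; field_simp [hs.1.ne']
      · refine .inr ⟨(1 - t) / (1 - s), ⟨div_nonneg (by linarith [ht.2]) hs1.le,
          (div_le_one hs1).2 (by linarith)⟩, ?_⟩
        simp only; congr 1; field_simp [hs1.ne']; ring
    · rintro _ (⟨t, -, rfl⟩ | ⟨t, -, rfl⟩) <;> exact mem_range_self _

end IsLoop

/-- The closed curve which runs along the first arc and back along the second. -/
def arcLoop (f g : ℝ → S) (t : ℝ) : S :=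
  if Int.fract t ≤ 1 / 2 then f (2 * Int.fract t) else g (2 - 2 * Int.fract t)

namespace IsPair

variable {f g : ℝ → S}

lemma eq_zero (h : IsPair f g) : f 0 = g 0 := (h.eq_iff 0 (by simp) 0 (by simp)).2 (by simp)

lemma eq_one (h : IsPair f g) : f 1 = g 1 := (h.eq_iff 1 (by simp) 1 (by simp)).2 (by simp)

lemma symm (h : IsPair f g) : IsPair g f := by
  refine ⟨h.right, h.left, fun s hs t ht => ?_⟩
  rw [eq_comm, h.eq_iff t ht s hs]
  constructor <;> rintro ⟨rfl, h⟩ <;> exact ⟨rfl, h⟩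

lemma isLoop (h : IsPair f g) : IsLoop (arcLoop f g) := by
  constructor
  · have h1 : ContinuousOn (fun u : ℝ => if u ≤ 1 / 2 then f (2 * u) else g (2 - 2 * u))
        (Icc 0 1) := by
      have e : Icc (0 : ℝ) 1 = Icc 0 (1 / 2) ∪ Icc (1 / 2) 1 :=
        (Icc_union_Icc_eq_Icc (by norm_num) (by norm_num)).symm
      rw [e]
      refine ContinuousOn.union_of_isClosed ?_ ?_ isClosed_Icc isClosed_Icc
      · refine (h.left.cont.comp (f := fun u : ℝ => 2 * u) (by fun_prop) ?_).congr ?_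
        · intro u hu; constructor <;> linarith [hu.1, hu.2]
        · intro u hu; simp [show u ≤ 1 / 2 from hu.2, -one_div]
      · refine (h.right.cont.comp (f := fun u : ℝ => 2 - 2 * u) (by fun_prop) ?_).congr ?_
        · intro u hu; constructor <;> linarith [hu.1, hu.2]
        · intro u hu
          rcases hu.1.eq_or_lt with rfl | hlt
          · norm_num [h.eq_one]
          · simp [not_le.2 hlt, -one_div]
    exact h1.comp_fract'' (by norm_num [h.eq_zero])
  · intro s t
    have hfr : Int.fract s = Int.fract t ↔ ∃ n : ℤ, t = s + n := by
      rw [eq_comm, Int.fract_eq_fract]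
      exact exists_congr fun n => by constructor <;> intro h <;> linarith
    rw [← hfr]
    have s0 := Int.fract_nonneg s
    have s1 := Int.fract_lt_one s
    have t0 := Int.fract_nonneg t
    have t1 := Int.fract_lt_one t
    simp only [arcLoop]
    generalize Int.fract s = u at *
    generalize Int.fract t = v at *
    refine ⟨fun H => ?_, fun H => by rw [H]⟩
    split_ifs at H with hu hv hv
    · linarith [h.left.inj ⟨by linarith, by linarith⟩ ⟨by linarith, by linarith⟩ H]
    · obtain ⟨h1, h2 | h2⟩ := (h.eq_iff _ ⟨by linarith, by linarith⟩ _
        ⟨by linarith, by linarith⟩).1 H <;> linarith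
    · obtain ⟨h1, h2 | h2⟩ := (h.eq_iff _ ⟨by linarith, by linarith⟩ _
        ⟨by linarith, by linarith⟩).1 H.symm <;> linarith
    · linarith [h.right.inj ⟨by linarith, by linarith⟩ ⟨by linarith, by linarith⟩ H]

lemma range_arcLoop (h : IsPair f g) : range (arcLoop f g) = f '' Icc 0 1 ∪ g '' Icc 0 1 := by
  refine Subset.antisymm ?_ ?_
  · rintro _ ⟨t, rfl⟩
    have t0 := Int.fract_nonneg t
    have t1 := Int.fract_lt_one t
    simp only [arcLoop]
    split_ifs with hu
    · exact .inl ⟨_, ⟨by linarith, by linarith⟩, rfl⟩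
    · exact .inr ⟨_, ⟨by linarith, by linarith⟩, rfl⟩
  · rintro _ (⟨t, ht, rfl⟩ | ⟨t, ht, rfl⟩)
    · refine ⟨t / 2, ?_⟩
      have : Int.fract (t / 2) = t / 2 :=
        Int.fract_eq_self.2 ⟨by linarith [ht.1], by linarith [ht.2]⟩
      rw [arcLoop, this, if_pos (by linarith [ht.2])]
      congr 1; ring
    · rcases ht.1.eq_or_lt with rfl | h0
      · exact ⟨0, by simp [arcLoop, h.eq_zero]⟩
      rcases ht.2.eq_or_lt with rfl | h1
      · refine ⟨1 / 2, ?_⟩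
        have : Int.fract (1 / 2 : ℝ) = 1 / 2 := Int.fract_eq_self.2 ⟨by norm_num, by norm_num⟩
        rw [arcLoop, this, if_pos le_rfl]; norm_num [h.eq_one]
      refine ⟨1 - t / 2, ?_⟩
      have : Int.fract (1 - t / 2) = 1 - t / 2 :=
        Int.fract_eq_self.2 ⟨by linarith, by linarith⟩
      rw [arcLoop, this, if_neg (by linarith)]
      congr 1; ring

end IsPair

/-- Three arcs with common end points, the last one across a face of the loop formed by the others. -/
lemma IsPair.theta {f g α : ℝ → S} (h : IsPair f g) (hf : IsPair f α) (hg : IsPair g α) {F : Set S}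
    (hF : IsFace (f '' Icc 0 1 ∪ g '' Icc 0 1) F) (hα : ∀ t ∈ Ioo (0 : ℝ) 1, α t ∈ F) :
    Theta (f '' Icc 0 1) (g '' Icc 0 1) (α '' Icc 0 1) F := by
  have hh : (1 / 2 : ℝ) ∈ Icc (0 : ℝ) 1 := by norm_num
  refine ⟨hF, h.range_arcLoop ▸ h.isLoop.fine, h.left.isClosed, h.right.isClosed,
    hf.right.isClosed, h.left.conn, h.right.conn, hf.right.conn, ?_, ?_, ?_, ?_,
    hf.right.nonSep, ?_, ?_⟩
  · rintro _ ⟨⟨s, hs, rfl⟩, ⟨t, ht, hst⟩⟩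
    obtain ⟨rfl, ht'⟩ := (h.eq_iff s hs t ht).1 hst.symm
    exact ⟨s, hs, ((hf.eq_iff s hs s hs).2 ⟨rfl, ht'⟩).symm⟩
  · rintro _ ⟨⟨t, ht, rfl⟩, ⟨s, hs, hst⟩⟩
    obtain ⟨rfl, ht'⟩ := (hf.eq_iff s hs t ht).1 hst
    exact ⟨s, hs, (hg.eq_iff s hs s hs).2 ⟨rfl, ht'⟩⟩
  · rintro _ ⟨⟨t, ht, rfl⟩, ⟨s, hs, hst⟩⟩
    obtain ⟨rfl, ht'⟩ := (hg.eq_iff s hs t ht).1 hst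
    exact ⟨s, hs, (hf.eq_iff s hs s hs).2 ⟨rfl, ht'⟩⟩
  · rintro _ ⟨t, ht, rfl⟩
    rcases ht.1.eq_or_lt with rfl | h0
    · exact .inl (.inl ⟨0, ht, hf.eq_zero⟩)
    rcases ht.2.eq_or_lt with rfl | h1
    · exact .inl (.inl ⟨1, ht, hf.eq_one⟩)
    exact .inr (hα t ⟨h0, h1⟩)
  · refine ⟨f (1 / 2), ⟨_, hh, rfl⟩, ?_⟩
    rintro ⟨t, ht, hst⟩
    obtain ⟨rfl, h1 | h1⟩ := (h.eq_iff _ hh t ht).1 hst.symm <;> norm_num at h1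
  · refine ⟨g (1 / 2), ⟨_, hh, rfl⟩, ?_⟩
    rintro ⟨t, ht, hst⟩
    obtain ⟨rfl, h1 | h1⟩ := (h.symm.eq_iff _ hh t ht).1 hst.symm <;> norm_num at h1

/-- An arc whose interior lies in a face of a loop and whose end points are the ends of an arc of the
loop. -/
lemma IsPair.of_face {f α : ℝ → S} {C F : Set S} (hf : IsArc f) (hα : IsArc α) (hF : IsFace C F)
    (hfC : f '' Icc 0 1 ⊆ C) (hαF : ∀ t ∈ Ioo (0 : ℝ) 1, α t ∈ F) (h0 : α 0 = f 0)
    (h1 : α 1 = f 1) : IsPair f α := by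
  refine ⟨hf, hα, fun s hs t ht => ?_⟩
  constructor
  · intro hst
    rcases ht.1.eq_or_lt with rfl | ht0
    · have := hf.inj hs ⟨le_rfl, zero_le_one⟩ (hst.trans h0)
      exact ⟨this, .inl this⟩
    rcases ht.2.eq_or_lt with rfl | ht1
    · have := hf.inj hs ⟨zero_le_one, le_rfl⟩ (hst.trans h1)
      exact ⟨this, .inr this⟩
    · exact absurd (hfC ⟨s, hs, hst⟩) (hF.subset_compl (hαF t ⟨ht0, ht1⟩))
  · rintro ⟨rfl, rfl | rfl⟩
    · exact h0.symm
    · exact h1.symm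

end CubicalChain

namespace CubicalChain

open Set Topology unitInterval

section PathArc

variable {X : Type} [MetricSpace X] {γ : ℝ → X} {K : Set ℝ}

/-- Closed sets of times such that the path agrees at the ends of every gap. -/
structure Skips (γ : ℝ → X) (K : Set ℝ) : Prop where
  closed : IsClosed K
  sub : K ⊆ Icc 0 1
  zero : (0 : ℝ) ∈ K
  one : (1 : ℝ) ∈ K
  gap : ∀ a ∈ K, ∀ b ∈ K, a < b → Disjoint (Ioo a b) K → γ a = γ b

lemma Skips.isCompact (h : Skips γ K) : IsCompact K := isCompact_Icc.of_isClosed_subset h.closed h.sub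

lemma skips_sInter (hγ : Continuous γ) {c : Set (Set ℝ)} (hc : ∀ K ∈ c, Skips γ K)
    (hch : IsChain (· ⊆ ·) c) (hne : c.Nonempty) : Skips γ (⋂₀ c) := by
  obtain ⟨K₀, hK₀⟩ := hne
  refine ⟨isClosed_sInter fun K hK => (hc K hK).closed, (sInter_subset_of_mem hK₀).trans
    (hc K₀ hK₀).sub, fun K hK => (hc K hK).zero, fun K hK => (hc K hK).one, ?_⟩
  intro a ha b hb hab hd
  refine eq_of_forall_dist_le fun ε hε => ?_
  obtain ⟨δ₁, h1, h1'⟩ := Metric.continuous_iff.1 hγ a (ε / 2) (half_pos hε)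
  obtain ⟨δ₂, h2, h2'⟩ := Metric.continuous_iff.1 hγ b (ε / 2) (half_pos hε)
  have hδ : ∃ δ, 0 < δ ∧ δ ≤ δ₁ ∧ δ ≤ δ₂ ∧ δ ≤ (b - a) / 2 :=
    ⟨min (min δ₁ δ₂) ((b - a) / 2), by have : 0 < b - a := by linarith
                                       positivity,
      (min_le_left _ _).trans (min_le_left _ _), (min_le_left _ _).trans (min_le_right _ _),
      min_le_right _ _⟩
  obtain ⟨δ, hδ0, hδ1, hδ2, hδ3⟩ := hδ
  obtain ⟨K, hK, hKd⟩ : ∃ K ∈ c, Icc (a + δ) (b - δ) ∩ K = ∅ := by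
    by_contra! hn
    have := IsCompact.nonempty_sInter_of_directed_nonempty_isCompact_isClosed
      (S := (fun K => Icc (a + δ) (b - δ) ∩ K) '' c) (hS := ⟨_, mem_image_of_mem _ hK₀⟩)
      ?_ ?_ ?_ ?_
    · obtain ⟨t, ht⟩ := this
      simp only [mem_sInter, mem_image, forall_exists_index, and_imp,
        forall_apply_eq_imp_iff₂] at ht
      refine hd.notMem_of_mem_left (a := t) ?_ fun K hK => (ht K hK).2
      have := (ht K₀ hK₀).1
      exact ⟨by linarith [this.1], by linarith [this.2]⟩
    · rintro _ ⟨K, hK, rfl⟩ _ ⟨L, hL, rfl⟩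
      rcases hch.total hK hL with h | h
      · exact ⟨_, ⟨K, hK, rfl⟩, subset_rfl, inter_subset_inter_right _ h⟩
      · exact ⟨_, ⟨L, hL, rfl⟩, inter_subset_inter_right _ h, subset_rfl⟩
    · rintro _ ⟨K, hK, rfl⟩; exact hn K hK
    · rintro _ ⟨K, hK, rfl⟩; exact isCompact_Icc.inter_right (hc K hK).closed
    · rintro _ ⟨K, hK, rfl⟩; exact isClosed_Icc.inter (hc K hK).closed
  have hout : ∀ k ∈ K, k < a + δ ∨ b - δ < k := fun k hk => by
    by_contra! hn
    exact notMem_empty k (hKd ▸ ⟨⟨hn.1, hn.2⟩, hk⟩)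
  obtain ⟨a', ⟨ha', ha1⟩, ha2⟩ := (((hc K hK).isCompact.inter_right
    (isClosed_Icc (a := a) (b := (a + b) / 2)))).exists_isGreatest
    ⟨a, ha K hK, le_rfl, by linarith⟩
  obtain ⟨b', ⟨hb', hb1⟩, hb2⟩ := (((hc K hK).isCompact.inter_right
    (isClosed_Icc (a := (a + b) / 2) (b := b)))).exists_isLeast
    ⟨b, hb K hK, by linarith, le_rfl⟩
  have e : γ a' = γ b' := by
    rcases (ha1.2.trans hb1.1).eq_or_lt with h | h
    · rw [h]
    refine (hc K hK).gap a' ha' b' hb' h (disjoint_left.2 fun k hk hkK => ?_)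
    rcases le_total k ((a + b) / 2) with h' | h'
    · exact absurd (ha2 ⟨hkK, by linarith [hk.1, ha1.1], h'⟩) (not_le.2 hk.1)
    · exact absurd (hb2 ⟨hkK, h', by linarith [hk.2, hb1.2]⟩) (not_le.2 hk.2)
  have e1 := h1' a' (by
    rw [Real.dist_eq, abs_of_nonneg (by linarith [ha1.1])]
    rcases hout a' ha' with h | h
    · linarith
    · linarith [ha1.2])
  have e2 := h2' b' (by
    rw [Real.dist_eq, abs_of_nonpos (by linarith [hb1.2])]
    rcases hout b' hb' with h | h
    · linarith [hb1.1]
    · linarith)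
  rw [← e] at e2
  linarith [dist_triangle_left (γ a) (γ b) (γ a')]

lemma exists_minimal_skips (hγ : Continuous γ) : ∃ K, Skips γ K ∧
    ∀ s ∈ K, ∀ t ∈ K, s < t → γ s = γ t → Disjoint (Ioo s t) K := by
  obtain ⟨K, hK⟩ := zorn_superset {K | Skips γ K} (by
    intro c hc hch
    rcases c.eq_empty_or_nonempty with rfl | hne
    · refine ⟨Icc 0 1, ⟨isClosed_Icc, subset_rfl, by simp, by simp, ?_⟩, by simp⟩
      intro a ha b hb hab hd
      exact absurd ⟨by linarith [ha.1], by linarith [hb.2]⟩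
        (hd.notMem_of_mem_left (a := (a + b) / 2) ⟨by linarith, by linarith⟩)
    · exact ⟨_, skips_sInter hγ hc hch hne, fun s hs => sInter_subset_of_mem hs⟩)
  have hK1 : Skips γ K := hK.prop
  refine ⟨K, hK1, fun s hs t ht hst h => ?_⟩
  have h1 : Skips γ (K \ Ioo s t) := by
    refine ⟨hK1.closed.sdiff isOpen_Ioo, sdiff_subset.trans hK1.sub, ⟨hK1.zero, fun h' => ?_⟩,
      ⟨hK1.one, fun h' => ?_⟩, fun a ha b hb hab hd => ?_⟩
    · linarith [h'.1, (hK1.sub hs).1]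
    · linarith [h'.2, (hK1.sub ht).2]
    · by_cases hd' : Disjoint (Ioo a b) K
      · exact hK1.gap a ha.1 b hb.1 hab hd'
      obtain ⟨c, hc, hcK⟩ := not_disjoint_iff.1 hd'
      have hc' : c ∈ Ioo s t := by
        by_contra hn
        exact disjoint_left.1 hd hc ⟨hcK, hn⟩
      have hs' : s ∉ Ioo a b := fun h' => disjoint_left.1 hd h' ⟨hs, by simp⟩
      have ht' : t ∉ Ioo a b := fun h' => disjoint_left.1 hd h' ⟨ht, by simp⟩
      have ha' := ha.2
      have hb' := hb.2
      simp only [mem_Ioo, not_and, not_lt] at hs' ht' ha' hb' hc hc'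
      have e1 : a = s := by
        refine le_antisymm ?_ ?_
        · by_contra! hn
          linarith [ha' hn]
        · by_contra! hn
          linarith [hs' hn]
      have e2 : b = t := by
        refine le_antisymm ?_ ?_
        · by_contra! hn
          linarith [ht' (by linarith)]
        · by_contra! hn
          linarith [hb' (by linarith)]
      rw [e1, e2, h]
  exact disjoint_left.2 fun u hu huK => (hK.le_of_le h1 sdiff_subset huK).2 hu

variable [CompactSpace X]

/-- A strictly monotone measure of progress along the path. -/
lemma exists_progress (hγ : Continuous γ) (hK : Skips γ K)
    (hm : ∀ s ∈ K, ∀ t ∈ K, s < t → γ s = γ t → Disjoint (Ioo s t) K) :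
    ∃ m : K → ℝ, Continuous m ∧ ∀ s t : K, s ≤ t → m t ≤ m s ∧ (m s = m t ↔ γ s = γ t) := by
  have : Nonempty X := ⟨γ 0⟩
  let x := TopologicalSpace.denseSeq X
  let Q : K → Set X := fun t => γ '' (K ∩ Icc 0 t)
  have hQne : ∀ t, (Q t).Nonempty := fun t => ⟨_, 0, ⟨hK.zero, le_rfl, (hK.sub t.2).1⟩, rfl⟩
  have hQc : ∀ t, IsClosed (Q t) := fun t =>
    ((hK.isCompact.inter_right isClosed_Icc).image hγ).isClosed
  have hQm : ∀ s t, s ≤ t → Q s ⊆ Q t := fun s t hst =>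
    image_mono (inter_subset_inter_right _ (Icc_subset_Icc_right hst))
  have hQs : ∀ s : K, γ s ∈ Q s := fun s => ⟨s, ⟨s.2, (hK.sub s.2).1, le_rfl⟩, rfl⟩
  obtain ⟨D, hD⟩ := Metric.isBounded_iff.1 (isCompact_univ (X := X)).isBounded
  have hbd : ∀ n t, ‖(1 / 2 : ℝ) ^ n * Metric.infDist (x n) (Q t)‖ ≤ (1 / 2) ^ n * D := by
    intro n t
    rw [Real.norm_of_nonneg (mul_nonneg (by positivity) Metric.infDist_nonneg)]
    gcongr
    exact (Metric.infDist_le_dist_of_mem (hQs t)).trans (hD (mem_univ _) (mem_univ _))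
  have hsum : Summable fun n : ℕ => (1 / 2 : ℝ) ^ n * D :=
    (summable_geometric_of_lt_one (by norm_num) (by norm_num)).mul_right D
  have hsum' : ∀ t, Summable fun n : ℕ => (1 / 2 : ℝ) ^ n * Metric.infDist (x n) (Q t) :=
    fun t => Summable.of_norm_bounded hsum fun n => hbd n t
  have hmono : ∀ n (s t : K), s ≤ t → Metric.infDist (x n) (Q t) ≤ Metric.infDist (x n) (Q s) :=
    fun n s t hst => Metric.infDist_le_infDist_of_subset (hQm s t hst) (hQne s)
  have hunif : UniformContinuousOn γ (Icc 0 1) :=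
    isCompact_Icc.uniformContinuousOn_of_continuous hγ.continuousOn
  have hcont : ∀ n, Continuous fun t : K => Metric.infDist (x n) (Q t) := by
    intro n
    rw [Metric.continuous_iff]
    intro t ε hε
    obtain ⟨δ, hδ, hδ'⟩ := Metric.uniformContinuousOn_iff.1 hunif (ε / 2) (half_pos hε)
    have key : ∀ s t : K, s ≤ t → dist s t < δ →
        Metric.infDist (x n) (Q s) - ε / 2 ≤ Metric.infDist (x n) (Q t) := by
      intro s t hst hd
      have hd : (t : ℝ) - s < δ := by
        rw [Subtype.dist_eq, Real.dist_eq, abs_sub_comm] at hd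
        exact (le_abs_self _).trans_lt hd
      refine (Metric.le_infDist (hQne t)).2 ?_
      rintro _ ⟨k, ⟨hk, hk'⟩, rfl⟩
      rcases le_total k s with h | h
      · linarith [Metric.infDist_le_dist_of_mem (x := x n) (s := Q s) (y := γ k)
          ⟨k, ⟨hk, hk'.1, h⟩, rfl⟩]
      · have h1 := hδ' s (hK.sub s.2) k (hK.sub hk) (by
          rw [Real.dist_eq, abs_sub_comm, abs_of_nonneg (by linarith)]
          linarith [hk'.2])
        linarith [Metric.infDist_le_dist_of_mem (x := x n) (hQs s),
          dist_triangle_right (x n) (γ s) (γ k)]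
    refine ⟨δ, hδ, fun s hs => ?_⟩
    rw [Real.dist_eq, abs_lt]
    rcases le_total s t with h | h
    · have := key s t h hs
      have := hmono n s t h
      constructor <;> linarith
    · have := key t s h (by rwa [dist_comm])
      have := hmono n t s h
      constructor <;> linarith
  refine ⟨fun t => ∑' n, (1 / 2 : ℝ) ^ n * Metric.infDist (x n) (Q t),
    continuous_tsum (fun n => continuous_const.mul (hcont n)) hsum hbd, fun s t hst => ?_⟩
  have hle : ∀ n, (1 / 2 : ℝ) ^ n * Metric.infDist (x n) (Q t) ≤
      (1 / 2 : ℝ) ^ n * Metric.infDist (x n) (Q s) := fun n => by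
    gcongr
    exact hmono n s t hst
  refine ⟨(hsum' t).tsum_le_tsum hle (hsum' s), fun h => ?_, fun h => ?_⟩
  · by_contra hne
    have hst' : s < t := lt_of_le_of_ne hst fun h' => hne (by rw [h'])
    have hnot : γ t ∉ Q s := by
      rintro ⟨k, ⟨hk, hk'⟩, hkt⟩
      rcases hk'.2.eq_or_lt with h' | h'
      · exact hne (by rw [← h', hkt])
      · exact disjoint_left.1 (hm k hk t t.2 (h'.trans hst') hkt) ⟨h', hst'⟩ s.2
    have hpos := ((hQc s).notMem_iff_infDist_pos (hQne s)).1 hnot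
    obtain ⟨n, hn⟩ := (TopologicalSpace.denseRange_denseSeq X).exists_dist_lt (γ t) (half_pos hpos)
    refine absurd h (ne_of_gt ((hsum' t).tsum_lt_tsum (i := n) hle ?_ (hsum' s)))
    gcongr
    calc Metric.infDist (x n) (Q t) ≤ dist (x n) (γ t) := Metric.infDist_le_dist_of_mem (hQs t)
      _ = dist (γ t) (x n) := dist_comm _ _
      _ < Metric.infDist (x n) (Q s) := by
        have := Metric.infDist_le_infDist_add_dist (s := Q s) (x := γ t) (y := x n)
        linarith
  · suffices Q s = Q t by simp only [this]
    refine Subset.antisymm (hQm s t hst) ?_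
    rintro _ ⟨k, ⟨hk, hk'⟩, rfl⟩
    rcases le_or_gt k s with h' | h'
    · exact ⟨k, ⟨hk, hk'.1, h'⟩, rfl⟩
    rcases hk'.2.eq_or_lt with hkt | hkt
    · rw [hkt, ← h]; exact hQs s
    · exact absurd hk (disjoint_left.1 (hm s s.2 t t.2 (h'.trans hkt) h) ⟨h', hkt⟩)

/-- A path contains an arc with the same end points. -/
theorem exists_arc_of_path (hγ : Continuous γ) (hne : γ 0 ≠ γ 1) : ∃ f : ℝ → X,
    ContinuousOn f (Icc 0 1) ∧ InjOn f (Icc 0 1) ∧ f 0 = γ 0 ∧ f 1 = γ 1 ∧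
    f '' Icc 0 1 ⊆ γ '' Icc 0 1 := by
  obtain ⟨K, hK, hm⟩ := exists_minimal_skips hγ
  obtain ⟨M, hMc, hM⟩ := exists_progress hγ hK hm
  let k0 : K := ⟨0, hK.zero⟩
  let k1 : K := ⟨1, hK.one⟩
  have hk0 : ∀ k, k0 ≤ k := fun k => (hK.sub k.2).1
  have hk1 : ∀ k, k ≤ k1 := fun k => (hK.sub k.2).2
  have hpos : 0 < M k0 - M k1 := by
    have := hM k0 k1 (hk0 k1)
    exact sub_pos.2 (lt_of_le_of_ne this.1 fun h => hne (this.2.1 h.symm))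
  have hMeq : ∀ s t : K, M s = M t ↔ γ s = γ t := by
    intro s t
    rcases le_total s t with h | h
    · exact (hM s t h).2
    · rw [eq_comm, (hM t s h).2, eq_comm]
  let m : K → ℝ := fun k => (M k0 - M k) / (M k0 - M k1)
  have hmc : Continuous m := by fun_prop
  have hmeq : ∀ s t : K, m s = m t ↔ γ s = γ t := by
    intro s t
    rw [← hMeq, div_left_inj' hpos.ne', sub_right_inj]
  have hmono : ∀ s t : K, s ≤ t → m s ≤ m t := by
    intro s t h
    have := (hM s t h).1
    simp only [m]
    gcongr
  have hm0 : m k0 = 0 := by simp [m]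
  have hm1 : m k1 = 1 := div_self hpos.ne'
  have hmI : ∀ k, m k ∈ Icc (0 : ℝ) 1 := fun k =>
    ⟨hm0 ▸ hmono _ _ (hk0 k), hm1 ▸ hmono _ _ (hk1 k)⟩
  have : CompactSpace K := isCompact_iff_compactSpace.1 hK.isCompact
  have hsurj : ∀ v ∈ Icc (0 : ℝ) 1, ∃ k, m k = v := by
    intro v hv
    obtain ⟨a, ha, ha'⟩ := (isClosed_Iic.preimage hmc (t := Iic v)).isCompact.exists_isGreatest
      ⟨k0, by simpa [hm0] using hv.1⟩
    obtain ⟨b, hb, hb'⟩ := (isClosed_Ici.preimage hmc (t := Ici v)).isCompact.exists_isLeast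
      ⟨k1, by simpa [hm1] using hv.2⟩
    rcases le_or_gt b a with h | h
    · exact ⟨a, le_antisymm ha (hb.trans (hmono b a h))⟩
    · have := hK.gap a a.2 b b.2 h (disjoint_left.2 fun k hk hkK => ?_)
      · exact ⟨a, le_antisymm ha (((hmeq a b).2 this).symm ▸ hb)⟩
      · rcases le_total (m ⟨k, hkK⟩) v with h' | h'
        · exact absurd (show k ≤ a from ha' h') (not_le.2 hk.1)
        · exact absurd (show (b : ℝ) ≤ k from hb' h') (not_le.2 hk.2)
  have : Nonempty K := ⟨k0⟩
  choose! r hr using hsurj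
  have hfm : ∀ k, γ (r (m k)) = γ k := fun k => (hmeq _ _).1 (hr _ (hmI k))
  refine ⟨fun v => γ (r v), ?_, ?_, ?_, ?_, ?_⟩
  · rw [continuousOn_iff_continuous_domRestrict]
    let m' : K → Icc (0 : ℝ) 1 := fun k => ⟨m k, hmI k⟩
    have hq : IsQuotientMap m' := IsQuotientMap.of_surjective_continuous
      (fun v => ⟨r v, Subtype.ext (hr v v.2)⟩) (hmc.subtype_mk _)
    rw [hq.continuous_iff]
    convert hγ.comp continuous_subtype_val using 1
    ext k
    exact hfm k
  · intro u hu v hv h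
    rw [← hr u hu, ← hr v hv, hmeq]
    exact h
  · have := hfm k0
    rwa [hm0] at this
  · have := hfm k1
    rwa [hm1] at this
  · rintro _ ⟨v, hv, rfl⟩
    exact ⟨_, hK.sub (r v).2, rfl⟩

end PathArc

end CubicalChain

namespace CubicalChain

open Set Topology unitInterval

/-- The concatenation of the first `n + 1` paths. -/
def concatFirst {X : Type} [TopologicalSpace X] {x : ℕ → X} (P : ∀ n, Path (x n) (x (n + 1))) :
    ℕ → ℝ → X
  | 0, t => (P 0).extend t
  | n + 1, t => if t ≤ n + 1 then concatFirst P n t else (P (n + 1)).extend (t - (n + 1))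

section Concat

variable {X : Type} [TopologicalSpace X] {x : ℕ → X} (P : ∀ n, Path (x n) (x (n + 1)))

lemma concatFirst_of_ge (n : ℕ) {t : ℝ} (ht : (n : ℝ) + 1 ≤ t) :
    concatFirst P n t = x (n + 1) := by
  cases n with
  | zero => exact (P 0).extend_of_one_le (by simpa using ht)
  | succ n =>
    push_cast at ht
    rw [concatFirst, if_neg (by linarith), (P (n + 1)).extend_of_one_le (by linarith)]

lemma continuous_concatFirst (n : ℕ) : Continuous (concatFirst P n) := by
  induction n with
  | zero => exact (P 0).continuous_extend
  | succ n ih =>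
    refine Continuous.if_le ih ((P (n + 1)).continuous_extend.comp (by fun_prop)) continuous_id
      continuous_const fun t ht => ?_
    rw [concatFirst_of_ge P n (by simpa using ht.ge)]
    simp [ht]

lemma concatFirst_eq {n m : ℕ} (h : n ≤ m) {t : ℝ} (ht : t ≤ n + 1) :
    concatFirst P m t = concatFirst P n t := by
  induction m, h using Nat.le_induction with
  | base => rfl
  | succ m hnm ih =>
    have : (n : ℝ) ≤ m := by exact_mod_cast hnm
    rw [concatFirst, if_pos (by linarith), ih]

lemma concatFirst_mem {U : ℕ → Set X} (hP : ∀ n t, P n t ∈ U n) (n : ℕ) {t : ℝ} (h0 : (n : ℝ) ≤ t)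
    (h1 : t ≤ n + 1) : concatFirst P n t ∈ U n := by
  have hmem : ∀ m u, (P m).extend u ∈ U m := fun m u => by
    have := (P m).extend_range.subset (mem_range_self u)
    obtain ⟨v, hv⟩ := this
    exact hv ▸ hP m v
  cases n with
  | zero => exact hmem 0 t
  | succ n =>
    rcases h0.eq_or_lt with h | h
    · have := hP (n + 1) 0
      push_cast at h
      rw [(P (n + 1)).source] at this
      rw [concatFirst, if_pos h.ge, concatFirst_of_ge P n h.le]
      exact this
    · push_cast at h
      rw [concatFirst, if_neg (by linarith)]
      exact hmem _ _

end Concat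

lemma joinedIn_of_tendsto {X : Type} [MetricSpace X] {x : ℕ → X} {p : X} {F : Set X}
    (h : ∀ n : ℕ, JoinedIn (F ∩ Metric.ball p (1 / (n + 1))) (x n) (x (n + 1))) :
    JoinedIn (insert p F) p (x 0) := by
  choose P hP using h
  let g : ℝ → X := fun t => concatFirst P ⌊t⌋₊ t
  have hg : ∀ n : ℕ, ∀ t : ℝ, t ≤ n + 1 → g t = concatFirst P n t := by
    intro n t ht
    rcases le_total ⌊t⌋₊ n with h | h
    · exact (concatFirst_eq P h (Nat.lt_floor_add_one t).le).symm
    · exact concatFirst_eq P h ht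
  have hgc : Continuous g := by
    rw [continuous_iff_continuousAt]
    intro t
    refine (continuous_concatFirst P ⌊t⌋₊).continuousAt.congr ?_
    filter_upwards [Iio_mem_nhds (Nat.lt_floor_add_one t)] with s hs
    exact (hg _ s hs.le).symm
  have hgm : ∀ t : ℝ, 0 ≤ t → g t ∈ F ∩ Metric.ball p (1 / (⌊t⌋₊ + 1)) := fun t ht =>
    concatFirst_mem P (U := fun n => F ∩ Metric.ball p (1 / (n + 1))) hP _ (Nat.floor_le ht)
      (Nat.lt_floor_add_one t).le
  have hg0 : g 0 = x 0 := by simp [g, concatFirst]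
  have hcont : Continuous fun t : ℝ => if t ≤ 0 then p else g (1 / t - 1) := by
    rw [continuous_iff_continuousAt]
    intro t
    rcases lt_trichotomy t 0 with ht | rfl | ht
    · refine (continuousAt_const (y := p)).congr ?_
      filter_upwards [Iio_mem_nhds ht] with s hs
      rw [if_pos hs.le]
    · rw [Metric.continuousAt_iff]
      intro ε hε
      obtain ⟨n, hn⟩ := exists_nat_one_div_lt hε
      refine ⟨1 / (n + 2), by positivity, fun s hs => ?_⟩
      rw [if_pos le_rfl]
      split_ifs with h
      · simpa using hε
      · push Not at h
        rw [Real.dist_eq, sub_zero, abs_of_pos h] at hs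
        have h2 : (n : ℝ) + 2 < 1 / s := by
          rw [lt_div_iff₀ h]
          rw [lt_div_iff₀ (by positivity)] at hs
          linarith
        have h3 : (n : ℝ) ≤ ⌊1 / s - 1⌋₊ := by
          have : n ≤ ⌊1 / s - 1⌋₊ := Nat.le_floor (by linarith)
          exact_mod_cast this
        refine lt_trans (lt_of_lt_of_le (hgm (1 / s - 1) (by
          have : (0 : ℝ) ≤ n := n.cast_nonneg
          linarith)).2 ?_) hn
        gcongr
    · have : ContinuousAt (fun s : ℝ => g (1 / s - 1)) t :=
        hgc.continuousAt.comp (by fun_prop (disch := exact ht.ne'))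
      refine this.congr ?_
      filter_upwards [Ioi_mem_nhds ht] with s hs
      rw [if_neg (not_le.2 hs)]
  refine JoinedIn.ofLine hcont.continuousOn (by simp) (by norm_num [hg0]) ?_
  rintro _ ⟨t, ht, rfl⟩
  simp only
  split_ifs with h
  · exact .inl rfl
  · push Not at h
    exact .inr (hgm _ (by have := one_le_one_div h ht.2; linarith)).1

variable {S : Type} [MetricSpace S] [IsSph S] {C F : Set S} {p q x : S}

/-- A face is uniformly locally connected at its frontier. -/
lemma IsFace.exists_nhds_joined (h : IsFace C F) (hC : Fine C) (hp : p ∈ C) {N : Set S}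
    (hN : IsOpen N) (hpN : p ∈ N) : ∃ V, IsOpen V ∧ p ∈ V ∧
      ∀ x ∈ F ∩ V, ∀ y ∈ F ∩ V, JoinedIn (F ∩ N) x y := by
  obtain ⟨A, hAC, hA, hAp, -, hpA, hCN⟩ := hC p hp N hN hpN
  refine ⟨{y | JoinedIn (N \ A) p y}, isOpen_joinedIn (hN.sdiff hA) p, .refl ⟨hpN, hpA⟩, ?_⟩
  rintro x ⟨hxF, hx⟩ y ⟨hyF, hy⟩
  have h1 : JoinedIn (Nᶜ ∪ A)ᶜ x y := by
    rw [compl_union, compl_compl]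
    exact (JoinedIn.symm hx).trans hy
  have h2 := jan h.isClosed (hN.isClosed_compl.union hA) (by
    rw [show C ∩ (Nᶜ ∪ A) = A from ?_]
    · exact hAp
    · ext z
      constructor
      · rintro ⟨hz, hz' | hz'⟩
        · by_contra hzA
          exact hz' (hCN ⟨hz, hzA⟩)
        · exact hz'
      · exact fun hz => ⟨hAC hz, .inr hz⟩) (h.joined hxF hyF) h1
  refine (joinedIn_inter_of_disjoint h.isOpen h.isOpen_compl ?_ h.disjoint_compl h2 hxF).mono ?_
  · exact (compl_subset_compl.2 subset_union_left).trans h.compl_subset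
  · rintro z ⟨hz, hz'⟩
    refine ⟨hz', ?_⟩
    by_contra hn
    exact hz (.inr (.inl hn))

/-- The points of the frontier are accessible. -/
lemma IsFace.access (h : IsFace C F) (hC : Fine C) (hp : p ∈ C) (hx : x ∈ F) :
    JoinedIn (insert p F) p x := by
  choose V hV hpV hVj using fun n : ℕ => h.exists_nhds_joined hC hp
    (Metric.isOpen_ball (x := p) (ε := 1 / ((n : ℝ) + 1))) (Metric.mem_ball_self (by positivity))
  have h1 : ∀ n : ℕ, ∃ y ∈ F, ∀ i ≤ n, y ∈ V i := by
    intro n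
    obtain ⟨y, hy, hyF⟩ := mem_closure_iff.1 (h.subset_closure hC hp) (⋂ i ∈ Iic n, V i)
      ((finite_Iic n).isOpen_biInter fun i _ => hV i) (by simp [hpV])
    exact ⟨y, hyF, by simpa using hy⟩
  choose y hyF hyV using h1
  have h2 := joinedIn_of_tendsto (x := y) (p := p) (F := F) fun n =>
    hVj n _ ⟨hyF n, hyV n n le_rfl⟩ _ ⟨hyF _, hyV (n + 1) n n.le_succ⟩
  exact h2.trans ((h.joinedIn (hyF 0) hx).mono (subset_insert _ _))

lemma exists_arc_of_joinedIn {U : Set S} (h : JoinedIn U p q) (hpq : p ≠ q) :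
    ∃ f : ℝ → S, IsArc f ∧ f 0 = p ∧ f 1 = q ∧ f '' Icc 0 1 ⊆ U := by
  obtain ⟨γ, hγ⟩ := h
  obtain ⟨f, h1, h2, h3, h4, h5⟩ := exists_arc_of_path γ.continuous_extend (by simpa using hpq)
  refine ⟨f, ⟨h1, h2⟩, by simpa using h3, by simpa using h4, h5.trans ?_⟩
  rintro _ ⟨t, ht, rfl⟩
  rw [γ.extend_apply ht]
  exact hγ _

/-- An arc across a face between two points of its frontier. -/
structure IsCross (F : Set S) (p q : S) (α : ℝ → S) : Prop where
  arc : IsArc α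
  zero : α 0 = p
  one : α 1 = q
  mem : ∀ t ∈ Ioo (0 : ℝ) 1, α t ∈ F

lemma exists_isCross_of_joinedIn {U : Set S} (hpq : p ≠ q) (h : JoinedIn U p q)
    (hU : U ⊆ insert p (insert q F)) : ∃ α, IsCross F p q α ∧ α '' Icc 0 1 ⊆ U := by
  obtain ⟨f, h1, h2, h3, h4⟩ := exists_arc_of_joinedIn h hpq
  refine ⟨f, ⟨h1, h2, h3, fun t ht => ?_⟩, h4⟩
  have ht' := Ioo_subset_Icc_self ht
  rcases hU (h4 ⟨t, ht', rfl⟩) with h | h | h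
  · exact absurd (h1.inj ht' ⟨le_rfl, zero_le_one⟩ (h.trans h2.symm)) ht.1.ne'
  · exact absurd (h1.inj ht' ⟨zero_le_one, le_rfl⟩ (h.trans h3.symm)) ht.2.ne
  · exact h

lemma IsFace.exists_isCross (h : IsFace C F) (hC : Fine C) (hp : p ∈ C) (hq : q ∈ C)
    (hpq : p ≠ q) : ∃ α, IsCross F p q α := by
  obtain ⟨x, hx⟩ := h.nonempty
  obtain ⟨α, hα, -⟩ := exists_isCross_of_joinedIn (F := F) hpq
    (((h.access hC hp hx).mono (insert_subset_insert (subset_insert q F))).trans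
      ((h.access hC hq hx).mono (subset_insert p _)).symm) subset_rfl
  exact ⟨α, hα⟩

/-- A crosscut can be made to meet a given path connected subset of the face. -/
lemma IsFace.exists_isCross_meeting (h : IsFace C F) (hC : Fine C) (hp : p ∈ C) (hq : q ∈ C)
    (hpq : p ≠ q) {B : Set S} (hB : IsClosed B) (hBF : B ⊆ F) (hBn : B.Nontrivial)
    (hBj : ∀ x ∈ B, ∀ y ∈ B, JoinedIn B x y) :
    ∃ α, IsCross F p q α ∧ (α '' Ioo 0 1 ∩ B).Nonempty := by
  have hCF := h.subset_compl
  obtain ⟨b, hb⟩ := hBn.nonempty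
  obtain ⟨f, hf, hf0, hf1, hfU⟩ := exists_arc_of_joinedIn (h.access hC hp (hBF hb))
    (fun hh => hCF (hBF hb) (hh ▸ hp))
  obtain ⟨u, ⟨hu, hu'⟩, hmin⟩ := (isCompact_Icc.of_isClosed_subset
    (hf.cont.preimage_isClosed_of_isClosed isClosed_Icc hB) inter_subset_left).exists_isLeast
    ⟨1, ⟨zero_le_one, le_rfl⟩, by simpa [hf1] using hb⟩
  have hsub : Icc 0 u ⊆ Icc 0 1 := Icc_subset_Icc_right hu.2
  have hLc : IsClosed (f '' Icc 0 u) := isClosed_image_Icc (hf.cont.mono hsub)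
  have hLU : f '' Icc 0 u ⊆ insert p F := (image_mono hsub).trans hfU
  have hLC : ∀ z ∈ f '' Icc 0 u, z ∈ C → z = p := fun z hz hzC =>
    (hLU hz).resolve_right fun h' => hCF h' hzC
  have hLB : ∀ z ∈ f '' Icc 0 u, z ∈ B → z = f u := by
    rintro _ ⟨t, ht, rfl⟩ hz
    rw [le_antisymm ht.2 (hmin ⟨hsub ht, hz⟩)]
  have hpL : p ∈ f '' Icc 0 u := ⟨0, ⟨le_rfl, hu.1⟩, hf0⟩
  have hqL : q ∉ f '' Icc 0 u := fun h' => hpq (hLC q h' hq).symm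
  obtain ⟨b', hb', hbb'⟩ := hBn.exists_ne (f u)
  have hb'L : b' ∉ f '' Icc 0 u := fun h' => hbb' (hLB b' h' hb')
  obtain ⟨w, hwF, hwL, hqw⟩ : ∃ w ∈ F, w ∉ f '' Icc 0 u ∧
      JoinedIn (insert q F \ f '' Icc 0 u) q w := by
    obtain ⟨g, hg, hg0, hg1, hgU⟩ := exists_arc_of_joinedIn (h.access hC hq (hBF hb))
      (fun hh => hCF (hBF hb) (hh ▸ hq))
    have h1 : ∀ᶠ t in 𝓝[Icc 0 1] (0 : ℝ), g t ∉ f '' Icc 0 u :=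
      (hg.cont 0 ⟨le_rfl, zero_le_one⟩).eventually (hLc.isOpen_compl.mem_nhds (by rwa [hg0]))
    rw [eventually_nhdsWithin_iff, Metric.eventually_nhds_iff] at h1
    obtain ⟨δ, hδ, h1⟩ := h1
    have hs : ∃ s, 0 < s ∧ s ≤ 1 ∧ s < δ :=
      ⟨min (δ / 2) 1, by positivity, min_le_right _ _, (min_le_left _ _).trans_lt (by linarith)⟩
    obtain ⟨s, hs0, hs1, hsδ⟩ := hs
    have h2 : ∀ t ∈ Icc 0 s, g t ∉ f '' Icc 0 u := fun t ht =>
      h1 (by rw [Real.dist_eq, sub_zero, abs_of_nonneg ht.1]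
             linarith [ht.2]) ⟨ht.1, by linarith [ht.2]⟩
    refine ⟨g s, ?_, h2 s ⟨hs0.le, le_rfl⟩, ?_⟩
    · refine (hgU ⟨s, ⟨hs0.le, hs1⟩, rfl⟩).resolve_left fun h' => ?_
      exact hs0.ne' (hg.inj ⟨hs0.le, hs1⟩ ⟨le_rfl, zero_le_one⟩ (h'.trans hg0.symm))
    · have hm : MapsTo (fun t : ℝ => s * t) I (Icc 0 s) := fun t ht =>
        ⟨mul_nonneg hs0.le ht.1, by nlinarith [ht.2]⟩
      refine JoinedIn.ofLine (f := fun t => g (s * t)) (hg.cont.comp (by fun_prop)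
        (hm.mono_right (Icc_subset_Icc_right hs1))) (by simpa using hg0) (by simp) ?_
      rintro _ ⟨t, ht, rfl⟩
      exact ⟨hgU ⟨_, Icc_subset_Icc_right hs1 (hm ht), rfl⟩, h2 _ (hm ht)⟩
  have hwb : JoinedIn (insert q F \ f '' Icc 0 u) w b' := by
    have h1 := jan h.isClosed hLc (by
      rw [show C ∩ f '' Icc 0 u = {p} from ?_]
      · exact isPreconnected_singleton
      · exact Subset.antisymm (fun z hz => hLC z hz.2 hz.1)
          (singleton_subset_iff.2 ⟨hp, hpL⟩)) (h.joined hwF (hBF hb'))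
      (nonSep_arc hu.1 (hf.cont.mono hsub) (hf.inj.mono hsub) hwL hb'L)
    refine (joinedIn_inter_of_disjoint h.isOpen h.isOpen_compl ?_ h.disjoint_compl h1 hwF).mono ?_
    · exact (compl_subset_compl.2 subset_union_left).trans h.compl_subset
    · exact fun z hz => ⟨.inr hz.2, fun h' => hz.1 (.inr h')⟩
  obtain ⟨μ, hμ⟩ := hqw.trans hwb
  have hμc : IsClosed (range μ) := (isCompact_range μ.continuous).isClosed
  have hjoin : JoinedIn (f '' Icc 0 u ∪ B ∪ range μ) p q := by
    have j1 : JoinedIn (f '' Icc 0 u) p (f u) := by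
      have hm : MapsTo (fun t : ℝ => u * t) I (Icc 0 u) := fun t ht =>
        ⟨mul_nonneg hu.1 ht.1, by nlinarith [ht.2, hu.1]⟩
      refine JoinedIn.ofLine (f := fun t => f (u * t)) ((hf.cont.mono hsub).comp (by fun_prop) hm)
        (by simpa using hf0) (by simp) ?_
      rintro _ ⟨t, ht, rfl⟩
      exact ⟨_, hm ht, rfl⟩
    have j2 := hBj _ hu' b' hb'
    have j3 : JoinedIn (range μ) q b' := ⟨μ, fun t => mem_range_self t⟩
    exact (j1.mono fun z hz => .inl (.inl hz)).trans
      ((j2.mono fun z hz => .inl (.inr hz)).trans (j3.symm.mono fun z hz => .inr hz))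
  obtain ⟨α, hα, hαU⟩ := exists_isCross_of_joinedIn (F := F) hpq hjoin (by
    rintro z ((hz | hz) | ⟨t, rfl⟩)
    · exact insert_subset_insert (subset_insert q F) (hLU hz)
    · exact .inr (.inr (hBF hz))
    · exact .inr (hμ t).1)
  refine ⟨α, hα, ?_⟩
  by_contra hn
  have hαB : ∀ t ∈ Icc (0 : ℝ) 1, α t ∉ B := by
    intro t ht hB'
    rcases ht.1.eq_or_lt with rfl | h0
    · exact hCF (hBF hB') (hα.zero ▸ hp)
    rcases ht.2.eq_or_lt with rfl | h1
    · exact hCF (hBF hB') (hα.one ▸ hq)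
    exact hn ⟨α t, ⟨t, ⟨h0, h1⟩, rfl⟩, hB'⟩
  obtain ⟨z, hz, hz1, hz2⟩ := isPreconnected_closed_iff.1 hα.arc.conn _ _ hLc hμc (by
    rintro _ ⟨t, ht, rfl⟩
    rcases hαU ⟨t, ht, rfl⟩ with (h' | h') | h'
    · exact .inl h'
    · exact absurd h' (hαB t ht)
    · exact .inr h') ⟨p, ⟨0, by simp, hα.zero⟩, hpL⟩
    ⟨q, ⟨1, by simp, hα.one⟩, ⟨0, μ.source⟩⟩
  obtain ⟨t, rfl⟩ := hz2
  exact (hμ t).2 hz1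

end CubicalChain

namespace CubicalChain

open Set Topology unitInterval

variable {S : Type} [TopologicalSpace S] [IsSph S]

/-- The linear identification of the coordinate plane with the complex numbers. -/
def planeComplex : ℂ ≃L[ℝ] E 2 := Complex.basisOneI.equivFun.toContinuousLinearEquiv

section Chart

variable (φ : OpenPartialHomeomorph S ℂ) {K : Set ℂ} {c : ℂ} {r : ℝ}

lemma nonSep_symm_image (hKc : IsCompact K) (hK : Convex ℝ K) (hne : K.Nonempty)
    (hKt : K ⊆ φ.target) : NonSep (φ.symm '' K) := by
  refine nonSep_of_van ?_
  have h1 := van_transfer (k := 1) (φ.symm.symm.transHomeomorph planeComplex.toHomeomorph)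
    (hKc.image_of_continuousOn (φ.continuousOn_symm.mono hKt))
    (by rintro _ ⟨z, hz, rfl⟩; exact φ.map_target (hKt hz))
  rw [h1, show (φ.symm.symm.transHomeomorph planeComplex.toHomeomorph) '' (φ.symm '' K) =
    planeComplex '' K from ?_]
  · exact van_compl_convex (hKc.image planeComplex.continuous)
      (hK.linear_image planeComplex.toLinearMap) (hne.image _) (by norm_num)
  · rw [image_image]
    refine image_congr fun z hz => ?_
    simp [φ.right_inv (hKt hz)]

lemma isClosed_symm_image (hKc : IsCompact K) (hKt : K ⊆ φ.target) : IsClosed (φ.symm '' K) :=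
  (hKc.image_of_continuousOn (φ.continuousOn_symm.mono hKt)).isClosed

lemma isOpen_symm_image {U : Set ℂ} (hU : IsOpen U) (hUt : U ⊆ φ.target) :
    IsOpen (φ.symm '' U) :=
  φ.symm.isOpen_image_of_subset_source hU hUt

lemma joinedIn_symm_image (hK : Convex ℝ K) (hKt : K ⊆ φ.target) :
    ∀ x ∈ φ.symm '' K, ∀ y ∈ φ.symm '' K, JoinedIn (φ.symm '' K) x y := by
  rintro _ ⟨x, hx, rfl⟩ _ ⟨y, hy, rfl⟩
  obtain ⟨γ, hγ⟩ := (hK.isPathConnected ⟨x, hx⟩).joinedIn x hx y hy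
  refine JoinedIn.ofLine (f := fun t => φ.symm (γ.extend t)) ?_ (by simp) (by simp) ?_
  · refine φ.continuousOn_symm.comp γ.continuous_extend.continuousOn fun t ht => hKt ?_
    rw [γ.extend_apply ht]
    exact hγ _
  · rintro _ ⟨t, ht, rfl⟩
    refine ⟨_, ?_, rfl⟩
    rw [γ.extend_apply ht]
    exact hγ _

/-- The curve which runs along the circle in a chart. -/
def chartCircle (c : ℂ) (r : ℝ) (t : ℝ) : S := φ.symm (circleMap c r (2 * Real.pi * t))

lemma range_chartCircle (hr : 0 ≤ r) :
    range (chartCircle φ c r) = φ.symm '' Metric.sphere c r := by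
  rw [← abs_of_nonneg hr, ← range_circleMap, ← range_comp]
  ext x
  constructor
  · rintro ⟨t, rfl⟩
    exact ⟨2 * Real.pi * t, by simp [chartCircle, abs_of_nonneg hr]⟩
  · rintro ⟨t, rfl⟩
    refine ⟨t / (2 * Real.pi), ?_⟩
    simp only [chartCircle, Function.comp]
    rw [mul_div_cancel₀ _ (by positivity), abs_of_nonneg hr]

lemma isLoop_chartCircle (hr : 0 < r) (ht : Metric.sphere c r ⊆ φ.target) :
    IsLoop (chartCircle φ c r) := by
  have hm : ∀ t, circleMap c r t ∈ φ.target := fun t => ht (circleMap_mem_sphere c hr.le t)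
  refine ⟨φ.continuousOn_symm.comp_continuous (by fun_prop) fun t => hm _, fun s t => ?_⟩
  rw [chartCircle, chartCircle, φ.symm.injOn.eq_iff (hm _) (hm _), eq_comm]
  simp only [circleMap]
  rw [add_right_inj, mul_right_inj' (by exact_mod_cast hr.ne'), Complex.exp_eq_exp_iff_exists_int]
  refine exists_congr fun n => ?_
  rw [← sub_eq_zero, ← sub_eq_zero (a := t)]
  have : ((2 * Real.pi * t : ℝ) : ℂ) * Complex.I - (((2 * Real.pi * s : ℝ) : ℂ) * Complex.I +
      n * (2 * Real.pi * Complex.I)) = ((2 * Real.pi * (t - (s + n)) : ℝ) : ℂ) * Complex.I := by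
    push_cast; ring
  rw [this, mul_eq_zero, Complex.ofReal_eq_zero, mul_eq_zero]
  simp [Real.pi_ne_zero]

lemma isFace_chartCircle (hr : 0 < r) (ht : Metric.closedBall c (2 * r) ⊆ φ.target) :
    IsFace (range (chartCircle φ c r)) (φ.symm '' Metric.ball c r) := by
  have ht' : Metric.closedBall c r ⊆ φ.target :=
    (Metric.closedBall_subset_closedBall (by linarith)).trans ht
  have hu : φ.symm '' Metric.sphere c r ∪ φ.symm '' Metric.ball c r =
      φ.symm '' Metric.closedBall c r := by
    rw [← image_union, union_comm, Metric.ball_union_sphere]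
  rw [range_chartCircle φ hr.le]
  refine ⟨?_, ?_, ?_, ?_, ?_, ?_, ?_, ?_⟩
  · exact isClosed_symm_image φ (isCompact_sphere c r) (Metric.sphere_subset_closedBall.trans ht')
  · exact isOpen_symm_image φ Metric.isOpen_ball (Metric.ball_subset_closedBall.trans ht')
  · rw [hu]
    exact (isClosed_symm_image φ (isCompact_closedBall c r) ht').isOpen_compl
  · exact (Metric.nonempty_ball.2 hr).image _
  · rw [hu]
    have h1 : c + (2 * r : ℝ) ∈ Metric.closedBall c (2 * r) := by
      simp [abs_of_pos hr]
    refine ⟨φ.symm (c + (2 * r : ℝ)), ?_⟩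
    rintro ⟨z, hz, hz'⟩
    rw [φ.symm.injOn (ht' hz) (ht h1) hz'] at hz
    simp [abs_of_pos hr] at hz
    linarith
  · rw [disjoint_left]
    rintro _ ⟨z, hz, rfl⟩ ⟨w, hw, hw'⟩
    rw [φ.symm.injOn (ht' (Metric.ball_subset_closedBall hw))
      (ht' (Metric.sphere_subset_closedBall hz)) hw'] at hw
    rw [Metric.mem_sphere] at hz
    rw [Metric.mem_ball] at hw
    linarith
  · intro x y hx hy
    refine (joinedIn_symm_image φ (convex_ball c r) (Metric.ball_subset_closedBall.trans ht')
      x hx y hy).mono ?_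
    rintro _ ⟨z, hz, rfl⟩ ⟨w, hw, hw'⟩
    rw [φ.symm.injOn (ht' (Metric.sphere_subset_closedBall hw))
      (ht' (Metric.ball_subset_closedBall hz)) hw'] at hw
    rw [Metric.mem_sphere] at hw
    rw [Metric.mem_ball] at hz
    linarith
  · intro x y hx hy
    rw [hu] at hx hy
    refine (nonSep_symm_image φ (isCompact_closedBall c r) (convex_closedBall c r)
      (Metric.nonempty_closedBall.2 hr.le) ht' hx hy).mono ?_
    exact compl_subset_compl.2 (image_mono Metric.sphere_subset_closedBall)

end Chart

lemma exists_chart (x : S) {U : Set S} (hU : IsOpen U) (hx : x ∈ U) :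
    ∃ (φ : OpenPartialHomeomorph S ℂ) (r : ℝ), x ∈ φ.source ∧ 0 < r ∧
      Metric.closedBall (φ x) r ⊆ φ.target ∧ φ.symm '' Metric.closedBall (φ x) r ⊆ U := by
  obtain ⟨ψ, hψ⟩ := IsSph.loc (S := S) x
  let φ := ψ.transHomeomorph planeComplex.toHomeomorph.symm
  have hs : x ∈ φ.source := hψ
  have h1 : φ.target ∩ φ.symm ⁻¹' U ∈ 𝓝 (φ x) :=
    (φ.isOpen_inter_preimage_symm hU).mem_nhds ⟨φ.map_source hs, by simpa [φ.left_inv hs] using hx⟩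
  obtain ⟨r, hr, h2⟩ := Metric.nhds_basis_closedBall.mem_iff.1 h1
  exact ⟨φ, r, hs, hr, fun z hz => (h2 hz).1, image_subset_iff.2 fun z hz => (h2 hz).2⟩

/-- A loop which separates a disc from the complement of a larger disc. -/
structure Shell (D D' : Set S) (κ : ℝ → S) : Prop where
  isLoop : IsLoop κ
  isClosed : IsClosed D
  joined : ∀ x ∈ D, ∀ y ∈ D, JoinedIn D x y
  nontrivial : D.Nontrivial
  isClosed_outer : IsClosed D'
  nonSep_outer : NonSep D'
  subset : range κ ⊆ interior D' \ D
  sep : ∀ x ∈ D, ∀ y ∉ D', ¬ JoinedIn (range κ)ᶜ x y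

lemma exists_shell (x : S) {U : Set S} (hU : IsOpen U) (hx : x ∈ U) :
    ∃ D D' κ, Shell D D' κ ∧ x ∈ interior D ∧ D ⊆ D' ∧ D' ⊆ U := by
  obtain ⟨φ, R, hxφ, hR, ht, hRU⟩ := exists_chart x hU hx
  have hsub : ∀ {s : ℝ}, s ≤ R → Metric.closedBall (φ x) s ⊆ φ.target := fun h =>
    (Metric.closedBall_subset_closedBall h).trans ht
  have hF := isFace_chartCircle φ (c := φ x) (r := R / 2) (by positivity) (hsub (by linarith))
  have hrange := range_chartCircle φ (c := φ x) (r := R / 2) (by positivity)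
  have hDF : φ.symm '' Metric.closedBall (φ x) (R / 4) ⊆ φ.symm '' Metric.ball (φ x) (R / 2) :=
    image_mono (Metric.closedBall_subset_ball (by linarith))
  have hball : Metric.ball (φ x) R ⊆ φ.target := Metric.ball_subset_closedBall.trans ht
  refine ⟨φ.symm '' Metric.closedBall (φ x) (R / 4), φ.symm '' Metric.closedBall (φ x) R,
    chartCircle φ (φ x) (R / 2), ⟨?_, ?_, ?_, ?_, ?_, ?_, ?_, ?_⟩, ?_,
    image_mono (Metric.closedBall_subset_closedBall (by linarith)), hRU⟩
  · exact isLoop_chartCircle φ (by positivity)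
      (Metric.sphere_subset_closedBall.trans (hsub (by linarith)))
  · exact isClosed_symm_image φ (isCompact_closedBall _ _) (hsub (by linarith))
  · exact joinedIn_symm_image φ (convex_closedBall _ _) (hsub (by linarith))
  · have h1 : φ x + (R / 4 : ℝ) ∈ Metric.closedBall (φ x) (R / 4) := by
      simp [abs_of_pos hR]
    refine ⟨_, ⟨φ x, Metric.mem_closedBall_self (by positivity), rfl⟩, _, ⟨_, h1, rfl⟩, fun h => ?_⟩
    have := φ.symm.injOn (hsub (by linarith) (Metric.mem_closedBall_self hR.le))
      (hsub (by linarith) h1) h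
    simp [hR.ne'] at this
  · exact isClosed_symm_image φ (isCompact_closedBall _ _) ht
  · exact nonSep_symm_image φ (isCompact_closedBall _ _) (convex_closedBall _ _)
      (Metric.nonempty_closedBall.2 hR.le) ht
  · refine fun z hz => ⟨?_, fun h => hF.subset_compl (hDF h) hz⟩
    refine interior_maximal (image_mono Metric.ball_subset_closedBall)
      (isOpen_symm_image φ Metric.isOpen_ball hball) ?_
    rw [hrange] at hz
    exact image_mono (fun w hw => by rw [Metric.mem_sphere] at hw; rw [Metric.mem_ball]; linarith) hz
  · intro y hy z hz h
    have := hF.mem_of_joinedIn (hDF hy) h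
    exact hz (image_mono (Metric.ball_subset_closedBall.trans
      (Metric.closedBall_subset_closedBall (by linarith))) this)
  · refine interior_maximal (image_mono Metric.ball_subset_closedBall)
      (isOpen_symm_image φ Metric.isOpen_ball
        ((Metric.ball_subset_ball (by linarith)).trans hball)) ?_
    exact ⟨φ x, Metric.mem_ball_self (by positivity), φ.left_inv hxφ⟩

variable (S) in
lemma exists_isLoop_isFace : ∃ (κ : ℝ → S) (F : Set S), IsLoop κ ∧ IsFace (range κ) F := by
  obtain ⟨x⟩ := (inferInstance : Nonempty S)
  obtain ⟨φ, R, hxφ, hR, ht, -⟩ := exists_chart x isOpen_univ (mem_univ x)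
  exact ⟨_, _, isLoop_chartCircle φ (r := R / 2) (by positivity)
    (Metric.sphere_subset_closedBall.trans ((Metric.closedBall_subset_closedBall
      (by linarith)).trans ht)), isFace_chartCircle φ (by positivity) (by rwa [mul_div_cancel₀ _ two_ne_zero])⟩

end CubicalChain

namespace CubicalChain

open Set Topology unitInterval

section Cut

variable {S : Type} [MetricSpace S] [IsSph S] {C F : Set S}

lemma IsFace.frontier_eq (h : IsFace C F) (hC : Fine C) : frontier F = C := by
  rw [frontier, h.closure_eq hC, h.isOpen.interior_eq, union_sdiff_right]
  exact h.disjoint.sdiff_eq_left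

/-- A crosscut divides a face of a loop into two faces. -/
lemma IsFace.exists_cut {κ α : ℝ → S} (hκ : IsLoop κ) (hF : IsFace (range κ) F) {s : ℝ}
    (hs : s ∈ Ioo (0 : ℝ) 1) (hα : IsCross F (κ 0) (κ s) α) :
    IsPair (fun t => κ (s * t)) α ∧ IsPair (fun t => κ (1 - (1 - s) * t)) α ∧
    ∃ G₁ G₂ : Set S, IsFace (range (arcLoop (fun t => κ (s * t)) α)) G₁ ∧
      IsFace (range (arcLoop (fun t => κ (1 - (1 - s) * t)) α)) G₂ ∧
      Disjoint G₁ G₂ ∧ G₁ ∪ G₂ = F \ α '' Icc 0 1 ∧ closure F ⊆ closure G₁ ∪ closure G₂ := by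
  obtain ⟨hp, hr⟩ := hκ.split hs
  have hr' := hr
  rw [hr] at hF
  have h1 : κ 1 = κ 0 := by simpa using hκ.add_one 0
  have hf := IsPair.of_face hp.left hα.arc hF subset_union_left hα.mem (by simpa using hα.zero)
    (by simpa using hα.one)
  have hg := IsPair.of_face hp.right hα.arc hF subset_union_right hα.mem
    (by simpa [h1] using hα.zero) (by simpa using hα.one)
  obtain ⟨G₁, G₂, h₁, h₂, hd, hu⟩ := (hp.theta hf hg hF hα.mem).exists_faces
  rw [← hf.range_arcLoop] at h₁
  rw [← hg.range_arcLoop] at h₂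
  refine ⟨hf, hg, G₁, G₂, h₁, h₂, hd, hu, ?_⟩
  refine closure_minimal (fun z hz => ?_) (isClosed_closure.union isClosed_closure)
  by_cases hzα : z ∈ α '' Icc 0 1
  · exact .inl (h₁.subset_closure hf.isLoop.fine (hf.range_arcLoop ▸ .inr hzα))
  · have : z ∈ G₁ ∪ G₂ := hu ▸ ⟨hz, hzα⟩
    exact this.imp (fun h => _root_.subset_closure h) (fun h => _root_.subset_closure h)

end Cut

/-- A pair of matching subdivisions of two spheres into finitely many faces. -/
structure Config (S T : Type) [MetricSpace S] [IsSph S] [MetricSpace T] [IsSph T] where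
  rel : Set (S × T)
  faces : Set (Set S × Set T)
  finite : faces.Finite
  inj_left : ∀ ⦃x y y'⦄, (x, y) ∈ rel → (x, y') ∈ rel → y = y'
  inj_right : ∀ ⦃x x' y⦄, (x, y) ∈ rel → (x', y) ∈ rel → x = x'
  loops : ∀ P ∈ faces, ∃ (κ : ℝ → S) (μ : ℝ → T), IsLoop κ ∧ IsLoop μ ∧
    (∀ t, (κ t, μ t) ∈ rel) ∧ IsFace (range κ) P.1 ∧ IsFace (range μ) P.2
  disj_left : ∀ P ∈ faces, ∀ Q ∈ faces, P ≠ Q → Disjoint P.1 Q.1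
  disj_right : ∀ P ∈ faces, ∀ Q ∈ faces, P ≠ Q → Disjoint P.2 Q.2
  cover_left : ∀ x, ∃ P ∈ faces, x ∈ closure P.1
  cover_right : ∀ y, ∃ P ∈ faces, y ∈ closure P.2
  rel_left : ∀ P ∈ faces, ∀ z ∈ rel, z.1 ∉ P.1
  rel_right : ∀ P ∈ faces, ∀ z ∈ rel, z.2 ∉ P.2

namespace Config

variable {S T : Type} [MetricSpace S] [IsSph S] [MetricSpace T] [IsSph T]

/-- Exchange of the two spheres. -/
def swap (c : Config S T) : Config T S where
  rel := Prod.swap ⁻¹' c.rel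
  faces := Prod.swap ⁻¹' c.faces
  finite := c.finite.preimage Prod.swap_injective.injOn
  inj_left _ _ _ h h' := c.inj_right h h'
  inj_right _ _ _ h h' := c.inj_left h h'
  loops P hP := by
    obtain ⟨κ, μ, h1, h2, h3, h4, h5⟩ := c.loops _ hP
    exact ⟨μ, κ, h2, h1, h3, h5, h4⟩
  disj_left P hP Q hQ h := c.disj_right _ hP _ hQ (Prod.swap_injective.ne h)
  disj_right P hP Q hQ h := c.disj_left _ hP _ hQ (Prod.swap_injective.ne h)
  cover_left y := by
    obtain ⟨P, hP, h⟩ := c.cover_right y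
    exact ⟨P.swap, by simpa using hP, h⟩
  cover_right y := by
    obtain ⟨P, hP, h⟩ := c.cover_left y
    exact ⟨P.swap, by simpa using hP, h⟩
  rel_left P hP z hz := c.rel_right _ hP _ hz
  rel_right P hP z hz := c.rel_left _ hP _ hz

/-- The second configuration subdivides the first one. -/
structure Refines (c d : Config S T) : Prop where
  rel : c.rel ⊆ d.rel
  faces : ∀ Q ∈ d.faces, ∃ P ∈ c.faces, Q.1 ⊆ P.1 ∧ Q.2 ⊆ P.2

lemma Refines.refl (c : Config S T) : c.Refines c :=
  ⟨subset_rfl, fun Q hQ => ⟨Q, hQ, subset_rfl, subset_rfl⟩⟩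

lemma Refines.trans {c d e : Config S T} (h : c.Refines d) (h' : d.Refines e) : c.Refines e := by
  refine ⟨h.rel.trans h'.rel, fun Q hQ => ?_⟩
  obtain ⟨P, hP, h1, h2⟩ := h'.faces Q hQ
  obtain ⟨P', hP', h1', h2'⟩ := h.faces P hP
  exact ⟨P', hP', h1.trans h1', h2.trans h2'⟩

lemma Refines.swap {c d : Config S T} (h : c.Refines d) : c.swap.Refines d.swap := by
  refine ⟨preimage_mono h.rel, fun Q hQ => ?_⟩
  obtain ⟨P, hP, h1, h2⟩ := h.faces _ hQ
  exact ⟨P.swap, by simpa [Config.swap] using hP, h2, h1⟩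

/-- The configuration given by one loop in each of the spheres. -/
lemma nonempty : Nonempty (Config S T) := by
  obtain ⟨κ, F, hκ, hF⟩ := exists_isLoop_isFace S
  obtain ⟨μ, G, hμ, hG⟩ := exists_isLoop_isFace T
  have cover : ∀ {X : Type} [MetricSpace X] [IsSph X] {ξ : ℝ → X} {H : Set X}, IsLoop ξ →
      IsFace (range ξ) H → ∀ x, x ∈ closure H ∨ x ∈ closure (range ξ ∪ H)ᶜ := by
    intro X _ _ ξ H hξ hH x
    by_cases hx : x ∈ range ξ
    · exact .inl (hH.subset_closure hξ.fine hx)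
    · exact (hH.compl_subset hx).imp (fun h => _root_.subset_closure h)
        (fun h => _root_.subset_closure h)
  refine ⟨⟨range fun t => (κ t, μ t), {(F, G), ((range κ ∪ F)ᶜ, (range μ ∪ G)ᶜ)}, by simp,
    ?_, ?_, ?_, ?_, ?_, ?_, ?_, ?_, ?_⟩⟩
  · rintro _ _ _ ⟨s, h⟩ ⟨t, h'⟩
    simp only [Prod.mk.injEq] at h h'
    rw [← h.2, ← h'.2, hμ.eq_iff, ← hκ.eq_iff, h.1, h'.1]
  · rintro _ _ _ ⟨s, h⟩ ⟨t, h'⟩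
    simp only [Prod.mk.injEq] at h h'
    rw [← h.1, ← h'.1, hκ.eq_iff, ← hμ.eq_iff, h.2, h'.2]
  · rintro _ (rfl | rfl)
    · exact ⟨κ, μ, hκ, hμ, fun t => ⟨t, rfl⟩, hF, hG⟩
    · exact ⟨κ, μ, hκ, hμ, fun t => ⟨t, rfl⟩, hF.compl, hG.compl⟩
  · rintro _ (rfl | rfl) _ (rfl | rfl) h
    · exact absurd rfl h
    · exact hF.disjoint_compl
    · exact hF.disjoint_compl.symm
    · exact absurd rfl h
  · rintro _ (rfl | rfl) _ (rfl | rfl) h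
    · exact absurd rfl h
    · exact hG.disjoint_compl
    · exact hG.disjoint_compl.symm
    · exact absurd rfl h
  · intro x
    rcases cover hκ hF x with h | h
    · exact ⟨_, .inl rfl, h⟩
    · exact ⟨_, .inr rfl, h⟩
  · intro x
    rcases cover hμ hG x with h | h
    · exact ⟨_, .inl rfl, h⟩
    · exact ⟨_, .inr rfl, h⟩
  · rintro _ (rfl | rfl) _ ⟨t, rfl⟩ h
    · exact hF.subset_compl h ⟨t, rfl⟩
    · exact h (.inl ⟨t, rfl⟩)
  · rintro _ (rfl | rfl) _ ⟨t, rfl⟩ h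
    · exact hG.subset_compl h ⟨t, rfl⟩
    · exact h (.inl ⟨t, rfl⟩)

/-- Subdivision of a face by a given crosscut. -/
lemma exists_refines_cross (c : Config S T) {P : Set S × Set T} (hP : P ∈ c.faces) {p q : S}
    (hp : p ∈ frontier P.1) (hq : q ∈ frontier P.1) (hpq : p ≠ q) {α : ℝ → S}
    (hα : IsCross P.1 p q α) : ∃ d : Config S T, c.Refines d ∧
      (∀ t ∈ Ioo (0 : ℝ) 1, ∃ y, (α t, y) ∈ d.rel) ∧
      ∀ Q ∈ d.faces, Q ∈ c.faces ∨ ∃ A ⊆ frontier P.1, IsClosed A ∧ IsPreconnected A ∧ p ∈ A ∧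
        q ∈ A ∧ IsFace (A ∪ α '' Icc 0 1) Q.1 ∧ Q.1 ⊆ P.1 \ α '' Icc 0 1 := by
  obtain ⟨F, F'⟩ := P
  obtain ⟨κ₀, μ₀, hκ₀, hμ₀, hR₀, hF₀, hF₀'⟩ := c.loops _ hP
  simp only at hF₀ hF₀' hp hq hα ⊢
  rw [hF₀.frontier_eq hκ₀.fine] at hp hq
  obtain ⟨a, rfl⟩ := hp
  obtain ⟨κ, μ, hκ, hμ, hR, hF, hF', hκ0, hfr⟩ : ∃ (κ : ℝ → S) (μ : ℝ → T), IsLoop κ ∧ IsLoop μ ∧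
      (∀ t, (κ t, μ t) ∈ c.rel) ∧ IsFace (range κ) F ∧ IsFace (range μ) F' ∧ κ 0 = κ₀ a ∧
      range κ₀ = range κ := by
    have e : ∀ {X : Type} (ξ : ℝ → X), range (fun t => ξ (a + t)) = range ξ := fun ξ =>
      (Equiv.addLeft a).surjective.range_comp ξ
    exact ⟨fun t => κ₀ (a + t), fun t => μ₀ (a + t), hκ₀.shift a, hμ₀.shift a, fun t => hR₀ _,
      by rwa [e], by rwa [e], by simp, (e κ₀).symm⟩
  rw [hfr] at hq
  rw [← hκ0] at hα hpq
  obtain ⟨s₀, rfl⟩ := hq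
  obtain ⟨s, hs, hss⟩ : ∃ s ∈ Ioo (0 : ℝ) 1, κ s = κ s₀ := by
    have h1 : κ (Int.fract s₀) = κ s₀ := (hκ.eq_iff _ _).2 ⟨⌊s₀⌋, (Int.fract_add_floor s₀).symm⟩
    refine ⟨Int.fract s₀, ⟨lt_of_le_of_ne (Int.fract_nonneg _) fun h => hpq ?_,
      Int.fract_lt_one _⟩, h1⟩
    rw [← h1, ← h]
  rw [← hss] at hα
  obtain ⟨α', hα'⟩ := hF'.exists_isCross hμ.fine ⟨0, rfl⟩ ⟨s, rfl⟩ (fun h => hpq (by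
    rw [← hss, hκ.eq_iff, ← hμ.eq_iff, h]))
  obtain ⟨hf, hg, G₁, G₂, hG₁, hG₂, hd, hu, hcl⟩ := hF.exists_cut hκ hs hα
  obtain ⟨hf', hg', G₁', G₂', hG₁', hG₂', hd', hu', hcl'⟩ := hF'.exists_cut hμ hs hα'
  have hs₁ : G₁ ⊆ F \ α '' Icc 0 1 := hu ▸ subset_union_left
  have hs₂ : G₂ ⊆ F \ α '' Icc 0 1 := hu ▸ subset_union_right
  have hs₁' : G₁' ⊆ F' \ α' '' Icc 0 1 := hu' ▸ subset_union_left
  have hs₂' : G₂' ⊆ F' \ α' '' Icc 0 1 := hu' ▸ subset_union_right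
  let R := c.rel ∪ (fun t => (α t, α' t)) '' Ioo (0 : ℝ) 1
  have hκR : ∀ t, (κ t, μ t) ∈ R := fun t => .inl (hR t)
  have hαR : ∀ t ∈ Icc (0 : ℝ) 1, (α t, α' t) ∈ R := by
    intro t ht
    rcases ht.1.eq_or_lt with rfl | h0
    · rw [hα.zero, hα'.zero]
      exact hκR 0
    rcases ht.2.eq_or_lt with rfl | h1
    · rw [hα.one, hα'.one]
      exact hκR s
    exact .inr ⟨t, ⟨h0, h1⟩, rfl⟩
  have hloop : ∀ (f : ℝ → S) (f' : ℝ → T), (∀ t, (f t, f' t) ∈ R) →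
      ∀ t, (arcLoop f α t, arcLoop f' α' t) ∈ R := by
    intro f f' h t
    have h0 := Int.fract_nonneg t
    have h1 := (Int.fract_lt_one t).le
    simp only [arcLoop]
    split_ifs with hh
    · exact h _
    · exact hαR _ ⟨by linarith, by linarith⟩
  have hF_of : ∀ Q ∈ c.faces \ {(F, F')}, Disjoint Q.1 F ∧ Disjoint Q.2 F' := fun Q hQ =>
    ⟨c.disj_left Q hQ.1 _ hP hQ.2, c.disj_right Q hQ.1 _ hP hQ.2⟩
  let d : Config S T :=
    { rel := R
      faces := c.faces \ {(F, F')} ∪ {(G₁, G₁'), (G₂, G₂')}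
      finite := (c.finite.subset sdiff_subset).union (by simp)
      inj_left := by
        rintro x y y' (h | ⟨t, ht, h⟩) (h' | ⟨t', ht', h'⟩)
        · exact c.inj_left h h'
        · rw [Prod.mk.injEq] at h'
          exact absurd (h'.1 ▸ hα.mem t' ht') (c.rel_left _ hP _ h)
        · rw [Prod.mk.injEq] at h
          exact absurd (h.1 ▸ hα.mem t ht) (c.rel_left _ hP _ h')
        · rw [Prod.mk.injEq] at h h'
          rw [← h.2, ← h'.2, hα.arc.inj (Ioo_subset_Icc_self ht) (Ioo_subset_Icc_self ht')
            (h.1.trans h'.1.symm)]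
      inj_right := by
        rintro x y y' (h | ⟨t, ht, h⟩) (h' | ⟨t', ht', h'⟩)
        · exact c.inj_right h h'
        · rw [Prod.mk.injEq] at h'
          exact absurd (h'.2 ▸ hα'.mem t' ht') (c.rel_right _ hP _ h)
        · rw [Prod.mk.injEq] at h
          exact absurd (h.2 ▸ hα'.mem t ht) (c.rel_right _ hP _ h')
        · rw [Prod.mk.injEq] at h h'
          rw [← h.1, ← h'.1, hα'.arc.inj (Ioo_subset_Icc_self ht) (Ioo_subset_Icc_self ht')
            (h.2.trans h'.2.symm)]
      loops := by
        rintro Q (hQ | rfl | rfl)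
        · obtain ⟨κ, μ, h1, h2, h3, h4, h5⟩ := c.loops _ hQ.1
          exact ⟨κ, μ, h1, h2, fun t => .inl (h3 t), h4, h5⟩
        · exact ⟨_, _, hf.isLoop, hf'.isLoop, hloop _ _ fun t => hκR _, hG₁, hG₁'⟩
        · exact ⟨_, _, hg.isLoop, hg'.isLoop, hloop _ _ fun t => hκR _, hG₂, hG₂'⟩
      disj_left := by
        rintro Q (hQ | rfl | rfl) Q' (hQ' | rfl | rfl) hne
        · exact c.disj_left _ hQ.1 _ hQ'.1 hne
        · exact (hF_of Q hQ).1.mono_right (hs₁.trans sdiff_subset)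
        · exact (hF_of Q hQ).1.mono_right (hs₂.trans sdiff_subset)
        · exact ((hF_of Q' hQ').1.mono_right (hs₁.trans sdiff_subset)).symm
        · exact absurd rfl hne
        · exact hd
        · exact ((hF_of Q' hQ').1.mono_right (hs₂.trans sdiff_subset)).symm
        · exact hd.symm
        · exact absurd rfl hne
      disj_right := by
        rintro Q (hQ | rfl | rfl) Q' (hQ' | rfl | rfl) hne
        · exact c.disj_right _ hQ.1 _ hQ'.1 hne
        · exact (hF_of Q hQ).2.mono_right (hs₁'.trans sdiff_subset)
        · exact (hF_of Q hQ).2.mono_right (hs₂'.trans sdiff_subset)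
        · exact ((hF_of Q' hQ').2.mono_right (hs₁'.trans sdiff_subset)).symm
        · exact absurd rfl hne
        · exact hd'
        · exact ((hF_of Q' hQ').2.mono_right (hs₂'.trans sdiff_subset)).symm
        · exact hd'.symm
        · exact absurd rfl hne
      cover_left := by
        intro x
        obtain ⟨Q, hQ, hx⟩ := c.cover_left x
        by_cases h : Q = (F, F')
        · subst h
          rcases hcl hx with h | h
          · exact ⟨_, .inr (.inl rfl), h⟩
          · exact ⟨_, .inr (.inr rfl), h⟩
        · exact ⟨Q, .inl ⟨hQ, h⟩, hx⟩
      cover_right := by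
        intro x
        obtain ⟨Q, hQ, hx⟩ := c.cover_right x
        by_cases h : Q = (F, F')
        · subst h
          rcases hcl' hx with h | h
          · exact ⟨_, .inr (.inl rfl), h⟩
          · exact ⟨_, .inr (.inr rfl), h⟩
        · exact ⟨Q, .inl ⟨hQ, h⟩, hx⟩
      rel_left := by
        rintro Q (hQ | rfl | rfl) z (hz | ⟨t, ht, rfl⟩) h
        · exact c.rel_left _ hQ.1 _ hz h
        · exact (hF_of Q hQ).1.notMem_of_mem_left h (hα.mem t ht)
        · exact c.rel_left _ hP _ hz (hs₁ h).1
        · exact (hs₁ h).2 ⟨t, Ioo_subset_Icc_self ht, rfl⟩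
        · exact c.rel_left _ hP _ hz (hs₂ h).1
        · exact (hs₂ h).2 ⟨t, Ioo_subset_Icc_self ht, rfl⟩
      rel_right := by
        rintro Q (hQ | rfl | rfl) z (hz | ⟨t, ht, rfl⟩) h
        · exact c.rel_right _ hQ.1 _ hz h
        · exact (hF_of Q hQ).2.notMem_of_mem_left h (hα'.mem t ht)
        · exact c.rel_right _ hP _ hz (hs₁' h).1
        · exact (hs₁' h).2 ⟨t, Ioo_subset_Icc_self ht, rfl⟩
        · exact c.rel_right _ hP _ hz (hs₂' h).1
        · exact (hs₂' h).2 ⟨t, Ioo_subset_Icc_self ht, rfl⟩ }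
  have hκ1 : κ 1 = κ 0 := by simpa using hκ.add_one 0
  refine ⟨d, ⟨subset_union_left, ?_⟩, fun t ht => ⟨α' t, .inr ⟨t, ht, rfl⟩⟩, ?_⟩
  · rintro Q (hQ | rfl | rfl)
    · exact ⟨Q, hQ.1, subset_rfl, subset_rfl⟩
    · exact ⟨_, hP, hs₁.trans sdiff_subset, hs₁'.trans sdiff_subset⟩
    · exact ⟨_, hP, hs₂.trans sdiff_subset, hs₂'.trans sdiff_subset⟩
  · rw [hF.frontier_eq hκ.fine, ← hκ0, ← hss]
    rintro Q (hQ | rfl | rfl)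
    · exact .inl hQ.1
    · refine .inr ⟨_, ?_, hf.left.isClosed, hf.left.conn, ⟨0, by simp⟩, ⟨1, by simp⟩,
        hf.range_arcLoop ▸ hG₁, hs₁⟩
      rintro _ ⟨t, -, rfl⟩
      exact ⟨_, rfl⟩
    · refine .inr ⟨_, ?_, hg.left.isClosed, hg.left.conn, ⟨0, by simp [hκ1]⟩, ⟨1, by simp⟩,
        hg.range_arcLoop ▸ hG₂, hs₂⟩
      rintro _ ⟨t, -, rfl⟩
      exact ⟨_, rfl⟩

end Config

end CubicalChain

namespace CubicalChain

open Set Topology unitInterval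

section Prelim

variable {S : Type} [TopologicalSpace S] [IsSph S]

lemma IsLoop.joinedIn_image {κ : ℝ → S} (h : IsLoop κ) {O : Set ℝ} (hO : O.OrdConnected) {s t : ℝ}
    (hs : s ∈ O) (ht : t ∈ O) : JoinedIn (κ '' O) (κ s) (κ t) := by
  have hm : ∀ r ∈ Icc (0 : ℝ) 1, (1 - r) * s + r * t ∈ uIcc s t := by
    intro r hr
    rw [← segment_eq_uIcc]
    exact ⟨1 - r, r, by linarith [hr.2], hr.1, by ring, rfl⟩
  refine JoinedIn.ofLine (f := fun r => κ ((1 - r) * s + r * t))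
    (h.cont.comp (by fun_prop)).continuousOn (by simp) (by simp) ?_
  rintro _ ⟨r, hr, rfl⟩
  exact ⟨_, hO.uIcc_subset hs ht (hm r hr), rfl⟩

lemma IsLoop.joinedIn_range {κ : ℝ → S} (h : IsLoop κ) (s t : ℝ) :
    JoinedIn (range κ) (κ s) (κ t) := by
  have := h.joinedIn_image ordConnected_univ (mem_univ s) (mem_univ t)
  rwa [image_univ] at this

lemma IsLoop.exists_Ioo {κ : ℝ → S} (h : IsLoop κ) {a s : ℝ} (hs : κ s ≠ κ a) :
    ∃ s' ∈ Ioo a (a + 1), κ s' = κ s := by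
  have h1 : κ (a + Int.fract (s - a)) = κ s :=
    (h.eq_iff _ _).2 ⟨⌊s - a⌋, by linarith [Int.fract_add_floor (s - a)]⟩
  refine ⟨a + Int.fract (s - a), ⟨?_, by linarith [Int.fract_lt_one (s - a)]⟩, h1⟩
  refine lt_of_le_of_ne (by linarith [Int.fract_nonneg (s - a)]) fun h2 => hs ?_
  rw [← h1, ← h2]

lemma IsLoop.eq_of_Ioo {κ : ℝ → S} (h : IsLoop κ) {a s t : ℝ} (hs : s ∈ Ioo a (a + 1))
    (ht : t ∈ Ioo a (a + 1)) (hst : κ s = κ t) : s = t := by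
  obtain ⟨n, hn⟩ := (h.eq_iff s t).1 hst
  have h1 : (n : ℝ) < 1 := by linarith [hs.1, ht.2]
  have h2 : (-1 : ℝ) < n := by linarith [hs.2, ht.1]
  have h3 : n = 0 := by
    have h1' : n < 1 := by exact_mod_cast h1
    have h2' : -1 < n := by exact_mod_cast h2
    omega
  rw [hn, h3]; simp

/-- A loop is not disconnected by the removal of a point. -/
lemma IsLoop.joinedIn_sdiff {κ : ℝ → S} (h : IsLoop κ) {s t : ℝ} {p : S} (hs : κ s ≠ p)
    (ht : κ t ≠ p) : JoinedIn (range κ \ {p}) (κ s) (κ t) := by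
  by_cases hp : p ∈ range κ
  · obtain ⟨a, rfl⟩ := hp
    obtain ⟨s', hs', h1⟩ := h.exists_Ioo hs
    obtain ⟨t', ht', h2⟩ := h.exists_Ioo ht
    rw [← h1, ← h2]
    refine (h.joinedIn_image ordConnected_Ioo hs' ht').mono ?_
    rintro _ ⟨r, hr, rfl⟩
    refine ⟨⟨r, rfl⟩, fun h3 => ?_⟩
    obtain ⟨n, hn⟩ := (h.eq_iff a r).1 (Eq.symm h3)
    have h4 : (0 : ℝ) < n := by linarith [hr.1]
    have h5 : (n : ℝ) < 1 := by linarith [hr.2]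
    have h4' : 0 < n := by exact_mod_cast h4
    have h5' : n < 1 := by exact_mod_cast h5
    omega
  · rw [sdiff_singleton_eq_self hp]
    exact h.joinedIn_range s t

lemma IsFace.closure_subset {C F : Set S} (h : IsFace C F) : closure F ⊆ C ∪ F :=
  closure_minimal subset_union_right (isOpen_compl_iff.1 h.isOpen_compl)

/-- Closed sets which do not separate two points and meet only in a connected set. -/
lemma joinedIn_compl_biUnion {ι : Type} {s : Set ι} (hs : s.Finite) {C : Set S} (hC : IsClosed C)
    (hconn : IsPreconnected C) {A : ι → Set S} (hA : ∀ i ∈ s, IsClosed (A i))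
    (hd : ∀ i ∈ s, ∀ j ∈ s, i ≠ j → A i ∩ A j ⊆ C) {x y : S} (h0 : JoinedIn Cᶜ x y)
    (h : ∀ i ∈ s, JoinedIn (C ∪ A i)ᶜ x y) : JoinedIn (C ∪ ⋃ i ∈ s, A i)ᶜ x y := by
  induction s, hs using Set.Finite.induction_on with
  | empty => simpa using h0
  | @insert i s his hs ih =>
    have hms : ∀ j ∈ s, j ∈ insert i s := fun j hj => .inr hj
    have hmi : i ∈ insert i s := .inl rfl
    have h1 := jan (hC.union (hs.isClosed_biUnion fun j hj => hA j (hms j hj)))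
      (hC.union (hA i hmi)) ?_
      (ih (fun j hj => hA j (hms j hj)) (fun j hj k hk => hd j (hms j hj) k (hms k hk))
        fun j hj => h j (hms j hj)) (h i hmi)
    · refine h1.mono (compl_subset_compl.2 ?_)
      rw [biUnion_insert]
      rintro z (hz | hz | hz)
      · exact .inl (.inl hz)
      · exact .inr (.inr hz)
      · exact .inl (.inr hz)
    · rw [← union_inter_distrib_left, union_eq_left.2]
      · exact hconn
      rintro z ⟨hz, hzi⟩
      obtain ⟨j, hj, hzj⟩ := mem_iUnion₂.1 hz
      exact hd j (hms j hj) i hmi (fun h => his (h ▸ hj)) ⟨hzj, hzi⟩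

end Prelim

variable {S T : Type} [MetricSpace S] [IsSph S] [MetricSpace T] [IsSph T] {D D' : Set S} {κ : ℝ → S}

/-- The parameter interval runs along a component of the part of the curve inside the set. -/
structure IsGap (κ : ℝ → S) (F : Set S) (e : ℝ × ℝ) : Prop where
  lt : e.1 < e.2
  subset : κ '' Ioo e.1 e.2 ⊆ F
  left : κ e.1 ∉ F
  right : κ e.2 ∉ F

namespace IsGap

variable {F C : Set S} {e e' : ℝ × ℝ}

lemma eq_of_mem (h : IsGap κ F e) (h' : IsGap κ F e') {t : ℝ} (ht : t ∈ Ioo e.1 e.2)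
    (ht' : t ∈ Ioo e'.1 e'.2) : e = e' := by
  have key : ∀ {s : ℝ}, κ s ∉ F → s ∉ Ioo e.1 e.2 ∧ s ∉ Ioo e'.1 e'.2 := fun hs =>
    ⟨fun h1 => hs (h.subset ⟨_, h1, rfl⟩), fun h1 => hs (h'.subset ⟨_, h1, rfl⟩)⟩
  have h1 := (key h.left).2
  have h2 := (key h.right).2
  have h3 := (key h'.left).1
  have h4 := (key h'.right).1
  simp only [mem_Ioo, not_and, not_lt] at *
  refine Prod.ext (le_antisymm ?_ ?_) (le_antisymm ?_ ?_) <;> by_contra! hc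
  · linarith [h3 |> fun _ => h1 hc]
  · linarith [h3 hc]
  · linarith [h4 (by linarith)]
  · linarith [h2 (by linarith)]

lemma closure_subset (h : IsGap κ F e) (hκ : IsLoop κ) : κ '' Icc e.1 e.2 ⊆ closure F := by
  rw [← closure_Ioo h.lt.ne]
  exact (image_closure_subset_closure_image hκ.cont).trans (closure_mono h.subset)

lemma mem_Ioo (h : IsGap κ F e) {t : ℝ} (ht : t ∈ Icc e.1 e.2) (htF : κ t ∈ F) :
    t ∈ Ioo e.1 e.2 :=
  ⟨lt_of_le_of_ne ht.1 fun h' => h.left (h' ▸ htF), lt_of_le_of_ne ht.2 fun h' => h.right (h' ▸ htF)⟩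

lemma mem (h : IsGap κ F e) (hκ : IsLoop κ) (hF : IsFace C F) {t : ℝ} (ht : t ∈ Icc e.1 e.2)
    (htF : κ t ∉ F) : κ t ∈ C :=
  (hF.closure_subset (h.closure_subset hκ ⟨t, ht, rfl⟩)).resolve_right htF

lemma le_add_one (h : IsGap κ F e) (hκ : IsLoop κ) : e.2 ≤ e.1 + 1 := by
  by_contra! hc
  exact h.left (hκ.add_one e.1 ▸ h.subset ⟨e.1 + 1, ⟨by linarith, hc⟩, rfl⟩)

end IsGap

lemma exists_isGap {F : Set S} (hκ : IsLoop κ) (hF : IsOpen F) {l r t : ℝ} (hl : κ l ∉ F)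
    (hr : κ r ∉ F) (ht : t ∈ Icc l r) (htF : κ t ∈ F) :
    ∃ e, IsGap κ F e ∧ t ∈ Ioo e.1 e.2 ∧ l ≤ e.1 ∧ e.2 ≤ r := by
  have hcl : IsClosed (κ ⁻¹' Fᶜ) := hF.isClosed_compl.preimage hκ.cont
  obtain ⟨a, ⟨ha1, ha2⟩, ha3⟩ := ((isCompact_Icc (a := l) (b := t)).inter_right hcl).exists_isGreatest
    ⟨l, ⟨le_rfl, ht.1⟩, hl⟩
  obtain ⟨b, ⟨hb1, hb2⟩, hb3⟩ := ((isCompact_Icc (a := t) (b := r)).inter_right hcl).exists_isLeast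
    ⟨r, ⟨ht.2, le_rfl⟩, hr⟩
  have hat : a < t := lt_of_le_of_ne ha1.2 fun h => ha2 (h ▸ htF)
  have htb : t < b := lt_of_le_of_ne hb1.1 fun h => hb2 (h ▸ htF)
  refine ⟨(a, b), ⟨hat.trans htb, ?_, ha2, hb2⟩, ⟨hat, htb⟩, ha1.1, hb1.2⟩
  rintro _ ⟨s, hs, rfl⟩
  by_contra hn
  rcases le_total s t with h | h
  · exact absurd (ha3 ⟨⟨ha1.1.trans hs.1.le, h⟩, hn⟩) (not_le.2 hs.1)
  · exact absurd (hb3 ⟨⟨h, hs.2.le.trans hb1.2⟩, hn⟩) (not_le.2 hs.2)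

/-- A face which meets the disc and the complement of the outer disc and is bounded by a loop with
the same property. -/
structure Crosses (D D' : Set S) (ξ : ℝ → S) (F : Set S) : Prop where
  isLoop : IsLoop ξ
  isFace : IsFace (range ξ) F
  inner : ∃ s, ξ s ∈ D
  outer : ∃ t, ξ t ∉ D'

lemma crosses_of_mem (hs : Shell D D' κ) (c : Config S T) (hD : ∃ z ∈ c.rel, z.1 ∈ D)
    (hD' : ∃ z ∈ c.rel, z.1 ∉ D') {P : Set S × Set T} (hP : P ∈ c.faces) {x y : S} (hx : x ∈ P.1)
    (hxD : x ∈ D) (hy : y ∈ P.1) (hyD : y ∉ D') : ∃ ξ, Crosses D D' ξ P.1 := by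
  obtain ⟨ξ, μ, h1, h2, h3, h4, h5⟩ := c.loops _ hP
  refine ⟨ξ, h1, h4, ?_, ?_⟩
  · by_contra! hn
    obtain ⟨z, hz, hzD⟩ := hD
    refine c.rel_left _ hP z hz (h4.mem_of_joinedIn hx ((hs.joined x hxD _ hzD).mono ?_))
    rintro w hw ⟨t, rfl⟩
    exact hn t hw
  · by_contra! hn
    obtain ⟨z, hz, hzD⟩ := hD'
    refine c.rel_left _ hP z hz (h4.mem_of_joinedIn hy ((hs.nonSep_outer hyD hzD).mono ?_))
    rintro w hw ⟨t, rfl⟩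
    exact hw (hn t)

namespace Crosses

variable {ξ : ℝ → S} {F : Set S}

lemma exists_mem_ne (h : Crosses D D' ξ F) (hs : Shell D D' κ) (p : S) (hp : p ∈ range κ) :
    ∃ t, κ t ∈ range ξ ∧ κ t ≠ p := by
  obtain ⟨s, hsD⟩ := h.inner
  obtain ⟨t, htD⟩ := h.outer
  have h1 : ξ s ≠ p := fun h' => (hs.subset hp).2 (h' ▸ hsD)
  have h2 : ξ t ≠ p := fun h' => htD (h' ▸ interior_subset (hs.subset hp).1)
  by_contra! hn
  refine hs.sep _ hsD _ htD ((h.isLoop.joinedIn_sdiff h1 h2).mono ?_)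
  rintro z ⟨hz, hzp⟩ ⟨r, rfl⟩
  exact hzp (hn r hz)

lemma lt_add_one (h : Crosses D D' ξ F) (hs : Shell D D' κ) {e : ℝ × ℝ} (he : IsGap κ F e) :
    e.2 < e.1 + 1 := by
  refine lt_of_le_of_ne (he.le_add_one hs.isLoop) fun h' => ?_
  obtain ⟨t, ht, hne⟩ := h.exists_mem_ne hs (κ e.1) ⟨_, rfl⟩
  obtain ⟨t', ht', htt⟩ := hs.isLoop.exists_Ioo hne
  exact h.isFace.subset_compl (he.subset ⟨t', h' ▸ ht', rfl⟩) (htt ▸ ht)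

/-- Short gaps do not separate. -/
lemma exists_short (h : Crosses D D' ξ F) (hs : Shell D D' κ) (t₀ : ℝ) : ∃ ε > 0, ∀ e,
    IsGap κ F e → Icc e.1 e.2 ⊆ Metric.ball t₀ ε → ∀ x ∈ F ∩ D, ∀ y ∈ F \ D',
      JoinedIn (range ξ ∪ κ '' Icc e.1 e.2)ᶜ x y := by
  have hcont := hs.isLoop.cont
  have hex : ∀ V : Set S, IsOpen V → κ t₀ ∈ V → ∃ ε > 0, Metric.ball t₀ ε ⊆ κ ⁻¹' V :=
    fun V hV h0 => Metric.mem_nhds_iff.1 (hcont.continuousAt.preimage_mem_nhds (hV.mem_nhds h0))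
  by_cases ht : κ t₀ ∈ range ξ
  · obtain ⟨τ, hτ⟩ := ht
    obtain ⟨N₀, N, ν, hN, hN0, hN1, hN2⟩ := exists_shell (κ t₀) (U := interior D' \ D)
      (isOpen_interior.sdiff hs.isClosed) (hs.subset ⟨t₀, rfl⟩)
    obtain ⟨δ, hδ, hA, hB, hC⟩ := h.isLoop.exists_small τ isOpen_interior
      (hτ ▸ interior_mono hN1 hN0)
    obtain ⟨ε, hε, hball⟩ := hex (interior N \ ξ '' Icc (τ + δ) (τ + 1 - δ))
      (isOpen_interior.sdiff (isClosed_image_Icc h.isLoop.cont.continuousOn))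
      ⟨interior_mono hN1 hN0, hτ ▸ hB⟩
    refine ⟨ε, hε, fun e he hsub x hx y hy => ?_⟩
    have hγ : κ '' Icc e.1 e.2 ⊆ interior N \ ξ '' Icc (τ + δ) (τ + 1 - δ) := by
      rintro _ ⟨t, ht, rfl⟩
      exact hball (hsub ht)
    have hL : ξ '' Icc (τ - δ) (τ + δ) ∪ κ '' Icc e.1 e.2 ⊆ N :=
      union_subset (hA.trans interior_subset) ((hγ.trans sdiff_subset).trans interior_subset)
    have h1 := jan h.isFace.isClosed (L := ξ '' Icc (τ - δ) (τ + δ) ∪ κ '' Icc e.1 e.2)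
      ((isClosed_image_Icc h.isLoop.cont.continuousOn).union
        (isClosed_image_Icc hcont.continuousOn)) ?_ (h.isFace.joined hx.1 hy.1)
      ((hN.nonSep_outer (fun hh => (hN2 hh).2 hx.2)
        (fun hh => hy.2 (interior_subset (hN2 hh).1))).mono (compl_subset_compl.2 hL))
    · exact h1.mono (compl_subset_compl.2 (union_subset_union_right _ subset_union_right))
    · rw [show range ξ ∩ (ξ '' Icc (τ - δ) (τ + δ) ∪ κ '' Icc e.1 e.2) =
        ξ '' Icc (τ - δ) (τ + δ) from ?_]
      · exact isPreconnected_Icc.image _ h.isLoop.cont.continuousOn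
      · refine Subset.antisymm ?_ (subset_inter (image_subset_range _ _) subset_union_left)
        rintro z ⟨hz, hz' | hz'⟩
        · exact hz'
        · rw [hC] at hz
          exact hz.resolve_right (hγ hz').2
  · obtain ⟨ε, hε, hball⟩ := hex _ h.isFace.isClosed.isOpen_compl ht
    refine ⟨ε, hε, fun e he hsub => ?_⟩
    have hm : e.1 ∈ Icc e.1 e.2 := ⟨le_rfl, he.lt.le⟩
    exact absurd (he.mem hs.isLoop h.isFace hm he.left) (hball (hsub hm))

/-- The gaps which separate are finite in number. -/
lemma finite_gaps (h : Crosses D D' ξ F) (hs : Shell D D' κ) : {e : ℝ × ℝ | e.1 ∈ Icc (0 : ℝ) 2 ∧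
    IsGap κ F e ∧ ∃ x ∈ F ∩ D, ∃ y ∈ F \ D', ¬ JoinedIn (range ξ ∪ κ '' Icc e.1 e.2)ᶜ x y}.Finite := by
  choose ε hε hshort using h.exists_short hs
  obtain ⟨η, hη, hleb⟩ := lebesgue_number_lemma_of_metric (isCompact_Icc (a := (0 : ℝ)) (b := 2))
    (c := fun t => Metric.ball t (ε t)) (fun _ => Metric.isOpen_ball)
    (fun t _ => mem_iUnion.2 ⟨t, Metric.mem_ball_self (hε t)⟩)
  have hlong : ∀ e : ℝ × ℝ, e.1 ∈ Icc (0 : ℝ) 2 → IsGap κ F e → (∃ x ∈ F ∩ D, ∃ y ∈ F \ D',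
      ¬ JoinedIn (range ξ ∪ κ '' Icc e.1 e.2)ᶜ x y) → η ≤ e.2 - e.1 := by
    rintro e he hg ⟨x, hx, y, hy, hn⟩
    by_contra! hlt
    obtain ⟨t, ht⟩ := hleb e.1 he
    refine hn (hshort t e hg (fun s hs => ht ?_) x hx y hy)
    rw [Metric.mem_ball, Real.dist_eq, abs_of_nonneg (by linarith [hs.1])]
    linarith [hs.2]
  refine Set.Finite.of_injOn (f := fun e => ⌊e.1 / η⌋) (t := Icc 0 ⌊2 / η⌋) ?_ ?_ (finite_Icc _ _)
  · rintro e ⟨he, -⟩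
    exact ⟨Int.floor_nonneg.2 (div_nonneg he.1 hη.le), Int.floor_le_floor (by gcongr; exact he.2)⟩
  · rintro e ⟨he, hg, hx⟩ e' ⟨he', hg', hx'⟩ hfl
    have h1 := Int.abs_sub_lt_one_of_floor_eq_floor hfl
    rw [← sub_div, abs_div, abs_of_pos hη, div_lt_one hη, abs_lt] at h1
    have h2 := hlong e he hg hx
    have h3 := hlong e' he' hg' hx'
    rcases le_total e.1 e'.1 with h4 | h4
    · obtain ⟨t, ht1, ht2⟩ := exists_between (a₁ := e'.1) (a₂ := min e.2 e'.2)
        (lt_min (by linarith) hg'.lt)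
      exact hg.eq_of_mem hg' ⟨h4.trans_lt ht1, ht2.trans_le (min_le_left _ _)⟩
        ⟨ht1, ht2.trans_le (min_le_right _ _)⟩
    · obtain ⟨t, ht1, ht2⟩ := exists_between (a₁ := e.1) (a₂ := min e.2 e'.2)
        (lt_min hg.lt (by linarith))
      exact hg.eq_of_mem hg' ⟨ht1, ht2.trans_le (min_le_left _ _)⟩
        ⟨h4.trans_lt ht1, ht2.trans_le (min_le_right _ _)⟩

/-- Some gap separates. -/
lemma exists_gap (h : Crosses D D' ξ F) (hs : Shell D D' κ) {x y : S} (hx : x ∈ F ∩ D)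
    (hy : y ∈ F \ D') : ∃ e : ℝ × ℝ, e.1 ∈ Icc (0 : ℝ) 2 ∧ IsGap κ F e ∧
      ¬ JoinedIn (range ξ ∪ κ '' Icc e.1 e.2)ᶜ x y := by
  by_contra! hn
  have hκ := hs.isLoop
  have hξc := h.isFace.isClosed
  obtain ⟨a, ha0, ha⟩ : ∃ a ∈ Icc (0 : ℝ) 1, κ a ∈ range ξ := by
    obtain ⟨t, ht, -⟩ := h.exists_mem_ne hs (κ 0) ⟨0, rfl⟩
    exact ⟨Int.fract t, ⟨Int.fract_nonneg t, (Int.fract_lt_one t).le⟩, by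
      rwa [(hκ.eq_iff (Int.fract t) t).2 ⟨⌊t⌋, (Int.fract_add_floor t).symm⟩]⟩
  have haF : κ a ∉ F := fun h' => h.isFace.subset_compl h' ha
  have haF' : κ (a + 1) ∉ F := by rwa [hκ.add_one]
  have hIoo : ∀ t ∈ Icc a (a + 1), κ t ∈ F → t ∈ Ioo a (a + 1) := fun t ht htF =>
    ⟨lt_of_le_of_ne ht.1 fun h' => haF (h' ▸ htF), lt_of_le_of_ne ht.2 fun h' => haF' (h' ▸ htF)⟩
  obtain ⟨γ, hγ⟩ := h.isFace.joinedIn hx.1 hy.1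
  have hM : IsCompact (Icc a (a + 1) ∩ κ ⁻¹' range γ) :=
    isCompact_Icc.inter_right ((isCompact_range γ.continuous).isClosed.preimage hκ.cont)
  obtain ⟨s, hsI, hsf, hsM⟩ := hM.elim_finite_subcover_image
    (b := {e | IsGap κ F e ∧ a ≤ e.1 ∧ e.2 ≤ a + 1}) (c := fun e => Ioo e.1 e.2)
    (fun _ _ => isOpen_Ioo) (by
      rintro t ⟨ht, ⟨r, hr⟩⟩
      obtain ⟨e, he, hte, h1, h2⟩ := exists_isGap hκ h.isFace.isOpen haF haF' ht (hr ▸ hγ r)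
      exact mem_biUnion (show e ∈ {e | IsGap κ F e ∧ a ≤ e.1 ∧ e.2 ≤ a + 1} from ⟨he, h1, h2⟩) hte)
  have hK : IsClosed (range ξ ∪ ⋃ e ∈ s, κ '' Icc e.1 e.2) :=
    hξc.union (hsf.isClosed_biUnion fun e _ => isClosed_image_Icc hκ.cont.continuousOn)
  have hconn : IsPreconnected (range ξ) := isPreconnected_range h.isLoop.cont
  have hjoin : JoinedIn (range ξ ∪ ⋃ e ∈ s, κ '' Icc e.1 e.2)ᶜ x y := by
    refine joinedIn_compl_biUnion hsf hξc hconn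
      (fun e _ => isClosed_image_Icc hκ.cont.continuousOn) ?_ (h.isFace.joined hx.1 hy.1) ?_
    · rintro e he e' he' hne _ ⟨⟨t, ht, rfl⟩, ⟨t', ht', htt⟩⟩
      obtain ⟨hg, hle, hge⟩ := hsI he
      obtain ⟨hg', hle', hge'⟩ := hsI he'
      by_contra hnot
      have htF : κ t ∈ F := by
        by_contra htF
        exact hnot (hg.mem hκ h.isFace ht htF)
      have e1 := hIoo t ⟨hle.trans ht.1, ht.2.trans hge⟩ htF
      have e2 := hIoo t' ⟨hle'.trans ht'.1, ht'.2.trans hge'⟩ (htt ▸ htF)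
      have e3 := hκ.eq_of_Ioo e2 e1 htt
      subst e3
      exact hne (hg.eq_of_mem hg' (hg.mem_Ioo ht htF) (hg'.mem_Ioo ht' htF))
    · intro e he
      obtain ⟨hg, hle, hge⟩ := hsI he
      exact hn e ⟨by linarith [ha0.1], by linarith [ha0.2, hg.lt]⟩ hg
  have hR : IsClosed (κ '' (Icc a (a + 1) \ ⋃ e ∈ s, Ioo e.1 e.2)) :=
    ((isCompact_Icc.diff (isOpen_biUnion fun _ _ => isOpen_Ioo)).image hκ.cont).isClosed
  have hfin := jan hK (hξc.union hR) ?_ hjoin ?_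
  · refine hs.sep _ hx.2 _ hy.2 (hfin.mono (compl_subset_compl.2 ?_))
    rw [hκ.range_eq a]
    rintro _ ⟨t, ht, rfl⟩
    by_cases h' : t ∈ ⋃ e ∈ s, Ioo e.1 e.2
    · obtain ⟨e, he, hte⟩ := mem_iUnion₂.1 h'
      exact .inl (.inr (mem_biUnion he ⟨t, Ioo_subset_Icc_self hte, rfl⟩))
    · exact .inr (.inr ⟨t, ⟨ht, h'⟩, rfl⟩)
  · rw [← union_inter_distrib_left, union_eq_left.2]
    · exact hconn
    rintro _ ⟨hz, ⟨t, ht, rfl⟩⟩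
    obtain ⟨e', he', ⟨t', ht', htt⟩⟩ := mem_iUnion₂.1 hz
    obtain ⟨hg', hle', hge'⟩ := hsI he'
    by_contra hnot
    have htF : κ t' ∈ F := by
      by_contra htF
      exact hnot (htt ▸ hg'.mem hκ h.isFace ht' htF)
    have e1 := hIoo t ht.1 (htt ▸ htF)
    have e2 := hIoo t' ⟨hle'.trans ht'.1, ht'.2.trans hge'⟩ htF
    have e3 := hκ.eq_of_Ioo e2 e1 htt
    subst e3
    exact ht.2 (mem_biUnion he' (hg'.mem_Ioo ht' htF))
  · refine ⟨γ, fun r => ?_⟩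
    rintro (hz | ⟨t, ht, hz⟩)
    · exact h.isFace.subset_compl (hγ r) hz
    · exact ht.2 (hsM ⟨ht.1, ⟨r, hz.symm⟩⟩)

end Crosses

end CubicalChain

namespace CubicalChain

open Set Topology unitInterval

section Gap

variable {S : Type} [MetricSpace S] [IsSph S] {κ : ℝ → S} {A C F G : Set S} {e e' : ℝ × ℝ}

lemma IsGap.notMem_of_cut (hκ : IsLoop κ) (he : IsGap κ F e)
    (hG : IsFace (A ∪ κ '' Icc e.1 e.2) G) (hGF : G ⊆ F \ κ '' Icc e.1 e.2) (hA : Disjoint A F)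
    (he' : IsGap κ G e') {t : ℝ} (ht : t ∈ Icc e'.1 e'.2) (htG : κ t ∉ G) : κ t ∉ F := by
  intro htF
  rcases he'.mem hκ hG ht htG with h | ⟨s, hs, hst⟩
  · exact hA.notMem_of_mem_left h htF
  · have hs' := he.mem_Ioo hs (hst ▸ htF)
    obtain ⟨n, hn⟩ := (hκ.eq_iff s t).1 hst
    have hcl : t ∈ closure (Ioo e'.1 e'.2) := by rwa [closure_Ioo he'.lt.ne]
    have ho : IsOpen ((fun r : ℝ => r + (s - t)) ⁻¹' Ioo e.1 e.2) :=
      isOpen_Ioo.preimage (by fun_prop)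
    obtain ⟨r, hr, hr'⟩ := mem_closure_iff.1 hcl _ ho (by simpa only [mem_preimage, add_sub_cancel] using hs')
    refine (hGF (he'.subset ⟨r, hr', rfl⟩)).2 ⟨r + (s - t), Ioo_subset_Icc_self hr, ?_⟩
    rw [hκ.eq_iff]
    exact ⟨n, by linarith⟩

lemma IsGap.of_cut (hκ : IsLoop κ) (he : IsGap κ F e)
    (hG : IsFace (A ∪ κ '' Icc e.1 e.2) G) (hGF : G ⊆ F \ κ '' Icc e.1 e.2) (hA : Disjoint A F)
    (he' : IsGap κ G e') : IsGap κ F e' where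
  lt := he'.lt
  subset := he'.subset.trans fun _ hx => (hGF hx).1
  left := he.notMem_of_cut hκ hG hGF hA he' (left_mem_Icc.2 he'.lt.le) he'.left
  right := he.notMem_of_cut hκ hG hGF hA he' (right_mem_Icc.2 he'.lt.le) he'.right

lemma IsGap.joinedIn_of_cut (hκ : IsLoop κ) (he : IsGap κ F e) (hC : IsFace C F)
    (hG : IsFace (A ∪ κ '' Icc e.1 e.2) G) (hGF : G ⊆ F \ κ '' Icc e.1 e.2) (hAC : A ⊆ C)
    (hAc : IsClosed A) (hAp : IsPreconnected A) (hp : κ e.1 ∈ A) (hq : κ e.2 ∈ A)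
    (he' : IsGap κ G e') {x y : S} (hx : x ∈ G) (hy : y ∈ G)
    (hxy : JoinedIn (C ∪ κ '' Icc e'.1 e'.2)ᶜ x y) :
    JoinedIn (frontier G ∪ κ '' Icc e'.1 e'.2)ᶜ x y := by
  have hA : Disjoint A F := hC.disjoint.mono_left hAC
  have harc : ∀ z ∈ κ '' Icc e.1 e.2, z ∉ F → z ∈ A := by
    rintro _ ⟨t, ht, rfl⟩ htF
    rcases eq_or_lt_of_le ht.1 with h | h
    · exact h ▸ hp
    rcases eq_or_lt_of_le ht.2 with h' | h'
    · exact h' ▸ hq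
    exact absurd (he.subset ⟨t, ⟨h, h'⟩, rfl⟩) htF
  have hinter : (C ∪ κ '' Icc e'.1 e'.2) ∩ (A ∪ κ '' Icc e.1 e.2) = A := by
    refine Subset.antisymm ?_ fun z hz => ⟨Or.inl (hAC hz), Or.inl hz⟩
    rintro z ⟨hz, hz' | hz'⟩
    · exact hz'
    refine harc z hz' ?_
    rcases hz with hz | ⟨t, ht, rfl⟩
    · exact hC.disjoint.notMem_of_mem_left hz
    · exact he.notMem_of_cut hκ hG hGF hA he' ht fun h => (hGF h).2 hz'
  have hcl : ∀ a b : ℝ, IsClosed (κ '' Icc a b) := fun a b => isClosed_image_Icc hκ.cont.continuousOn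
  have := jan (hC.isClosed.union (hcl _ _)) (hAc.union (hcl _ _)) (by rwa [hinter]) hxy
    ((hG.joinedIn hx hy).mono hG.subset_compl)
  refine this.mono (compl_subset_compl.2 ?_)
  rintro z (hz | hz)
  · refine Or.inr ((hG.closure_subset hz.1).resolve_right fun h => ?_)
    exact hz.2 (by rwa [hG.isOpen.interior_eq])
  · exact Or.inl (Or.inr hz)

end Gap

namespace Config

variable {S T : Type} [MetricSpace S] [IsSph S] [MetricSpace T] [IsSph T] {κ : ℝ → S}
  {D D' : Set S}

/-- The gaps of the curve `κ` in the faces of `c` that separate `D` from the complement of `D'`. -/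
def ess (c : Config S T) (D D' : Set S) (κ : ℝ → S) : Set (ℝ × ℝ) :=
  {e | e.1 ∈ Icc (0 : ℝ) 2 ∧ ∃ P ∈ c.faces, IsGap κ P.1 e ∧ ∃ x ∈ P.1 ∩ D, ∃ y ∈ P.1 \ D',
    ¬ JoinedIn (frontier P.1 ∪ κ '' Icc e.1 e.2)ᶜ x y}

lemma finite_ess (c : Config S T) (hs : Shell D D' κ) (hD : ∃ z ∈ c.rel, z.1 ∈ D)
    (hD' : ∃ z ∈ c.rel, z.1 ∉ D') : (c.ess D D' κ).Finite := by
  have : c.ess D D' κ = ⋃ P ∈ c.faces, {e : ℝ × ℝ | e.1 ∈ Icc (0 : ℝ) 2 ∧ IsGap κ P.1 e ∧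
      ∃ x ∈ P.1 ∩ D, ∃ y ∈ P.1 \ D', ¬ JoinedIn (frontier P.1 ∪ κ '' Icc e.1 e.2)ᶜ x y} := by
    ext e
    simp only [ess, mem_iUnion, Set.mem_ofPred_eq, exists_prop]
    exact ⟨fun ⟨h, P, hP, h'⟩ => ⟨P, hP, h, h'⟩, fun ⟨P, hP, h, h'⟩ => ⟨h, P, hP, h'⟩⟩
  rw [this]
  refine c.finite.biUnion fun P hP => ?_
  by_cases h : ∃ x ∈ P.1 ∩ D, ∃ y ∈ P.1 \ D', True
  · obtain ⟨x, hx, y, hy, -⟩ := h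
    obtain ⟨ξ, hξ⟩ := crosses_of_mem hs c hD hD' hP hx.1 hx.2 hy.1 hy.2
    rw [hξ.isFace.frontier_eq hξ.isLoop.fine]
    exact hξ.finite_gaps hs
  · refine Set.Finite.subset finite_empty ?_
    rintro e ⟨-, -, x, hx, y, hy, -⟩
    exact h ⟨x, hx, y, hy, trivial⟩

lemma exists_ess_ssubset (c : Config S T) (hs : Shell D D' κ) (hD : ∃ z ∈ c.rel, z.1 ∈ D)
    (hD' : ∃ z ∈ c.rel, z.1 ∉ D') {e : ℝ × ℝ} (he : e ∈ c.ess D D' κ) :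
    ∃ d, c.Refines d ∧ d.ess D D' κ ⊂ c.ess D D' κ := by
  obtain ⟨he0, P, hP, hgap, x, hx, y, hy, hxy⟩ := id he
  obtain ⟨ξ, hξ⟩ := crosses_of_mem hs c hD hD' hP hx.1 hx.2 hy.1 hy.2
  have hfr := hξ.isFace.frontier_eq hξ.isLoop.fine
  have hκ := hs.isLoop
  have hlt := hξ.lt_add_one hs hgap
  have hinj := hκ.injOn hlt
  have hle := hgap.lt.le
  have hl : e.1 ∈ Icc e.1 e.2 := left_mem_Icc.2 hle
  have hr : e.2 ∈ Icc e.1 e.2 := right_mem_Icc.2 hle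
  have hα : IsCross P.1 (κ e.1) (κ e.2) fun t => κ (e.1 + (e.2 - e.1) * t) := by
    refine ⟨IsArc.comp_affine hκ.cont.continuousOn hinj hgap.lt.ne hl hr, by simp, by simp, ?_⟩
    intro t ht
    refine hgap.subset ⟨_, ⟨?_, ?_⟩, rfl⟩ <;> nlinarith [ht.1, ht.2, hgap.lt]
  have himg : (fun t => κ (e.1 + (e.2 - e.1) * t)) '' Icc 0 1 = κ '' Icc e.1 e.2 := by
    have := hgap.lt
    apply Subset.antisymm
    · rintro _ ⟨t, ht, rfl⟩
      exact ⟨_, ⟨by nlinarith [ht.1], by nlinarith [ht.2]⟩, rfl⟩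
    · rintro _ ⟨t, ht, rfl⟩
      have h0 : 0 < e.2 - e.1 := by linarith
      refine ⟨(t - e.1) / (e.2 - e.1), ⟨div_nonneg (by linarith [ht.1]) h0.le,
        (div_le_one h0).2 (by linarith [ht.2])⟩, ?_⟩
      simp only
      congr 1
      field_simp
      ring
  have hp : κ e.1 ∈ frontier P.1 := by rw [hfr]; exact hgap.mem hκ hξ.isFace hl hgap.left
  have hq : κ e.2 ∈ frontier P.1 := by rw [hfr]; exact hgap.mem hκ hξ.isFace hr hgap.right
  obtain ⟨d, hcd, hdα, hd⟩ := c.exists_refines_cross hP hp hq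
    (fun h => hgap.lt.ne (hinj hl hr h)) hα
  rw [himg] at hd
  refine ⟨d, hcd, ?_, fun h => ?_⟩
  · rintro e' ⟨h0, Q, hQ, hg', u, hu, v, hv, huv⟩
    rcases hd Q hQ with h | ⟨A, hAP, hAc, hAp, hpA, hqA, hF, hsub⟩
    · exact ⟨h0, Q, h, hg', u, hu, v, hv, huv⟩
    rw [hfr] at hAP
    refine ⟨h0, P, hP, hgap.of_cut hκ hF hsub (hξ.isFace.disjoint.mono_left hAP) hg', u,
      ⟨(hsub hu.1).1, hu.2⟩, v, ⟨(hsub hv.1).1, hv.2⟩, fun h => huv ?_⟩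
    rw [hfr] at h
    exact hgap.joinedIn_of_cut hκ hξ.isFace hF hsub hAP hAc hAp hpA hqA hg' hu.1 hv.1 h
  · obtain ⟨-, Q, hQ, hg', -⟩ := h he
    obtain ⟨y, hy⟩ := hdα (1 / 2) ⟨by norm_num, by norm_num⟩
    refine d.rel_left Q hQ _ hy (hg'.subset ⟨_, ⟨?_, ?_⟩, rfl⟩) <;> linarith [hgap.lt]

lemma exists_refines_shell_of_mem (c : Config S T) (hs : Shell D D' κ)
    (hD : ∃ z ∈ c.rel, z.1 ∈ D) (hD' : ∃ z ∈ c.rel, z.1 ∉ D') :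
    ∃ d, c.Refines d ∧ ∀ P ∈ d.faces, (P.1 ∩ D).Nonempty → P.1 ⊆ D' := by
  induction hn : (c.ess D D' κ).ncard using Nat.strong_induction_on generalizing c with
  | _ n ih =>
  by_cases h : (c.ess D D' κ).Nonempty
  · obtain ⟨e, he⟩ := h
    obtain ⟨d, hcd, hlt⟩ := c.exists_ess_ssubset hs hD hD' he
    obtain ⟨z, hz, hzD⟩ := hD
    obtain ⟨z', hz', hzD'⟩ := hD'
    obtain ⟨d', hd', h'⟩ := ih _ (hn ▸ ncard_lt_ncard hlt
      (c.finite_ess hs ⟨z, hz, hzD⟩ ⟨z', hz', hzD'⟩)) d ⟨z, hcd.rel hz, hzD⟩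
      ⟨z', hcd.rel hz', hzD'⟩ rfl
    exact ⟨d', hcd.trans hd', h'⟩
  · refine ⟨c, .refl c, fun P hP ⟨x, hx⟩ y hy => by_contra fun hyD => h ?_⟩
    obtain ⟨ξ, hξ⟩ := crosses_of_mem hs c hD hD' hP hx.1 hx.2 hy hyD
    obtain ⟨e, he, hg, hn⟩ := hξ.exists_gap hs hx ⟨hy, hyD⟩
    refine ⟨e, he, P, hP, hg, x, hx, y, ⟨hy, hyD⟩, ?_⟩
    rwa [hξ.isFace.frontier_eq hξ.isLoop.fine]

lemma exists_refines_shell (c : Config S T) (hs : Shell D D' κ) (hD' : ∃ z ∈ c.rel, z.1 ∉ D') :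
    ∃ d, c.Refines d ∧ ∀ P ∈ d.faces, (P.1 ∩ D).Nonempty → P.1 ⊆ D' := by
  by_cases hD : ∃ z ∈ c.rel, z.1 ∈ D
  · exact c.exists_refines_shell_of_mem hs hD hD'
  obtain ⟨x, hx⟩ := hs.nontrivial.nonempty
  obtain ⟨P, hP, hxP⟩ := c.cover_left x
  obtain ⟨ξ, μ, hξ, hμ, hrel, hF, hF'⟩ := c.loops P hP
  have hdisj : D ⊆ (range ξ)ᶜ := by
    rintro _ hy ⟨t, rfl⟩
    exact hD ⟨_, hrel t, hy⟩
  have hxF : x ∈ P.1 := (hF.closure_subset hxP).resolve_left (hdisj hx)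
  have hDF : D ⊆ P.1 := fun y hy => hF.mem_of_joinedIn hxF ((hs.joined x hx y hy).mono hdisj)
  have hne : ξ 0 ≠ ξ (1 / 2) := fun h => by
    have := hξ.injOn (a := 0) (b := 1 / 2) (by norm_num) (by simp) (by simp) h
    norm_num at this
  have hfr := hF.frontier_eq hξ.fine
  obtain ⟨α, hα, _, ⟨t, ht, rfl⟩, hz⟩ := hF.exists_isCross_meeting hξ.fine (mem_range_self 0)
    (mem_range_self (1 / 2)) hne hs.isClosed hDF hs.nontrivial hs.joined
  obtain ⟨d, hcd, hdα, -⟩ := c.exists_refines_cross hP (hfr ▸ mem_range_self 0)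
    (hfr ▸ mem_range_self (1 / 2)) hne hα
  obtain ⟨y, hy⟩ := hdα t ht
  obtain ⟨w, hw, hw'⟩ := hD'
  obtain ⟨d', hd', h⟩ := d.exists_refines_shell_of_mem hs ⟨_, hy, hz⟩ ⟨w, hcd.rel hw, hw'⟩
  exact ⟨d', hcd.trans hd', h⟩

lemma exists_refines_shells (c : Config S T) {ι : Type} {s : Set ι} (hfin : s.Finite)
    {D D' : ι → Set S} {κ : ι → ℝ → S} (hs : ∀ i, Shell (D i) (D' i) (κ i))
    (hD' : ∀ i, ∃ z ∈ c.rel, z.1 ∉ D' i) :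
    ∃ d, c.Refines d ∧ ∀ i ∈ s, ∀ P ∈ d.faces, (P.1 ∩ D i).Nonempty → P.1 ⊆ D' i := by
  induction s, hfin using Set.Finite.induction_on with
  | empty => exact ⟨c, .refl c, by simp⟩
  | @insert i s hi hfin ih =>
    obtain ⟨d, hcd, hd⟩ := ih
    obtain ⟨z, hz, hzD⟩ := hD' i
    obtain ⟨d', hdd, hd'⟩ := d.exists_refines_shell (hs i) ⟨z, hcd.rel hz, hzD⟩
    refine ⟨d', hcd.trans hdd, ?_⟩
    rintro j (rfl | hj) Q hQ hQD
    · exact hd' Q hQ hQD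
    · obtain ⟨P, hP, hQP, -⟩ := hdd.faces Q hQ
      exact hQP.trans (hd j hj P hP (hQD.mono (inter_subset_inter_left _ hQP)))

theorem exists_refines_dist (c : Config S T) {ε : ℝ} (hε : 0 < ε) :
    ∃ d, c.Refines d ∧ ∀ P ∈ d.faces, ∀ x ∈ P.1, ∀ y ∈ P.1, dist x y < ε := by
  obtain ⟨x₀⟩ : Nonempty S := inferInstance
  obtain ⟨P, hP, -⟩ := c.cover_left x₀
  obtain ⟨ξ, μ, hξ, hμ, hrel, hF, hF'⟩ := c.loops P hP
  have hne : ξ 0 ≠ ξ (1 / 2) := fun h => by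
    have := hξ.injOn (a := 0) (b := 1 / 2) (by norm_num) (by simp) (by simp) h
    norm_num at this
  have hpt : ∀ x : S, ∃ t, ξ t ≠ x := fun x => by
    by_cases h : ξ 0 = x
    · exact ⟨1 / 2, fun h' => hne (h.trans h'.symm)⟩
    · exact ⟨0, h⟩
  choose t ht using hpt
  have hsh : ∀ x : S, ∃ D D' κ, Shell D D' κ ∧ x ∈ interior D ∧ D ⊆ D' ∧
      D' ⊆ Metric.ball x (ε / 2) ∩ {ξ (t x)}ᶜ := fun x =>
    exists_shell x (Metric.isOpen_ball.inter isOpen_compl_singleton)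
      ⟨Metric.mem_ball_self (by linarith), (ht x).symm⟩
  choose D D' κ hs hinter hDD hsub using hsh
  obtain ⟨s, hcov⟩ := isCompact_univ.elim_finite_subcover (fun x => interior (D x))
    (fun x => isOpen_interior) fun x _ => mem_iUnion.2 ⟨x, hinter x⟩
  obtain ⟨d, hcd, hd⟩ := c.exists_refines_shells s.finite_toSet hs
    fun x => ⟨_, hrel (t x), fun h => (hsub x h).2 rfl⟩
  refine ⟨d, hcd, fun Q hQ x hx y hy => ?_⟩
  obtain ⟨i, hi, hxi⟩ := mem_iUnion₂.1 (hcov (mem_univ x))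
  have hQi := hd i hi Q hQ ⟨x, hx, interior_subset hxi⟩
  have h1 := (hsub i (hQi hx)).1
  have h2 := (hsub i (hQi hy)).1
  rw [Metric.mem_ball] at h1 h2
  linarith [dist_triangle_right x y i]

end Config
end CubicalChain

namespace CubicalChain

open Set Topology unitInterval

lemma nonempty_homeomorph_of_isClosed {S T : Type} [TopologicalSpace S] [CompactSpace S] [T2Space S]
    [TopologicalSpace T] [CompactSpace T] [T2Space T] {K : Set (S × T)} (hK : IsClosed K)
    (h : ∀ x, ∃! y, (x, y) ∈ K) (h' : ∀ y, ∃! x, (x, y) ∈ K) : Nonempty (S ≃ₜ T) := by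
  have : CompactSpace K := isCompact_iff_compactSpace.1 hK.isCompact
  have h1 : Function.Bijective fun z : K => z.1.1 := by
    constructor
    · rintro ⟨⟨x, y⟩, hz⟩ ⟨⟨x', y'⟩, hz'⟩ (rfl : x = x')
      exact Subtype.ext (Prod.ext rfl ((h x).unique hz hz'))
    · intro x
      obtain ⟨y, hy, -⟩ := h x
      exact ⟨⟨_, hy⟩, rfl⟩
  have h2 : Function.Bijective fun z : K => z.1.2 := by
    constructor
    · rintro ⟨⟨x, y⟩, hz⟩ ⟨⟨x', y'⟩, hz'⟩ (rfl : y = y')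
      exact Subtype.ext (Prod.ext ((h' y).unique hz hz') rfl)
    · intro y
      obtain ⟨x, hx, -⟩ := h' y
      exact ⟨⟨_, hx⟩, rfl⟩
  let e1 : K ≃ₜ S := Continuous.homeoOfEquivCompactToT2 (f := Equiv.ofBijective _ h1)
    (continuous_fst.comp continuous_subtype_val)
  let e2 : K ≃ₜ T := Continuous.homeoOfEquivCompactToT2 (f := Equiv.ofBijective _ h2)
    (continuous_snd.comp continuous_subtype_val)
  exact ⟨e1.symm.trans e2⟩

namespace Config

variable {S T : Type} [MetricSpace S] [IsSph S] [MetricSpace T] [IsSph T]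

/-- All faces of `c` have diameter less than `ε`. -/
def Small (c : Config S T) (ε : ℝ) : Prop :=
  ∀ P ∈ c.faces, (∀ x ∈ P.1, ∀ y ∈ P.1, dist x y < ε) ∧ ∀ x ∈ P.2, ∀ y ∈ P.2, dist x y < ε

lemma exists_refines_small (c : Config S T) {ε : ℝ} (hε : 0 < ε) :
    ∃ d, c.Refines d ∧ d.Small ε := by
  obtain ⟨d, hcd, hd⟩ := c.exists_refines_dist hε
  obtain ⟨d', hdd, hd'⟩ := d.swap.exists_refines_dist hε
  have hdd' : d.Refines d'.swap := hdd.swap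
  refine ⟨d'.swap, hcd.trans hdd', fun Q hQ => ⟨fun x hx y hy => ?_, hd' _ hQ⟩⟩
  obtain ⟨P, hP, hQP, -⟩ := hdd'.faces Q hQ
  exact hd P hP x (hQP hx) y (hQP hy)

lemma Small.swap {c : Config S T} {ε : ℝ} (h : c.Small ε) : c.swap.Small ε :=
  fun P hP => (h P.swap hP).symm

lemma exists_mem_closure (c : Config S T) {P Q : Set S × Set T} (hP : P ∈ c.faces)
    (hQ : Q ∈ c.faces) {x : S} (hx : x ∈ closure P.1) (hx' : x ∈ closure Q.1) (hPQ : P ≠ Q) :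
    ∃ y, y ∈ closure P.2 ∧ y ∈ closure Q.2 := by
  obtain ⟨κ, μ, hκ, hμ, hr, hF, hF'⟩ := c.loops P hP
  obtain ⟨κ', μ', hκ', hμ', hr', hG, hG'⟩ := c.loops Q hQ
  have hd := c.disj_left P hP Q hQ hPQ
  obtain ⟨t, rfl⟩ : x ∈ range κ := (hF.closure_subset hx).resolve_right fun h =>
    (hd.closure_right hF.isOpen).notMem_of_mem_left h hx'
  obtain ⟨s, hs⟩ : κ t ∈ range κ' := (hG.closure_subset hx').resolve_right fun h =>
    (hd.closure_left hG.isOpen).notMem_of_mem_left hx h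
  have hμμ : μ' s = μ t := c.inj_left (hs ▸ hr' s) (hr t)
  exact ⟨μ t, hF'.subset_closure hμ.fine (mem_range_self t),
    hG'.subset_closure hμ'.fine (hμμ ▸ mem_range_self s)⟩

lemma Small.dist_le {c : Config S T} {ε : ℝ} (h : c.Small ε) {P : Set S × Set T}
    (hP : P ∈ c.faces) {y y' : T} (hy : y ∈ closure P.2) (hy' : y' ∈ closure P.2) :
    dist y y' ≤ ε := by
  have hsub : P.2 ×ˢ P.2 ⊆ {z : T × T | dist z.1 z.2 ≤ ε} := fun z hz =>
    ((h P hP).2 _ hz.1 _ hz.2).le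
  have hcl := closure_minimal hsub (isClosed_le continuous_dist continuous_const)
  rw [closure_prod_eq] at hcl
  have := hcl (mk_mem_prod hy hy')
  exact this

/-- The pairs of points that lie in the closures of corresponding faces of each of the `c n`. -/
def limit (c : ℕ → Config S T) : Set (S × T) :=
  {z | ∀ n, ∃ P ∈ (c n).faces, z.1 ∈ closure P.1 ∧ z.2 ∈ closure P.2}

lemma isClosed_limit (c : ℕ → Config S T) : IsClosed (limit c) := by
  have : limit c = ⋂ n, ⋃ P ∈ (c n).faces, closure P.1 ×ˢ closure P.2 := by
    ext z
    simp only [limit, mem_iInter, mem_iUnion, mem_prod, exists_prop, Set.mem_ofPred_eq]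
  rw [this]
  exact isClosed_iInter fun n => (c n).finite.isClosed_biUnion fun P _ =>
    isClosed_closure.prod isClosed_closure

lemma mem_limit_swap {c : ℕ → Config S T} {x : S} {y : T} :
    (y, x) ∈ limit (fun n => (c n).swap) ↔ (x, y) ∈ limit c := by
  refine forall_congr' fun n => ⟨?_, ?_⟩
  · rintro ⟨P, hP, h⟩
    exact ⟨P.swap, hP, h.symm⟩
  · rintro ⟨P, hP, h⟩
    exact ⟨P.swap, by simpa [Config.swap] using hP, h.symm⟩

lemma existsUnique_limit {c : ℕ → Config S T} (hc : ∀ n, (c n).Refines (c (n + 1))) {ε : ℕ → ℝ}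
    (hε : Filter.Tendsto ε Filter.atTop (𝓝 0)) (hs : ∀ n, (c n).Small (ε n)) (x : S) :
    ∃! y, (x, y) ∈ limit c := by
  refine existsUnique_of_exists_of_unique ?_ fun y y' hy hy' => ?_
  · have hne := IsCompact.nonempty_iInter_of_sequence_nonempty_isCompact_isClosed
      (fun n => ⋃ P ∈ {P ∈ (c n).faces | x ∈ closure P.1}, closure P.2) ?_ ?_ ?_ ?_
    · obtain ⟨y, hy⟩ := hne
      refine ⟨y, fun n => ?_⟩
      obtain ⟨P, hP, hyP⟩ := mem_iUnion₂.1 (mem_iInter.1 hy n)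
      exact ⟨P, hP.1, hP.2, hyP⟩
    · intro n y hy
      obtain ⟨Q, hQ, hyQ⟩ := mem_iUnion₂.1 hy
      obtain ⟨P, hP, h1, h2⟩ := (hc n).faces Q hQ.1
      exact mem_iUnion₂.2 ⟨P, ⟨hP, closure_mono h1 hQ.2⟩, closure_mono h2 hyQ⟩
    · intro n
      obtain ⟨P, hP, hx⟩ := (c n).cover_left x
      obtain ⟨κ, μ, -, -, -, -, h⟩ := (c n).loops P hP
      obtain ⟨y, hy⟩ := h.nonempty
      exact ⟨y, mem_iUnion₂.2 ⟨P, ⟨hP, hx⟩, subset_closure hy⟩⟩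
    · exact (((c 0).finite.subset fun P hP => hP.1).isClosed_biUnion
        fun P _ => isClosed_closure).isCompact
    · exact fun n => ((c n).finite.subset fun P hP => hP.1).isClosed_biUnion
        fun P _ => isClosed_closure
  · have hle : ∀ n, dist y y' ≤ ε n + ε n := by
      intro n
      obtain ⟨P, hP, hx, hyP⟩ := hy n
      obtain ⟨Q, hQ, hx', hyQ⟩ := hy' n
      by_cases hPQ : P = Q
      · subst hPQ
        have h1 := (hs n).dist_le hP hyP hyQ
        linarith [dist_nonneg (x := y) (y := y')]
      · obtain ⟨w, hw, hw'⟩ := (c n).exists_mem_closure hP hQ hx hx' hPQ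
        linarith [(hs n).dist_le hP hyP hw, (hs n).dist_le hQ hw' hyQ, dist_triangle y w y']
    have h0 : dist y y' ≤ 0 := by
      have := ge_of_tendsto' (hε.add hε) hle
      rwa [add_zero] at this
    exact dist_le_zero.1 h0

end Config

theorem IsSph.nonempty_homeomorph (S T : Type) [MetricSpace S] [IsSph S] [MetricSpace T]
    [IsSph T] : Nonempty (S ≃ₜ T) := by
  obtain ⟨c₀⟩ := Config.nonempty (S := S) (T := T)
  have hstep : ∀ (c : Config S T) (n : ℕ), ∃ d, c.Refines d ∧ d.Small (1 / ((n : ℝ) + 1)) :=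
    fun c n => c.exists_refines_small (by positivity)
  choose f hf hfs using hstep
  let a : ℕ → Config S T := fun n => Nat.rec c₀ (fun n c => f c n) n
  have ha : ∀ n, a (n + 1) = f (a n) n := fun _ => rfl
  let c : ℕ → Config S T := fun n => a (n + 1)
  have hc : ∀ n, (c n).Refines (c (n + 1)) := fun n => by
    simp only [c, ha (n + 1)]
    exact hf _ _
  have hs : ∀ n : ℕ, (c n).Small (1 / ((n : ℝ) + 1)) := fun n => hfs (a n) n
  have hε := tendsto_one_div_add_atTop_nhds_zero_nat (𝕜 := ℝ)
  refine nonempty_homeomorph_of_isClosed (Config.isClosed_limit c)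
    (Config.existsUnique_limit hc hε hs) fun y => ?_
  simpa only [Config.mem_limit_swap] using
    Config.existsUnique_limit (c := fun n => (c n).swap) (fun n => (hc n).swap) hε
      (fun n => (hs n).swap) y

end CubicalChain

/-- **Boundary components of a compact simply connected 3-manifold are 2-spheres.**
Let `X` be a nonempty compact simply connected topological 3-manifold with boundary
(a Hausdorff space locally homeomorphic to open subsets of the half-space, formalized by a
charted space structure modelled on `EuclideanHalfSpace 3`).  Then every connected component
of the boundary `∂X` is homeomorphic to the 2-sphere `S²`. -/
theorem boundary_components_homeomorph_sphere
    (X : Type) [TopologicalSpace X] [T2Space X] [CompactSpace X] [Nonempty X]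
    [SimplyConnectedSpace X] [ChartedSpace (EuclideanHalfSpace 3) X] :
    ∀ x ∈ (modelWithCornersEuclideanHalfSpace 3).boundary X,
      Nonempty
        (↥(connectedComponentIn ((modelWithCornersEuclideanHalfSpace 3).boundary X) x) ≃ₜ
          Metric.sphere (0 : EuclideanSpace ℝ (Fin 3)) 1) := by
  rw [CubicalChain.boundary_eq_bdry]
  intro x hx
  obtain ⟨S, _, hS, ⟨e⟩⟩ := CubicalChain.isSph_component X hx
  have := hS.loc.metrizableSpace
  let := TopologicalSpace.metrizableSpaceMetric S
  have := CubicalChain.isSph_sphere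
  obtain ⟨g⟩ := CubicalChain.IsSph.nonempty_homeomorph S (Metric.sphere (0 : EuclideanSpace ℝ (Fin 3)) 1)
  exact ⟨e.trans g⟩
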